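/- arXiv:1704.08905 — 2 statements merged into one kernel-verified Lean document; each statement's English description precedes it below -/
import Mathlib

section
/- There exists a constant C > 0, depending only on K0, a, δ, m, L0, ρ0, with the following property. Let h ∈ X_{L,ρ} and assume 1/2 ≤ Q[h](y) ≤ 3/2 for all y < Lρ. Then: |R̃[h](x)| ≤ C·ρ·e^{(m+a+2)L}·e^{(m/ρ)(x+Lρ)} for x ≤ −Lρ; |R̃[h](x)| ≤ C·ρ·e^{(a+2)L} for −Lρ < x < Lρ; and |R̃[h](x)| ≤ C·(e^{−aL} + ρ·e^{aL})·e^{−(1/2)(x−Lρ)} for x ≥ Lρ. -/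
open Set MeasureTheory Filter

/-- The weight exponent ω. -/
noncomputable def omegaFn (m L ρ x : ℝ) : ℝ :=
  if x ≤ -(L*ρ) then m/ρ*(x+L*ρ) else if x < L*ρ then 0 else -(1/2)*(x - L*ρ)

/-- The norm on the space X_{L,ρ}. -/
noncomputable def normX (m L ρ : ℝ) (h : ℝ → ℝ) : ℝ :=
  ⨆ x : ℝ, |h x| * Real.exp (-(omegaFn m L ρ x))

/-- Membership in the space X_{L,ρ}. -/
def memX (a m L ρ : ℝ) (h : ℝ → ℝ) : Prop :=
  ContinuousOn h {x : ℝ | x ≠ L*ρ} ∧ (∫ x : ℝ, h x) = 1 ∧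
  (1/ρ) * (∫ x : ℝ, Real.exp (-(a/ρ)*x) * h x) = 1/(1+ρ) ∧
  ∀ x : ℝ, |h x| ≤ 2 * Real.exp (omegaFn m L ρ x)

/-- The hypotheses on the coagulation kernel K. -/
def KernelHyp (K : ℝ → ℝ → ℝ) (γ a K0 δ : ℝ) : Prop :=
  γ < 1 ∧ a = 1 - γ ∧
  ContinuousOn (fun p : ℝ × ℝ => K p.1 p.2) (Ioi 0 ×ˢ Ioi 0) ∧
  (∀ x y : ℝ, 0 < x → 0 < y → 0 ≤ K x y) ∧
  (∀ x y : ℝ, 0 < x → 0 < y → K x y = K y x) ∧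
  (∀ x y α : ℝ, 0 < x → 0 < y → 0 < α → K (α*x) (α*y) = α ^ γ * K x y) ∧
  0 < K0 ∧ δ ∈ Ioo 0 (min 1 a) ∧
  ∀ x ∈ Ioo (0:ℝ) 2, |x ^ a * K x 1 - 1| ≤ K0 * x ^ δ

/-- The hypotheses on the fixed parameters m, L0, ρ0. -/
def ParamHyp (a m L0 ρ0 : ℝ) : Prop :=
  max (a+1) (3*a) < m ∧ (1/a) * Real.log (4*m) < L0 ∧ ρ0 ∈ Ioo (0:ℝ) 1

/-- The function Q[h]. -/
noncomputable def Qfun (K : ℝ → ℝ → ℝ) (a ρ : ℝ) (h : ℝ → ℝ) (y : ℝ) : ℝ :=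
  ∫ z : ℝ, Real.exp (a/ρ*(y-z)) * K (Real.exp ((y-z)/ρ)) 1 * h z

/-- The function ψ_ρ[h]. -/
noncomputable def psiFn (K : ℝ → ℝ → ℝ) (a L ρ : ℝ) (h : ℝ → ℝ) (x : ℝ) : ℝ :=
  (1/ρ) * ∫ y in Ioo x (L*ρ), Real.exp (-(a/ρ)*y) * Qfun K a ρ h y

/-- The remainder R[h]. -/
noncomputable def Rfun (K : ℝ → ℝ → ℝ) (a L ρ : ℝ) (h : ℝ → ℝ) (x : ℝ) : ℝ :=
  if x < L*ρ then
    -(1/ρ) * ∫ y in Iio x, ∫ z in Iio (x + ρ * Real.log (1 - Real.exp ((y-x)/ρ))),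
      Real.exp (-(a/ρ)*z) * K (Real.exp ((y-z)/ρ)) 1 * h y * h z
  else
    -(1/ρ) * (∫ y in Ioi x, Real.exp (-(a/ρ)*y) * h y) * (∫ z in Ioi x, h z)
    + (1/ρ) * (∫ y in Iio x, ∫ z in Ioi x,
        (Real.exp (-(a/ρ)*z) * K (Real.exp ((y-z)/ρ)) 1 - Real.exp (-(a/ρ)*y)) * h y * h z)
    + (1/ρ) * (∫ y in Iio x, ∫ z in Ioo (x + ρ * Real.log (1 - Real.exp ((y-x)/ρ))) x,
        Real.exp (-(a/ρ)*z) * K (Real.exp ((y-z)/ρ)) 1 * h y * h z)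

/-- The remainder R̃[h]. -/
noncomputable def Rtil (K : ℝ → ℝ → ℝ) (a L ρ : ℝ) (h : ℝ → ℝ) (x : ℝ) : ℝ :=
  if x < L*ρ then
    Rfun K a L ρ h x - (1/ρ) * ∫ y in Ioo x (L*ρ),
      Real.exp (-(psiFn K a L ρ h x - psiFn K a L ρ h y)) * Real.exp (-(a/ρ)*y) *
        Qfun K a ρ h y * Rfun K a L ρ h y
  else
    Rfun K a L ρ h x - (1/(1+ρ)) * ∫ y in Ioo (L*ρ) x,
      Real.exp ((y-x)/(1+ρ)) * Rfun K a L ρ h y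

/-- Equation (E) in exponential variables. -/
def solvesE (K : ℝ → ℝ → ℝ) (a ρ : ℝ) (h : ℝ → ℝ) : Prop :=
  ∀ x : ℝ, h x = (1/ρ) * ∫ y in Iio x,
    ∫ z in Ioi (x + ρ * Real.log (1 - Real.exp ((y-x)/ρ))),
      Real.exp (-(a/ρ)*z) * K (Real.exp ((y-z)/ρ)) 1 * h y * h z

/-- The decay exponent λ. -/
noncomputable def lamFn (K : ℝ → ℝ → ℝ) (a L ρ : ℝ) (h : ℝ → ℝ) (x : ℝ) : ℝ :=
  if x < L*ρ then -psiFn K a L ρ h x else -(1/2)*(x - L*ρ)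

/-- The remainder H. -/
noncomputable def Hfun (K : ℝ → ℝ → ℝ) (a ρ : ℝ) (h : ℝ → ℝ) (x : ℝ) : ℝ :=
  (1/ρ) * (∫ y in Iio x, ∫ z in Ioi (x + ρ * Real.log (1 - Real.exp ((y-x)/ρ))),
      Real.exp (-(a/ρ)*z) * K (Real.exp ((y-z)/ρ)) 1 * h y * h z)
    - (ρ/(1+ρ)) * h x - (1/(1+ρ)) * ∫ z in Ioi x, h z


namespace RtilAux

lemma kern_nonneg {K : ℝ → ℝ → ℝ} {γ a K0 δ : ℝ} (hK : KernelHyp K γ a K0 δ) (u : ℝ) :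
    0 ≤ K (Real.exp u) 1 := hK.2.2.2.1 _ _ (Real.exp_pos _) one_pos

lemma kern_k1 {K : ℝ → ℝ → ℝ} {γ a K0 δ : ℝ} (hK : KernelHyp K γ a K0 δ) {u : ℝ} (hu : u ≤ 0) :
    |Real.exp (a*u) * K (Real.exp u) 1 - 1| ≤ K0 * Real.exp (δ*u) := by
  obtain ⟨_, _, _, _, _, _, _, _, h⟩ := hK
  have := h (Real.exp u) ⟨Real.exp_pos _, by
    have : Real.exp u ≤ 1 := Real.exp_le_one_iff.2 hu
    linarith⟩
  rw [← Real.exp_mul, ← Real.exp_mul] at this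
  rw [mul_comm a, mul_comm δ]
  exact this

lemma kern_k2 {K : ℝ → ℝ → ℝ} {γ a K0 δ : ℝ} (hK : KernelHyp K γ a K0 δ) {u : ℝ} (hu : u ≤ 0) :
    K (Real.exp u) 1 ≤ (1+K0) * Real.exp (-(a*u)) := by
  have h1 := kern_k1 hK hu
  obtain ⟨_, _, _, _, _, _, hK0, hδ, _⟩ := hK
  have h2 : Real.exp (δ*u) ≤ 1 := Real.exp_le_one_iff.2 (mul_nonpos_of_nonneg_of_nonpos hδ.1.le hu)
  have h3 : Real.exp (a*u) * K (Real.exp u) 1 ≤ 1 + K0 := by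
    have := (abs_le.1 h1).2
    nlinarith
  have h4 : Real.exp (-(a*u)) * Real.exp (a*u) = 1 := by rw [← Real.exp_add]; simp
  calc K (Real.exp u) 1 = Real.exp (-(a*u)) * (Real.exp (a*u) * K (Real.exp u) 1) := by
        rw [← mul_assoc, h4, one_mul]
    _ ≤ Real.exp (-(a*u)) * (1+K0) := mul_le_mul_of_nonneg_left h3 (Real.exp_pos _).le
    _ = _ := mul_comm _ _

lemma kern_k3 {K : ℝ → ℝ → ℝ} {γ a K0 δ : ℝ} (hK : KernelHyp K γ a K0 δ) {u : ℝ} (hu : 0 ≤ u) :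
    K (Real.exp u) 1 ≤ (1+K0) * Real.exp u := by
  have h1 := kern_k2 hK (u := -u) (by linarith)
  obtain ⟨_, ha, _, _, hs, hh, hK0, hδ, _⟩ := hK
  have h2 := hh 1 (Real.exp (-u)) (Real.exp u) one_pos (Real.exp_pos _) (Real.exp_pos _)
  rw [mul_one, ← Real.exp_add, add_neg_cancel, Real.exp_zero, hs 1 _ one_pos (Real.exp_pos _),
    ← Real.exp_mul] at h2
  rw [h2]
  calc _ ≤ Real.exp (u*γ) * ((1+K0) * Real.exp (-(a * -u))) :=
        mul_le_mul_of_nonneg_left h1 (Real.exp_pos _).le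
    _ = (1+K0) * (Real.exp (u*γ) * Real.exp (-(a * -u))) := by ring
    _ = _ := by rw [← Real.exp_add]; congr 2; rw [ha]; ring

lemma F_nonneg {K : ℝ → ℝ → ℝ} {γ a K0 δ : ℝ} (hK : KernelHyp K γ a K0 δ) (ρ y z : ℝ) :
    0 ≤ Real.exp (-(a/ρ)*z) * K (Real.exp ((y-z)/ρ)) 1 :=
  mul_nonneg (Real.exp_pos _).le (kern_nonneg hK _)

lemma F_le1 {K : ℝ → ℝ → ℝ} {γ a K0 δ : ℝ} (hK : KernelHyp K γ a K0 δ) {ρ y z : ℝ} (hρ : 0 < ρ)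
    (hyz : y ≤ z) :
    Real.exp (-(a/ρ)*z) * K (Real.exp ((y-z)/ρ)) 1 ≤ (1+K0) * Real.exp (-(a/ρ)*y) := by
  have h := kern_k2 hK (u := (y-z)/ρ) (div_nonpos_of_nonpos_of_nonneg (by linarith) hρ.le)
  calc _ ≤ Real.exp (-(a/ρ)*z) * ((1+K0) * Real.exp (-(a*((y-z)/ρ)))) :=
        mul_le_mul_of_nonneg_left h (Real.exp_pos _).le
    _ = (1+K0) * (Real.exp (-(a/ρ)*z) * Real.exp (-(a*((y-z)/ρ)))) := by ring
    _ = _ := by rw [← Real.exp_add]; congr 2; ring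

lemma F_le2 {K : ℝ → ℝ → ℝ} {γ a K0 δ : ℝ} (hK : KernelHyp K γ a K0 δ) {ρ y z : ℝ} (hρ : 0 < ρ)
    (hyz : z ≤ y) :
    Real.exp (-(a/ρ)*z) * K (Real.exp ((y-z)/ρ)) 1 ≤
      (1+K0) * (Real.exp (y/ρ) * Real.exp (-((a+1)/ρ)*z)) := by
  have h := kern_k3 hK (u := (y-z)/ρ) (div_nonneg (by linarith) hρ.le)
  calc _ ≤ Real.exp (-(a/ρ)*z) * ((1+K0) * Real.exp ((y-z)/ρ)) :=
        mul_le_mul_of_nonneg_left h (Real.exp_pos _).le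
    _ = (1+K0) * (Real.exp (-(a/ρ)*z) * Real.exp ((y-z)/ρ)) := by ring
    _ = _ := by rw [← Real.exp_add, ← Real.exp_add]; congr 2; ring

lemma F_le1' {K : ℝ → ℝ → ℝ} {γ a K0 δ : ℝ} (hK : KernelHyp K γ a K0 δ) {ρ y z x : ℝ} (hρ : 0 < ρ)
    (hyz : y ≤ z) (hyx : y ≤ x) :
    Real.exp (-(a/ρ)*z) * K (Real.exp ((y-z)/ρ)) 1 ≤
      (1+K0) * (Real.exp (x/ρ) * Real.exp (-((a+1)/ρ)*y)) := by
  refine (F_le1 hK hρ hyz).trans ?_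
  have : 0 < K0 := hK.2.2.2.2.2.2.1
  rw [← Real.exp_add]
  gcongr
  have : y/ρ ≤ x/ρ := by gcongr
  calc -(a/ρ)*y = y/ρ + (-((a+1)/ρ)*y) := by ring
    _ ≤ _ := by linarith

/-! weights -/
lemma om_left {m L ρ x : ℝ} (hx : x ≤ -(L*ρ)) : omegaFn m L ρ x = m/ρ*(x+L*ρ) := by
  simp [omegaFn, hx]

lemma om_mid {m L ρ x : ℝ} (hx : -(L*ρ) < x) (hx' : x < L*ρ) : omegaFn m L ρ x = 0 := by
  simp [omegaFn, hx, hx']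

lemma om_right {m L ρ x : ℝ} (hL : 0 < L*ρ) (hx' : L*ρ ≤ x) :
    omegaFn m L ρ x = -(1/2)*(x-L*ρ) := by
  have h1 : ¬ x ≤ -(L*ρ) := by linarith
  have h2 : ¬ x < L*ρ := by linarith
  rw [omegaFn, if_neg h1, if_neg h2]

lemma om_nonpos {m L ρ : ℝ} (hL : 0 < L*ρ) (hm : 0 < m/ρ) (x : ℝ) : omegaFn m L ρ x ≤ 0 := by
  rcases le_or_gt x (-(L*ρ)) with h | h
  · rw [om_left h]; exact mul_nonpos_of_nonneg_of_nonpos hm.le (by linarith)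
  rcases lt_or_ge x (L*ρ) with h' | h'
  · rw [om_mid h h']
  · rw [om_right hL h']; linarith

lemma om_le_right {m L ρ : ℝ} (hL : 0 < L*ρ) (hm : 0 < m/ρ) (x : ℝ) :
    omegaFn m L ρ x ≤ -(1/2)*(x-L*ρ) := by
  rcases lt_or_ge x (L*ρ) with h' | h'
  · exact (om_nonpos hL hm x).trans (by linarith)
  · rw [om_right hL h']

lemma om_mono {m L ρ : ℝ} (hL : 0 < L*ρ) (hm : 0 < m/ρ) {x y : ℝ} (hyx : y ≤ x) (hx : x < L*ρ) :
    omegaFn m L ρ y ≤ omegaFn m L ρ x := by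
  rcases le_or_gt x (-(L*ρ)) with h | h
  · rw [om_left h, om_left (hyx.trans h)]; gcongr
  · rw [om_mid h hx]; exact om_nonpos hL hm y

lemma om_meas (m L ρ : ℝ) : Measurable (omegaFn m L ρ) := by
  unfold omegaFn
  refine Measurable.ite measurableSet_Iic (by fun_prop) (Measurable.ite measurableSet_Iio (by fun_prop) (by fun_prop))

lemma phi_ge {a m L ρ : ℝ} (ha : 0 < a) (hρ : 0 < ρ) (hL : 4*m ≤ Real.exp (a*L))
    {x y : ℝ} (hxy : x ≤ y) (hy : y ≤ -(L*ρ)) :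
    2*(m/ρ*(y-x)) ≤ Real.exp (-(a/ρ)*x)/(2*a) - Real.exp (-(a/ρ)*y)/(2*a) := by
  have h1 : Real.exp (a*L) ≤ Real.exp (-(a/ρ)*y) := by
    apply Real.exp_le_exp.2
    have : L ≤ -y/ρ := by rw [le_div_iff₀ hρ]; linarith
    calc a*L ≤ a*(-y/ρ) := by gcongr
      _ = _ := by ring
  have h2 : Real.exp (-(a/ρ)*x) = Real.exp (-(a/ρ)*y) * Real.exp (a/ρ*(y-x)) := by
    rw [← Real.exp_add]; congr 1; ring
  have h3 := Real.add_one_le_exp (a/ρ*(y-x))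
  have h4 : 0 ≤ a/ρ*(y-x) := mul_nonneg (by positivity) (by linarith)
  have h5 : 4*m*(a/ρ*(y-x)) ≤ Real.exp (-(a/ρ)*x) - Real.exp (-(a/ρ)*y) := by
    rw [h2]
    have := Real.exp_pos (-(a/ρ)*y)
    nlinarith
  rw [← sub_div, le_div_iff₀ (by positivity)]
  calc _ = 4*m*(a/ρ*(y-x)) := by ring
    _ ≤ _ := h5

lemma om_phi {a m L ρ : ℝ} (ha : 0 < a) (hρ : 0 < ρ)
    (hL : 4*m ≤ Real.exp (a*L)) {x y : ℝ} (hxy : x ≤ y) (hy : y < L*ρ) :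
    omegaFn m L ρ y ≤ omegaFn m L ρ x +
      (Real.exp (-(a/ρ)*x)/(2*a) - Real.exp (-(a/ρ)*y)/(2*a))/2 := by
  have mono : ∀ {s t : ℝ}, s ≤ t → Real.exp (-(a/ρ)*t)/(2*a) ≤ Real.exp (-(a/ρ)*s)/(2*a) := by
    intro s t hst
    have : 0 < a/ρ := by positivity
    gcongr ?_ / _
    exact Real.exp_le_exp.2 (by nlinarith)
  rcases le_or_gt y (-(L*ρ)) with h | h
  · have := phi_ge ha hρ hL hxy h
    rw [om_left h, om_left (hxy.trans h)]
    have e : m/ρ*(y+L*ρ) = m/ρ*(x+L*ρ) + m/ρ*(y-x) := by ring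
    linarith
  · rw [om_mid h hy]
    rcases le_or_gt x (-(L*ρ)) with h' | h'
    · have := phi_ge ha hρ hL h' le_rfl
      rw [om_left h']
      have e : m/ρ*(-(L*ρ)-x) = - (m/ρ*(x+L*ρ)) := by ring
      have := mono h.le
      linarith
    · rw [om_mid h' (hxy.trans_lt hy)]
      have := mono hxy
      linarith

/-! integrals -/
lemma lint_Iic {c : ℝ} (hc : 0 < c) (x : ℝ) :
    ∫⁻ y in Iic x, ENNReal.ofReal (Real.exp (c*y)) = ENNReal.ofReal (Real.exp (c*x)/c) := by
  rw [← integral_exp_mul_Iic hc x, ofReal_integral_eq_lintegral_ofReal]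
  · exact integrableOn_exp_mul_Iic hc x
  · exact ae_of_all _ fun y => (Real.exp_pos _).le

lemma lint_Ioi {c : ℝ} (hc : 0 < c) (x : ℝ) :
    ∫⁻ y in Ioi x, ENNReal.ofReal (Real.exp (-c*y)) = ENNReal.ofReal (Real.exp (-c*x)/c) := by
  have := integral_exp_mul_Ioi (a := -c) (by linarith) x
  rw [neg_div_neg_eq] at this
  rw [← this, ofReal_integral_eq_lintegral_ofReal]
  · exact integrableOn_exp_mul_Ioi (by linarith) x
  · exact ae_of_all _ fun y => (Real.exp_pos _).le

lemma lint_om {s m L ρ : ℝ} (hs : 0 < s) (hsm : s < m) (hρ : 0 < ρ) (hL : 0 < L*ρ) :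
    ∫⁻ y, ENNReal.ofReal (Real.exp (-(s/ρ)*y) * Real.exp (omegaFn m L ρ y)) ≤
      ENNReal.ofReal (ρ * Real.exp (s*L) * (1/(m-s)+1/s)) := by
  have hms : 0 < m - s := by linarith
  have hm : 0 < m/ρ := div_pos (by linarith) hρ
  rw [← lintegral_add_compl _ (measurableSet_Iic (a := -(L*ρ))), compl_Iic]
  have e1 : ∫⁻ y in Iic (-(L*ρ)), ENNReal.ofReal (Real.exp (-(s/ρ)*y) * Real.exp (omegaFn m L ρ y))
      = ENNReal.ofReal (ρ * Real.exp (s*L) * (1/(m-s))) := by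
    have hc : 0 < (m-s)/ρ := by positivity
    calc _ = ∫⁻ y in Iic (-(L*ρ)), ENNReal.ofReal (Real.exp (m*L)) * ENNReal.ofReal (Real.exp ((m-s)/ρ*y)) := by
          refine setLIntegral_congr_fun measurableSet_Iic fun y hy => ?_
          rw [om_left hy, ← ENNReal.ofReal_mul (Real.exp_pos _).le, ← Real.exp_add, ← Real.exp_add]
          congr 2; field_simp; ring
      _ = _ := by
          rw [lintegral_const_mul _ (by fun_prop), lint_Iic hc, ← ENNReal.ofReal_mul (Real.exp_pos _).le]
          congr 1
          rw [mul_div_assoc', ← Real.exp_add]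
          have : m*L + (m-s)/ρ * -(L*ρ) = s*L := by field_simp; ring
          rw [this]; field_simp
  have e2 : ∫⁻ y in Ioi (-(L*ρ)), ENNReal.ofReal (Real.exp (-(s/ρ)*y) * Real.exp (omegaFn m L ρ y))
      ≤ ENNReal.ofReal (ρ * Real.exp (s*L) * (1/s)) := by
    have hc : 0 < s/ρ := by positivity
    calc _ ≤ ∫⁻ y in Ioi (-(L*ρ)), ENNReal.ofReal (Real.exp (-(s/ρ)*y)) := by
          refine lintegral_mono fun y => ENNReal.ofReal_le_ofReal ?_
          exact mul_le_of_le_one_right (Real.exp_pos _).le (Real.exp_le_one_iff.2 (om_nonpos hL hm y))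
      _ = _ := by
          rw [lint_Ioi hc]
          congr 1
          have : -(s/ρ) * -(L*ρ) = s*L := by field_simp
          rw [this]; field_simp
  rw [e1, mul_add (ρ * Real.exp (s*L)), ENNReal.ofReal_add (by positivity) (by positivity)]
  gcongr

lemma abs_int_le {α : Type*} [MeasurableSpace α] {μ : Measure α} {f : α → ℝ} {c : ℝ} (hc : 0 ≤ c)
    (h : ∫⁻ x, ENNReal.ofReal |f x| ∂μ ≤ ENNReal.ofReal c) : |∫ x, f x ∂μ| ≤ c := by
  have h1 := enorm_integral_le_lintegral_enorm (μ := μ) f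
  have h2 : ∀ r : ℝ, ‖r‖ₑ = ENNReal.ofReal |r| := fun r => by
    rw [← Real.norm_eq_abs, ofReal_norm]
  simp only [h2] at h1
  exact (ENNReal.ofReal_le_ofReal_iff hc).1 (h1.trans h)

lemma abs_int_le_set {S : Set ℝ} (hS : MeasurableSet S) {f g : ℝ → ℝ} {c : ℝ} (hc : 0 ≤ c)
    (hfg : ∀ x ∈ S, |f x| ≤ g x)
    (h : ∫⁻ x in S, ENNReal.ofReal (g x) ≤ ENNReal.ofReal c) : |∫ x in S, f x| ≤ c :=
  abs_int_le hc ((setLIntegral_mono' hS fun x hx => ENNReal.ofReal_le_ofReal (hfg x hx)).trans h)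

lemma abs_int2_le {S : Set ℝ} (hS : MeasurableSet S) {T : ℝ → Set ℝ} (hT : ∀ y, MeasurableSet (T y))
    {f g : ℝ → ℝ → ℝ} {c : ℝ} (hc : 0 ≤ c)
    (hfg : ∀ y ∈ S, ∀ z ∈ T y, |f y z| ≤ g y z)
    (h : ∫⁻ y in S, ∫⁻ z in T y, ENNReal.ofReal (g y z) ≤ ENNReal.ofReal c) :
    |∫ y in S, ∫ z in T y, f y z| ≤ c := by
  refine abs_int_le hc (le_trans (setLIntegral_mono' hS fun y hy => ?_) h)
  have h1 := enorm_integral_le_lintegral_enorm (μ := volume.restrict (T y)) (f y)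
  have h2 : ∀ r : ℝ, ‖r‖ₑ = ENNReal.ofReal |r| := fun r => by
    rw [← Real.norm_eq_abs, ofReal_norm]
  simp only [h2] at h1
  exact h1.trans (setLIntegral_mono' (hT y) fun x hx => ENNReal.ofReal_le_ofReal (hfg y hy x hx))

lemma log_le0 {x y ρ : ℝ} (hρ : 0 < ρ) (hy : y < x) :
    x + ρ * Real.log (1 - Real.exp ((y-x)/ρ)) ≤ x := by
  have h1 : Real.exp ((y-x)/ρ) < 1 := Real.exp_lt_one_iff.2 (div_neg_of_neg_of_pos (by linarith) hρ)
  have := Real.log_nonpos (x := 1 - Real.exp ((y-x)/ρ)) (by linarith) (by linarith [Real.exp_pos ((y-x)/ρ)])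
  nlinarith

lemma hh_le {m L ρ : ℝ} {h : ℝ → ℝ} (hb : ∀ x : ℝ, |h x| ≤ 2 * Real.exp (omegaFn m L ρ x)) (y z : ℝ) :
    |h y| * |h z| ≤ 4 * (Real.exp (omegaFn m L ρ y) * Real.exp (omegaFn m L ρ z)) := by
  calc _ ≤ (2 * Real.exp (omegaFn m L ρ y)) * (2 * Real.exp (omegaFn m L ρ z)) :=
        mul_le_mul (hb y) (hb z) (abs_nonneg _) (by positivity)
    _ = _ := by ring

end RtilAux

namespace RtilAux

lemma prod_lint {S : Set ℝ} {A B : ℝ → ℝ} (hA : Measurable A) (hB : Measurable B)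
    (hA0 : ∀ y, 0 ≤ A y) (hB0 : ∀ y, 0 ≤ B y) {k cA cB : ℝ} (hk : 0 ≤ k) (hcA : 0 ≤ cA) (hcB : 0 ≤ cB)
    (hIA : ∫⁻ y in S, ENNReal.ofReal (A y) ≤ ENNReal.ofReal cA)
    (hIB : ∫⁻ y in S, ENNReal.ofReal (B y) ≤ ENNReal.ofReal cB) :
    ∫⁻ y in S, ∫⁻ z in S, ENNReal.ofReal (k * (A y * B z + B y * A z)) ≤
      ENNReal.ofReal (2 * k * cA * cB) := by
  have e : ∀ y z, ENNReal.ofReal (k * (A y * B z + B y * A z)) =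
      ENNReal.ofReal k * (ENNReal.ofReal (A y) * ENNReal.ofReal (B z)
        + ENNReal.ofReal (B y) * ENNReal.ofReal (A z)) := by
    intro y z
    rw [ENNReal.ofReal_mul hk, ENNReal.ofReal_add (mul_nonneg (hA0 _) (hB0 _)) (mul_nonneg (hB0 _) (hA0 _)),
      ENNReal.ofReal_mul (hA0 _), ENNReal.ofReal_mul (hB0 _)]
  simp only [e]
  have hA' : Measurable fun y => ENNReal.ofReal (A y) := hA.ennreal_ofReal
  have hB' : Measurable fun y => ENNReal.ofReal (B y) := hB.ennreal_ofReal
  have e1 : ∀ y, ∫⁻ z in S, ENNReal.ofReal k * (ENNReal.ofReal (A y) * ENNReal.ofReal (B z)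
        + ENNReal.ofReal (B y) * ENNReal.ofReal (A z)) =
      ENNReal.ofReal k * (ENNReal.ofReal (A y) * (∫⁻ z in S, ENNReal.ofReal (B z))
        + ENNReal.ofReal (B y) * (∫⁻ z in S, ENNReal.ofReal (A z))) := by
    intro y
    rw [lintegral_const_mul _ (by fun_prop), lintegral_add_left (by fun_prop),
      lintegral_const_mul _ (by fun_prop), lintegral_const_mul _ (by fun_prop)]
  simp only [e1]
  rw [lintegral_const_mul _ (by fun_prop), lintegral_add_left (by fun_prop),
      lintegral_mul_const _ (by fun_prop), lintegral_mul_const _ (by fun_prop)]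
  calc _ ≤ ENNReal.ofReal k * (ENNReal.ofReal cA * ENNReal.ofReal cB + ENNReal.ofReal cB * ENNReal.ofReal cA) := by
        gcongr
    _ = _ := by
        rw [← ENNReal.ofReal_mul hcA, ← ENNReal.ofReal_mul hcB, ← ENNReal.ofReal_add (by positivity) (by positivity),
          ← ENNReal.ofReal_mul hk]
        congr 1; ring

lemma R_left {K : ℝ → ℝ → ℝ} {γ a K0 δ m L ρ : ℝ} {h : ℝ → ℝ} (hK : KernelHyp K γ a K0 δ)
    (ha : 0 < a) (ham : a + 1 < m) (hρ : 0 < ρ) (hL : 0 < L)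
    (hb : ∀ x : ℝ, |h x| ≤ 2 * Real.exp (omegaFn m L ρ x)) {x : ℝ} (hx : x < L*ρ) :
    |Rfun K a L ρ h x| ≤ (8*(1+K0)*(1/(m-(a+1))+1/(a+1))) * ρ * Real.exp ((a+2)*L)
      * Real.exp (omegaFn m L ρ x) := by
  have hK0 : 0 < K0 := hK.2.2.2.2.2.2.1
  have hLρ : 0 < L*ρ := by positivity
  have hm : 0 < m/ρ := div_pos (by linarith) hρ
  have hms : 0 < m - (a+1) := by linarith
  have hom := om_meas m L ρ
  have key := abs_int2_le (S := Iio x) measurableSet_Iio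
    (T := fun y => Iio (x + ρ * Real.log (1 - Real.exp ((y-x)/ρ)))) (fun _ => measurableSet_Iio)
    (f := fun y z => Real.exp (-(a/ρ)*z) * K (Real.exp ((y-z)/ρ)) 1 * h y * h z)
    (g := fun y z => (4*(1+K0)) *
      ((Real.exp (-((a+1)/ρ)*y) * Real.exp (omegaFn m L ρ y)) * (Real.exp (1/ρ*z) * Real.exp (omegaFn m L ρ x))
      + (Real.exp (1/ρ*y) * Real.exp (omegaFn m L ρ x)) * (Real.exp (-((a+1)/ρ)*z) * Real.exp (omegaFn m L ρ z))))
    (c := 2 * (4*(1+K0)) * (ρ * Real.exp ((a+1)*L) * (1/(m-(a+1))+1/(a+1))) *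
      (ρ * Real.exp L * Real.exp (omegaFn m L ρ x))) (by positivity) ?_ ?_
  · rw [Rfun, if_pos hx, abs_mul, abs_neg, abs_of_pos (by positivity : 0 < 1/ρ)]
    refine (mul_le_mul_of_nonneg_left key (by positivity)).trans (le_of_eq ?_)
    have : Real.exp ((a+2)*L) = Real.exp ((a+1)*L) * Real.exp L := by
      rw [← Real.exp_add]; congr 1; ring
    rw [this]
    field_simp
    try ring
  · intro y hy z hz
    have hyx : y < x := hy
    have hzx : z < x := lt_of_lt_of_le hz (log_le0 hρ hyx)
    rw [abs_mul, abs_mul, abs_of_nonneg (F_nonneg hK ρ y z), mul_assoc]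
    have hh := hh_le hb y z
    have oy := Real.exp_le_exp.2 (om_mono hLρ hm hyx.le hx)
    have oz := Real.exp_le_exp.2 (om_mono hLρ hm hzx.le hx)
    rcases le_total y z with hyz | hyz
    · have hF := F_le1' hK hρ hyz hyz
      calc _ ≤ ((1+K0) * (Real.exp (z/ρ) * Real.exp (-((a+1)/ρ)*y))) *
            (4 * (Real.exp (omegaFn m L ρ y) * Real.exp (omegaFn m L ρ z))) :=
            mul_le_mul hF hh (by positivity) (by positivity)
        _ ≤ ((1+K0) * (Real.exp (z/ρ) * Real.exp (-((a+1)/ρ)*y))) *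
            (4 * (Real.exp (omegaFn m L ρ y) * Real.exp (omegaFn m L ρ x))) := by gcongr
        _ = (4*(1+K0)) * ((Real.exp (-((a+1)/ρ)*y) * Real.exp (omegaFn m L ρ y)) *
              (Real.exp (1/ρ*z) * Real.exp (omegaFn m L ρ x))) := by
            rw [show 1/ρ*z = z/ρ by ring]; ring
        _ ≤ _ := by
            apply mul_le_mul_of_nonneg_left _ (by positivity)
            exact le_add_of_nonneg_right (by positivity)
    · have hF := F_le2 hK hρ hyz
      calc _ ≤ ((1+K0) * (Real.exp (y/ρ) * Real.exp (-((a+1)/ρ)*z))) *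
            (4 * (Real.exp (omegaFn m L ρ y) * Real.exp (omegaFn m L ρ z))) :=
            mul_le_mul hF hh (by positivity) (by positivity)
        _ ≤ ((1+K0) * (Real.exp (y/ρ) * Real.exp (-((a+1)/ρ)*z))) *
            (4 * (Real.exp (omegaFn m L ρ x) * Real.exp (omegaFn m L ρ z))) := by gcongr
        _ = (4*(1+K0)) * ((Real.exp (1/ρ*y) * Real.exp (omegaFn m L ρ x)) *
              (Real.exp (-((a+1)/ρ)*z) * Real.exp (omegaFn m L ρ z))) := by
            rw [show 1/ρ*y = y/ρ by ring]; ring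
        _ ≤ _ := by
            apply mul_le_mul_of_nonneg_left _ (by positivity)
            exact le_add_of_nonneg_left (by positivity)
  · refine le_trans ?_ (prod_lint (S := Iic x)
      (A := fun y => Real.exp (-((a+1)/ρ)*y) * Real.exp (omegaFn m L ρ y))
      (B := fun z => Real.exp (1/ρ*z) * Real.exp (omegaFn m L ρ x)) (by fun_prop) (by fun_prop)
      (fun y => by positivity) (fun y => by positivity) (by positivity) (by positivity) (by positivity)
      ?_ ?_)
    · refine (setLIntegral_mono' measurableSet_Iio fun y hy => ?_).trans
        (lintegral_mono_set Iio_subset_Iic_self)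
      exact lintegral_mono_set fun z hz => (lt_of_lt_of_le hz (log_le0 hρ hy)).le
    · exact (setLIntegral_le_lintegral _ _).trans (lint_om (by linarith) ham hρ hLρ)
    · simp only [ENNReal.ofReal_mul (Real.exp_pos _).le]
      rw [lintegral_mul_const _ (by fun_prop), lint_Iic (by positivity),
        ENNReal.ofReal_mul (by positivity)]
      gcongr
      have : 1/ρ*x ≤ L := by rw [one_div, inv_mul_le_iff₀ hρ]; linarith
      calc _ = ρ * Real.exp (1/ρ*x) := by field_simp
        _ ≤ _ := by gcongr

end RtilAux

namespace RtilAux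

lemma Q_meas {K : ℝ → ℝ → ℝ} {γ a K0 δ ρ : ℝ} {h : ℝ → ℝ} (hK : KernelHyp K γ a K0 δ)
    (hh : Measurable h) : StronglyMeasurable (Qfun K a ρ h) := by
  have hc := hK.2.2.1
  have h1 : Continuous fun p : ℝ × ℝ => K (Real.exp ((p.1-p.2)/ρ)) 1 := by
    have : Continuous fun p : ℝ × ℝ => ((Real.exp ((p.1-p.2)/ρ), (1:ℝ)) : ℝ × ℝ) := by fun_prop
    exact hc.comp_continuous this fun p => ⟨Real.exp_pos _, (one_pos : (0:ℝ) < 1)⟩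
  have h2 : StronglyMeasurable fun p : ℝ × ℝ =>
      Real.exp (a/ρ*(p.1-p.2)) * K (Real.exp ((p.1-p.2)/ρ)) 1 * h p.2 := by
    have := h1.measurable
    apply Measurable.stronglyMeasurable
    exact ((by fun_prop : Measurable fun p : ℝ × ℝ => Real.exp (a/ρ*(p.1-p.2))).mul this).mul
      (hh.comp measurable_snd)
  exact h2.integral_prod_right

lemma psi_diff {K : ℝ → ℝ → ℝ} {γ a K0 δ L ρ : ℝ} {h : ℝ → ℝ} (hK : KernelHyp K γ a K0 δ)
    (hh : Measurable h) (ha : 0 < a) (hρ : 0 < ρ)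
    (hQ : ∀ y : ℝ, y < L*ρ → Qfun K a ρ h y ∈ Icc (1/2:ℝ) (3/2)) {x y : ℝ} (hxy : x ≤ y)
    (hy : y < L*ρ) :
    Real.exp (-(a/ρ)*x)/(2*a) - Real.exp (-(a/ρ)*y)/(2*a) ≤ psiFn K a L ρ h x - psiFn K a L ρ h y := by
  have hce : Continuous fun s : ℝ => Real.exp (-(a/ρ)*s) := by fun_prop
  have hI : ∀ t, IntegrableOn (fun s => Real.exp (-(a/ρ)*s) * Qfun K a ρ h s) (Ioo t (L*ρ)) := by
    intro t
    have h1 : IntegrableOn (fun s : ℝ => Real.exp (-(a/ρ)*s)) (Ioo t (L*ρ)) :=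
      (hce.integrableOn_Icc).mono_set Ioo_subset_Icc_self
    refine Integrable.mul_bdd (c := 3/2) h1 (Q_meas hK hh).aestronglyMeasurable ?_
    refine (ae_restrict_iff' measurableSet_Ioo).2 (ae_of_all _ fun s hs => ?_)
    have := hQ s hs.2
    rw [Real.norm_eq_abs, abs_le]
    constructor <;> linarith [this.1, this.2]
  have hu : Ioo x (L*ρ) = Ioc x y ∪ Ioo y (L*ρ) := (Ioc_union_Ioo_eq_Ioo hxy hy).symm
  have hs1 : IntegrableOn (fun s => Real.exp (-(a/ρ)*s) * Qfun K a ρ h s) (Ioc x y) :=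
    (hI x).mono_set (by rw [hu]; exact subset_union_left)
  have e1 : psiFn K a L ρ h x - psiFn K a L ρ h y =
      (1/ρ) * ∫ s in Ioc x y, Real.exp (-(a/ρ)*s) * Qfun K a ρ h s := by
    unfold psiFn
    rw [hu, setIntegral_union _ measurableSet_Ioo hs1 (hI y)]
    · ring
    · rw [Set.disjoint_left]; intro s hs hs'; exact absurd hs.2 (not_le.2 hs'.1)
  have e2 : ∫ s in Ioc x y, Real.exp (-(a/ρ)*s) * (1/2) ≤
      ∫ s in Ioc x y, Real.exp (-(a/ρ)*s) * Qfun K a ρ h s := by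
    refine setIntegral_mono_on ?_ hs1 measurableSet_Ioc fun s hs => ?_
    · exact ((hce.mul continuous_const).integrableOn_Icc).mono_set Ioc_subset_Icc_self
    · exact mul_le_mul_of_nonneg_left (hQ s (hs.2.trans_lt hy)).1 (Real.exp_pos _).le
  have e3 : ∫ s in Ioc x y, Real.exp (-(a/ρ)*s) * (1/2) =
      (-ρ/(2*a)) * Real.exp (-(a/ρ)*y) - (-ρ/(2*a)) * Real.exp (-(a/ρ)*x) := by
    rw [← intervalIntegral.integral_of_le hxy]
    refine intervalIntegral.integral_eq_sub_of_hasDerivAt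
      (f := fun s => (-ρ/(2*a)) * Real.exp (-(a/ρ)*s)) (fun s _ => ?_) ?_
    · have := (((hasDerivAt_id' s).const_mul (-(a/ρ))).exp).const_mul (-ρ/(2*a))
      refine this.congr_deriv ?_
      field_simp
    · exact (hce.mul continuous_const).intervalIntegrable _ _
  rw [e1]
  rw [e3] at e2
  calc _ = (1/ρ) * ((-ρ/(2*a)) * Real.exp (-(a/ρ)*y) - (-ρ/(2*a)) * Real.exp (-(a/ρ)*x)) := by
        field_simp; ring
    _ ≤ _ := mul_le_mul_of_nonneg_left e2 (by positivity)

lemma lint_phi {a ρ : ℝ} (ha : 0 < a) (hρ : 0 < ρ) {x b : ℝ} (hxb : x ≤ b) :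
    ∫⁻ y in Ioo x b, ENNReal.ofReal (Real.exp (-(a/ρ)*y) *
      Real.exp (-((Real.exp (-(a/ρ)*x)/(2*a) - Real.exp (-(a/ρ)*y)/(2*a))/2))) ≤ ENNReal.ofReal (4*ρ) := by
  have hc : Continuous fun y : ℝ => Real.exp (-(a/ρ)*y) *
      Real.exp (-((Real.exp (-(a/ρ)*x)/(2*a) - Real.exp (-(a/ρ)*y)/(2*a))/2)) := by fun_prop
  rw [← ofReal_integral_eq_lintegral_ofReal]
  · apply ENNReal.ofReal_le_ofReal
    rw [← integral_Ioc_eq_integral_Ioo, ← intervalIntegral.integral_of_le hxb]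
    rw [intervalIntegral.integral_eq_sub_of_hasDerivAt
      (f := fun y => (-4*ρ) * Real.exp (-((Real.exp (-(a/ρ)*x)/(2*a) - Real.exp (-(a/ρ)*y)/(2*a))/2)))]
    · have : 0 ≤ ρ * Real.exp (-((Real.exp (-(a/ρ)*x)/(2*a) - Real.exp (-(a/ρ)*b)/(2*a))/2)) := by positivity
      simp only [sub_self, zero_div, neg_zero, Real.exp_zero]
      linarith
    · intro s _
      have h1 := (((hasDerivAt_id' s).const_mul (-(a/ρ))).exp).div_const (2*a)
      have h2 := ((((h1.const_sub (Real.exp (-(a/ρ)*x)/(2*a))).div_const 2).fun_neg).exp).const_mul (-4*ρ)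
      refine h2.congr_deriv ?_
      field_simp
      try ring
    · exact hc.intervalIntegrable _ _
  · exact (hc.integrableOn_Icc).mono_set Ioo_subset_Icc_self
  · exact ae_of_all _ fun y => by positivity

lemma Rtil_left {K : ℝ → ℝ → ℝ} {γ a K0 δ m L ρ : ℝ} {h : ℝ → ℝ} (hK : KernelHyp K γ a K0 δ)
    (hh : Measurable h)
    (ha : 0 < a) (ham : a + 1 < m) (hρ : 0 < ρ) (hL : 0 < L) (hL4 : 4*m ≤ Real.exp (a*L))
    (hb : ∀ x : ℝ, |h x| ≤ 2 * Real.exp (omegaFn m L ρ x))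
    (hQ : ∀ y : ℝ, y < L*ρ → Qfun K a ρ h y ∈ Icc (1/2:ℝ) (3/2)) {x : ℝ} (hx : x < L*ρ) :
    |Rtil K a L ρ h x| ≤ 7 * ((8*(1+K0)*(1/(m-(a+1))+1/(a+1))) * ρ * Real.exp ((a+2)*L)
      * Real.exp (omegaFn m L ρ x)) := by
  have hK0 : 0 < K0 := hK.2.2.2.2.2.2.1
  have hms : 0 < m - (a+1) := by linarith
  obtain ⟨M, hM⟩ : ∃ M, M = (8*(1+K0)*(1/(m-(a+1))+1/(a+1))) * ρ * Real.exp ((a+2)*L) := ⟨_, rfl⟩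
  have hM0 : 0 ≤ M := by rw [hM]; positivity
  have hR : ∀ y, y < L*ρ → |Rfun K a L ρ h y| ≤ M * Real.exp (omegaFn m L ρ y) := by
    intro y hy; rw [hM]; exact R_left hK ha ham hρ hL hb hy
  rw [← hM]
  have key := abs_int_le_set (S := Ioo x (L*ρ)) measurableSet_Ioo
    (f := fun y => Real.exp (-(psiFn K a L ρ h x - psiFn K a L ρ h y)) * Real.exp (-(a/ρ)*y) *
        Qfun K a ρ h y * Rfun K a L ρ h y)
    (g := fun y => (3/2*M*Real.exp (omegaFn m L ρ x)) * (Real.exp (-(a/ρ)*y) *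
      Real.exp (-((Real.exp (-(a/ρ)*x)/(2*a) - Real.exp (-(a/ρ)*y)/(2*a))/2))))
    (c := (3/2*M*Real.exp (omegaFn m L ρ x)) * (4*ρ)) (by positivity) ?_ ?_
  · rw [Rtil, if_pos hx]
    refine (abs_sub _ _).trans ?_
    rw [abs_mul, abs_of_pos (by positivity : 0 < 1/ρ)]
    have h1 := hR x hx
    have h2 := mul_le_mul_of_nonneg_left key (by positivity : 0 ≤ 1/ρ)
    have h3 : 1/ρ * ((3/2*M*Real.exp (omegaFn m L ρ x)) * (4*ρ)) = 6 * (M*Real.exp (omegaFn m L ρ x)) := by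
      field_simp; ring
    linarith
  · intro y hy
    have h1 := psi_diff hK hh ha hρ hQ hy.1.le hy.2
    have h2 := om_phi (m := m) ha hρ hL4 hy.1.le hy.2
    have h3 := hQ y hy.2
    have h4 := hR y hy.2
    rw [abs_mul, abs_mul, abs_of_nonneg (by positivity :
      0 ≤ Real.exp (-(psiFn K a L ρ h x - psiFn K a L ρ h y)) * Real.exp (-(a/ρ)*y)),
      abs_of_nonneg (by linarith [h3.1] : 0 ≤ Qfun K a ρ h y)]
    calc _ ≤ Real.exp (-(Real.exp (-(a/ρ)*x)/(2*a) - Real.exp (-(a/ρ)*y)/(2*a))) * Real.exp (-(a/ρ)*y)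
          * (3/2) * (M * Real.exp (omegaFn m L ρ x +
      (Real.exp (-(a/ρ)*x)/(2*a) - Real.exp (-(a/ρ)*y)/(2*a))/2)) := by
          refine mul_le_mul (mul_le_mul ?_ h3.2 (by linarith [h3.1]) (by positivity)) ?_ (abs_nonneg _) (by positivity)
          · gcongr
          · exact h4.trans (by gcongr)
      _ = _ := by
          rw [Real.exp_add]
          have : Real.exp (-((Real.exp (-(a/ρ)*x)/(2*a) - Real.exp (-(a/ρ)*y)/(2*a))/2)) =
            Real.exp (-(Real.exp (-(a/ρ)*x)/(2*a) - Real.exp (-(a/ρ)*y)/(2*a))) *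
            Real.exp ((Real.exp (-(a/ρ)*x)/(2*a) - Real.exp (-(a/ρ)*y)/(2*a))/2) := by
            rw [← Real.exp_add]; congr 1; ring
          rw [this]; ring
  · have hk : 0 ≤ 3/2*M*Real.exp (omegaFn m L ρ x) := by positivity
    simp only [ENNReal.ofReal_mul hk]
    rw [lintegral_const_mul _ (by fun_prop)]
    gcongr
    exact lint_phi ha hρ hx.le

end RtilAux

namespace RtilAux

lemma geo {x y z ρ : ℝ} (hρ : 0 < ρ) (hyz : y ≤ z)
    (h1 : 1 < Real.exp ((z-x)/ρ) + Real.exp ((y-x)/ρ)) : x - 2*ρ*Real.exp ((y-x)/ρ) ≤ z := by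
  have hts : Real.exp ((y-x)/ρ) ≤ Real.exp ((z-x)/ρ) := Real.exp_le_exp.2 (by gcongr)
  have ht := Real.exp_pos ((y-x)/ρ)
  have hs := Real.exp_pos ((z-x)/ρ)
  have h2 := Real.add_one_le_exp (-((z-x)/ρ))
  rw [Real.exp_neg] at h2
  have h3 : (Real.exp ((z-x)/ρ))⁻¹ ≤ 1 + 2 * Real.exp ((y-x)/ρ) := by
    rw [inv_le_iff_one_le_mul₀ hs]
    nlinarith
  have h4 : -(2*Real.exp ((y-x)/ρ)) ≤ (z-x)/ρ := by linarith
  rw [le_div_iff₀ hρ] at h4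
  linarith

lemma geo0 {x y z ρ : ℝ} (hρ : 0 < ρ) (hy : y < x)
    (hz : x + ρ * Real.log (1 - Real.exp ((y-x)/ρ)) < z) :
    1 < Real.exp ((z-x)/ρ) + Real.exp ((y-x)/ρ) := by
  have h1 : Real.exp ((y-x)/ρ) < 1 := Real.exp_lt_one_iff.2 (div_neg_of_neg_of_pos (by linarith) hρ)
  have h2 : Real.log (1 - Real.exp ((y-x)/ρ)) < (z-x)/ρ := by
    rw [lt_div_iff₀ hρ]; linarith
  have := (Real.log_lt_iff_lt_exp (by linarith)).1 h2
  linarith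

lemma exp_tail {m L ρ x y z : ℝ} {h : ℝ → ℝ} (hLρ : 0 < L*ρ) (hm : 0 < m/ρ) (hρ : 0 < ρ) (hρ1 : ρ < 1)
    (hb : ∀ x : ℝ, |h x| ≤ 2 * Real.exp (omegaFn m L ρ x)) (hy : y < x)
    (hz : x - 2*ρ*Real.exp ((y-x)/ρ) ≤ z) :
    |h z| ≤ 2 * (Real.exp 1 * Real.exp (-(1/2)*(x-L*ρ))) := by
  refine (hb z).trans ?_
  rw [← Real.exp_add]
  have h1 : Real.exp ((y-x)/ρ) < 1 := Real.exp_lt_one_iff.2 (div_neg_of_neg_of_pos (by linarith) hρ)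
  have h0 := Real.exp_pos ((y-x)/ρ)
  have h2 : ρ * Real.exp ((y-x)/ρ) ≤ 1 := by nlinarith
  gcongr
  refine (om_le_right hLρ hm z).trans ?_
  linarith

lemma T1 {a m L ρ : ℝ} {h : ℝ → ℝ}
    (ha : 0 < a) (hm : 0 < m/ρ) (hρ : 0 < ρ) (hL : 0 < L)
    (hb : ∀ x : ℝ, |h x| ≤ 2 * Real.exp (omegaFn m L ρ x)) {x : ℝ} (hx : L*ρ ≤ x) :
    |-(1/ρ) * (∫ y in Ioi x, Real.exp (-(a/ρ)*y) * h y) * (∫ z in Ioi x, h z)| ≤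
      8/a * Real.exp (-a*L) * Real.exp (-(1/2)*(x-L*ρ)) := by
  have hLρ : 0 < L*ρ := by positivity
  have hy : ∀ y ∈ Ioi x, |h y| ≤ 2 * Real.exp (-(1/2)*(y-L*ρ)) := fun y _ =>
    (hb y).trans (mul_le_mul_of_nonneg_left (Real.exp_le_exp.2 (om_le_right hLρ hm y)) (by norm_num))
  have k1 := abs_int_le_set (S := Ioi x) measurableSet_Ioi
    (f := fun y => Real.exp (-(a/ρ)*y) * h y)
    (g := fun y => (2 * Real.exp (-(1/2)*(x-L*ρ))) * Real.exp (-(a/ρ)*y))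
    (c := (2 * Real.exp (-(1/2)*(x-L*ρ))) * (ρ/a * Real.exp (-a*L))) (by positivity) ?_ ?_
  have k2 := abs_int_le_set (S := Ioi x) measurableSet_Ioi
    (f := h) (g := fun y => (2 * Real.exp (1/2*(L*ρ))) * Real.exp (-(1/2)*y))
    (c := 4) (by norm_num) ?_ ?_
  · rw [abs_mul, abs_mul, abs_neg, abs_of_pos (by positivity : 0 < 1/ρ)]
    calc _ ≤ 1/ρ * ((2 * Real.exp (-(1/2)*(x-L*ρ))) * (ρ/a * Real.exp (-a*L))) * 4 := by gcongr
      _ = _ := by field_simp; ring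
  · intro y hyx
    refine (hy y hyx).trans (le_of_eq ?_)
    rw [mul_assoc, ← Real.exp_add]; congr 2; ring
  · have hk : 0 ≤ 2 * Real.exp (1/2*(L*ρ)) := by positivity
    simp only [ENNReal.ofReal_mul hk]
    rw [lintegral_const_mul _ (by fun_prop), lint_Ioi (by norm_num), ← ENNReal.ofReal_mul hk]
    apply ENNReal.ofReal_le_ofReal
    calc _ = 4 * (Real.exp (1/2*(L*ρ)) * Real.exp (-(1/2)*x)) := by ring
      _ = 4 * Real.exp (-(1/2)*(x-L*ρ)) := by rw [← Real.exp_add]; congr 2; ring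
      _ ≤ 4 := mul_le_of_le_one_right (by norm_num) (Real.exp_le_one_iff.2 (by linarith))
  · intro y hyx
    rw [abs_mul, abs_of_pos (Real.exp_pos _), mul_comm]
    gcongr
    refine (hy y hyx).trans ?_
    have : x < y := hyx
    refine mul_le_mul_of_nonneg_left (Real.exp_le_exp.2 ?_) (by norm_num)
    linarith
  · have hk : 0 ≤ 2 * Real.exp (-(1/2)*(x-L*ρ)) := by positivity
    simp only [ENNReal.ofReal_mul hk]
    rw [lintegral_const_mul _ (by fun_prop), lint_Ioi (by positivity)]
    gcongr
    calc _ = ρ/a * Real.exp (-(a/ρ)*x) := by field_simp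
      _ ≤ _ := by
        have : L ≤ x/ρ := by rwa [le_div_iff₀ hρ]
        refine mul_le_mul_of_nonneg_left (Real.exp_le_exp.2 ?_) (by positivity)
        calc -(a/ρ)*x = -a*(x/ρ) := by ring
          _ ≤ _ := by nlinarith

lemma T2 {K : ℝ → ℝ → ℝ} {γ a K0 δ m L ρ : ℝ} {h : ℝ → ℝ} (hK : KernelHyp K γ a K0 δ)
    (ham : a < m) (hm : 0 < m/ρ) (hρ : 0 < ρ) (hL : 0 < L)
    (hb : ∀ x : ℝ, |h x| ≤ 2 * Real.exp (omegaFn m L ρ x)) {x : ℝ} (hx : L*ρ ≤ x) :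
    |(1/ρ) * (∫ y in Iio x, ∫ z in Ioi x,
        (Real.exp (-(a/ρ)*z) * K (Real.exp ((y-z)/ρ)) 1 - Real.exp (-(a/ρ)*y)) * h y * h z)| ≤
      4*K0*(1/(m-(a-δ))+1/(a-δ))/δ * (ρ * Real.exp (a*L)) * Real.exp (-(1/2)*(x-L*ρ)) := by
  have hLρ : 0 < L*ρ := by positivity
  have hK0 : 0 < K0 := hK.2.2.2.2.2.2.1
  have hδ : 0 < δ := hK.2.2.2.2.2.2.2.1.1
  have hδa : δ < a := lt_of_lt_of_le hK.2.2.2.2.2.2.2.1.2 (min_le_right _ _)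
  have had : 0 < a - δ := by linarith
  have hmad : 0 < m - (a - δ) := by linarith
  have hom := om_meas m L ρ
  have key := abs_int2_le (S := Iio x) measurableSet_Iio
    (T := fun _ => Ioi x) (fun _ => measurableSet_Ioi)
    (f := fun y z => (Real.exp (-(a/ρ)*z) * K (Real.exp ((y-z)/ρ)) 1 - Real.exp (-(a/ρ)*y)) * h y * h z)
    (g := fun y z => (4*K0*Real.exp (-(1/2)*(x-L*ρ))) *
      ((Real.exp (-((a-δ)/ρ)*y) * Real.exp (omegaFn m L ρ y)) * Real.exp (-(δ/ρ)*z)))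
    (c := (4*K0*Real.exp (-(1/2)*(x-L*ρ))) * ((ρ * Real.exp ((a-δ)*L) * (1/(m-(a-δ))+1/(a-δ))) *
      (ρ/δ * 1))) (by positivity) ?_ ?_
  · rw [abs_mul, abs_of_pos (by positivity : 0 < 1/ρ)]
    calc _ ≤ _ := mul_le_mul_of_nonneg_left key (by positivity)
      _ = 4*K0*(1/(m-(a-δ))+1/(a-δ))/δ * (ρ * Real.exp ((a-δ)*L)) * Real.exp (-(1/2)*(x-L*ρ)) := by
        field_simp
      _ ≤ _ := by
        gcongr
        linarith
  · intro y hy z hz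
    have hyx : y < x := hy
    have hzx : x < z := hz
    have hF : |Real.exp (-(a/ρ)*z) * K (Real.exp ((y-z)/ρ)) 1 - Real.exp (-(a/ρ)*y)| ≤
        K0 * (Real.exp (-((a-δ)/ρ)*y) * Real.exp (-(δ/ρ)*z)) := by
      have h1 := kern_k1 hK (u := (y-z)/ρ) (div_nonpos_of_nonpos_of_nonneg (by linarith) hρ.le)
      have e1 : Real.exp (-(a/ρ)*z) * K (Real.exp ((y-z)/ρ)) 1 - Real.exp (-(a/ρ)*y) =
          Real.exp (-(a/ρ)*y) * (Real.exp (a*((y-z)/ρ)) * K (Real.exp ((y-z)/ρ)) 1 - 1) := by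
        rw [mul_sub, ← mul_assoc, ← Real.exp_add, mul_one]; congr 3; ring
      rw [e1, abs_mul, abs_of_pos (Real.exp_pos _)]
      calc _ ≤ _ := mul_le_mul_of_nonneg_left h1 (Real.exp_pos _).le
        _ = K0 * (Real.exp (-(a/ρ)*y) * Real.exp (δ*((y-z)/ρ))) := by ring
        _ = _ := by rw [← Real.exp_add, ← Real.exp_add]; congr 2; ring
    have hzb : |h z| ≤ 2 * Real.exp (-(1/2)*(x-L*ρ)) := by
      refine (hb z).trans ?_
      gcongr
      refine (om_le_right hLρ hm z).trans ?_
      linarith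
    rw [abs_mul, abs_mul]
    calc _ ≤ (K0 * (Real.exp (-((a-δ)/ρ)*y) * Real.exp (-(δ/ρ)*z))) * (2 * Real.exp (omegaFn m L ρ y))
          * (2 * Real.exp (-(1/2)*(x-L*ρ))) := by
          have := hb y
          gcongr
      _ = _ := by ring
  · have hk : 0 ≤ 4*K0*Real.exp (-(1/2)*(x-L*ρ)) := by positivity
    have hk2 : ∀ y, 0 ≤ Real.exp (-((a-δ)/ρ)*y) * Real.exp (omegaFn m L ρ y) := fun y => by positivity
    simp only [ENNReal.ofReal_mul hk, ENNReal.ofReal_mul (hk2 _)]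
    have e1 : ∫⁻ z in Ioi x, ENNReal.ofReal (Real.exp (-(δ/ρ)*z)) ≤ ENNReal.ofReal (ρ/δ*1) := by
      rw [lint_Ioi (by positivity)]
      apply ENNReal.ofReal_le_ofReal
      calc _ = ρ/δ * Real.exp (-(δ/ρ)*x) := by field_simp
        _ ≤ _ := by
          gcongr
          rw [Real.exp_le_one_iff]
          have : 0 ≤ δ/ρ*x := mul_nonneg (by positivity) (by linarith)
          linarith
    have e2 := lint_om (s := a-δ) (m := m) (L := L) had (by linarith) hρ hLρ
    have e3 : ∀ y, ∫⁻ z in Ioi x, ENNReal.ofReal (4*K0*Real.exp (-(1/2)*(x-L*ρ))) *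
        (ENNReal.ofReal (Real.exp (-((a-δ)/ρ)*y) * Real.exp (omegaFn m L ρ y)) *
          ENNReal.ofReal (Real.exp (-(δ/ρ)*z))) ≤ ENNReal.ofReal (4*K0*Real.exp (-(1/2)*(x-L*ρ))) *
        (ENNReal.ofReal (Real.exp (-((a-δ)/ρ)*y) * Real.exp (omegaFn m L ρ y)) * ENNReal.ofReal (ρ/δ*1)) := by
      intro y
      rw [lintegral_const_mul _ (by fun_prop), lintegral_const_mul _ (by fun_prop)]
      gcongr
    refine (lintegral_mono e3).trans ?_
    rw [lintegral_const_mul _ (by fun_prop), lintegral_mul_const _ (by fun_prop),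
      ENNReal.ofReal_mul (p := ρ * Real.exp ((a-δ)*L) * (1/(m-(a-δ))+1/(a-δ))) (by positivity)]
    gcongr
    exact (setLIntegral_le_lintegral _ _).trans e2

lemma T3_int {a m L ρ : ℝ} (ha : 0 < a) (ham : a < m) (hρ : 0 < ρ) (hL : 0 < L) (x : ℝ) (D : Set (ℝ × ℝ))
    (hD : D = {p : ℝ × ℝ | x - 2*ρ*Real.exp ((p.1-x)/ρ) ≤ p.2 ∧ p.2 ≤ x}) {k : ℝ} (hk : 0 ≤ k) :
    ∫⁻ y, ∫⁻ z, ENNReal.ofReal (k *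
      (Real.exp (x/ρ) * Real.exp (-((a+1)/ρ)*y) * Real.exp (omegaFn m L ρ y) * D.indicator 1 (y,z) +
       Real.exp (x/ρ) * Real.exp (-((a+1)/ρ)*z) * Real.exp (omegaFn m L ρ z) * D.indicator 1 (z,y))) ≤
    ENNReal.ofReal (k * (4*ρ*(ρ * Real.exp (a*L) * (1/(m-a)+1/a)))) := by
  have hLρ : 0 < L*ρ := by positivity
  have hma : 0 < m - a := by linarith
  have hom := om_meas m L ρ
  have hDm : MeasurableSet D := by
    rw [hD]
    exact (measurableSet_le (f := fun p : ℝ × ℝ => x - 2*ρ*Real.exp ((p.1-x)/ρ)) (g := fun p => p.2)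
      (by fun_prop) (by fun_prop)).inter
      (measurableSet_le (f := fun p : ℝ × ℝ => p.2) (g := fun _ => x) (by fun_prop) (by fun_prop))
  have hind : ∀ p : ℝ × ℝ, (0:ℝ) ≤ D.indicator 1 p := fun p =>
    indicator_nonneg (fun _ _ => zero_le_one) p
  obtain ⟨G, hG⟩ : ∃ G : ℝ → ℝ → ENNReal, G = fun y z => ENNReal.ofReal (Real.exp (x/ρ) * Real.exp (-((a+1)/ρ)*y) *
      Real.exp (omegaFn m L ρ y) * D.indicator 1 (y,z)) := ⟨_, rfl⟩
  have hGm : Measurable (fun p : ℝ × ℝ => G p.1 p.2) := by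
    rw [hG]
    have hi : Measurable (fun p : ℝ × ℝ => (D.indicator (1 : ℝ × ℝ → ℝ) (p.1,p.2))) :=
      measurable_one.indicator hDm
    have : Measurable (fun p : ℝ × ℝ => Real.exp (x/ρ) * Real.exp (-((a+1)/ρ)*p.1) *
      Real.exp (omegaFn m L ρ p.1)) := by
        have : Measurable (fun p : ℝ × ℝ => omegaFn m L ρ p.1) := hom.comp measurable_fst
        have h2 : Measurable (fun p : ℝ × ℝ => Real.exp (omegaFn m L ρ p.1)) := Real.measurable_exp.comp this
        exact Measurable.mul (by fun_prop) h2
    exact (this.mul hi).ennreal_ofReal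
  have hGs : Measurable (fun p : ℝ × ℝ => G p.2 p.1) := hGm.comp measurable_swap
  have hsplit : ∀ y z, ENNReal.ofReal (k *
      (Real.exp (x/ρ) * Real.exp (-((a+1)/ρ)*y) * Real.exp (omegaFn m L ρ y) * D.indicator 1 (y,z) +
       Real.exp (x/ρ) * Real.exp (-((a+1)/ρ)*z) * Real.exp (omegaFn m L ρ z) * D.indicator 1 (z,y))) =
      ENNReal.ofReal k * (G y z + G z y) := by
    intro y z
    have h1 := hind (y,z)
    have h2 := hind (z,y)
    rw [hG, ENNReal.ofReal_mul hk, ENNReal.ofReal_add (by positivity) (by positivity)]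
  simp only [hsplit]
  have hbase : ∫⁻ y, ∫⁻ z, G y z ≤ ENNReal.ofReal (2*ρ*(ρ * Real.exp (a*L) * (1/(m-a)+1/a))) := by
    have e1 : ∀ y, ∫⁻ z, G y z = ENNReal.ofReal (2*ρ) *
        ENNReal.ofReal (Real.exp (-(a/ρ)*y) * Real.exp (omegaFn m L ρ y)) := by
      intro y
      have e2 : ∀ z, G y z = (Icc (x - 2*ρ*Real.exp ((y-x)/ρ)) x).indicator (fun _ =>
          ENNReal.ofReal (Real.exp (x/ρ) * Real.exp (-((a+1)/ρ)*y) * Real.exp (omegaFn m L ρ y))) z := by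
        intro z
        rw [hG]
        by_cases hz : z ∈ Icc (x - 2*ρ*Real.exp ((y-x)/ρ)) x
        · have : (y,z) ∈ D := by rw [hD]; exact hz
          simp [hz, this]
        · have : (y,z) ∉ D := by rw [hD]; exact hz
          rw [indicator_of_notMem hz]
          simp [this]
      simp only [e2]
      rw [lintegral_indicator measurableSet_Icc, setLIntegral_const, Real.volume_Icc,
        ← ENNReal.ofReal_mul (by positivity), ← ENNReal.ofReal_mul (by positivity)]
      congr 1
      have : Real.exp (-(a/ρ)*y) = Real.exp (x/ρ) * Real.exp (-((a+1)/ρ)*y) * Real.exp ((y-x)/ρ) := by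
        rw [← Real.exp_add, ← Real.exp_add]; congr 1; ring
      rw [this]; ring
    simp only [e1]
    rw [lintegral_const_mul _ (by fun_prop), ENNReal.ofReal_mul (by positivity : 0 ≤ 2*ρ)]
    gcongr
    exact lint_om ha ham hρ hLρ
  have hswap : ∫⁻ y, ∫⁻ z, G z y = ∫⁻ y, ∫⁻ z, G y z :=
    lintegral_lintegral_swap (f := fun y z => G z y) hGs.aemeasurable
  have e3 : ∀ y, ∫⁻ z, ENNReal.ofReal k * (G y z + G z y) =
      ENNReal.ofReal k * ((∫⁻ z, G y z) + ∫⁻ z, G z y) := by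
    intro y
    have m1 : Measurable (fun z => G y z) := hGm.comp (measurable_const.prodMk measurable_id)
    have m2 : Measurable (fun z => G z y) := hGs.comp (measurable_const.prodMk measurable_id)
    rw [lintegral_const_mul _ (by fun_prop), lintegral_add_left m1]
  simp only [e3]
  have m3 : Measurable (fun y => ∫⁻ z, G y z) := hGm.lintegral_prod_right'
  have m4 : Measurable (fun y => ∫⁻ z, G z y) := hGs.lintegral_prod_right'
  rw [lintegral_const_mul _ (by fun_prop), lintegral_add_left m3, hswap, ENNReal.ofReal_mul hk]
  gcongr
  calc _ ≤ ENNReal.ofReal (2*ρ*(ρ * Real.exp (a*L) * (1/(m-a)+1/a))) +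
      ENNReal.ofReal (2*ρ*(ρ * Real.exp (a*L) * (1/(m-a)+1/a))) := add_le_add hbase hbase
    _ = _ := by rw [← ENNReal.ofReal_add (by positivity) (by positivity)]; congr 1; ring

lemma T3 {K : ℝ → ℝ → ℝ} {γ a K0 δ m L ρ : ℝ} {h : ℝ → ℝ} (hK : KernelHyp K γ a K0 δ)
    (ha : 0 < a) (ham : a < m) (hm : 0 < m/ρ) (hρ : 0 < ρ) (hρ1 : ρ < 1) (hL : 0 < L)
    (hb : ∀ x : ℝ, |h x| ≤ 2 * Real.exp (omegaFn m L ρ x)) (x : ℝ) :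
    |(1/ρ) * (∫ y in Iio x, ∫ z in Ioo (x + ρ * Real.log (1 - Real.exp ((y-x)/ρ))) x,
        Real.exp (-(a/ρ)*z) * K (Real.exp ((y-z)/ρ)) 1 * h y * h z)| ≤
      16*(1+K0)*Real.exp 1*(1/(m-a)+1/a) * (ρ * Real.exp (a*L)) * Real.exp (-(1/2)*(x-L*ρ)) := by
  have hLρ : 0 < L*ρ := by positivity
  have hK0 : 0 < K0 := hK.2.2.2.2.2.2.1
  have hma : 0 < m - a := by linarith
  obtain ⟨D, hD⟩ : ∃ D : Set (ℝ × ℝ),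
    D = {p : ℝ × ℝ | x - 2*ρ*Real.exp ((p.1-x)/ρ) ≤ p.2 ∧ p.2 ≤ x} := ⟨_, rfl⟩
  have hk : 0 ≤ 4*(1+K0)*Real.exp 1*Real.exp (-(1/2)*(x-L*ρ)) := by positivity
  have hI := T3_int (m := m) ha ham hρ hL x D hD hk
  have hind : ∀ p : ℝ × ℝ, (0:ℝ) ≤ D.indicator 1 p := fun p =>
    indicator_nonneg (fun _ _ => zero_le_one) p
  have key := abs_int2_le (S := Iio x) measurableSet_Iio
    (T := fun y => Ioo (x + ρ * Real.log (1 - Real.exp ((y-x)/ρ))) x) (fun _ => measurableSet_Ioo)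
    (f := fun y z => Real.exp (-(a/ρ)*z) * K (Real.exp ((y-z)/ρ)) 1 * h y * h z)
    (g := fun y z => (4*(1+K0)*Real.exp 1*Real.exp (-(1/2)*(x-L*ρ))) *
      (Real.exp (x/ρ) * Real.exp (-((a+1)/ρ)*y) * Real.exp (omegaFn m L ρ y) * D.indicator 1 (y,z) +
       Real.exp (x/ρ) * Real.exp (-((a+1)/ρ)*z) * Real.exp (omegaFn m L ρ z) * D.indicator 1 (z,y)))
    (c := (4*(1+K0)*Real.exp 1*Real.exp (-(1/2)*(x-L*ρ))) * (4*ρ*(ρ * Real.exp (a*L) * (1/(m-a)+1/a))))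
    (by positivity) ?_ ?_
  · rw [abs_mul, abs_of_pos (by positivity : 0 < 1/ρ)]
    calc _ ≤ _ := mul_le_mul_of_nonneg_left key (by positivity)
      _ = _ := by field_simp; try ring
  · intro y hy z hz
    have hyx : y < x := hy
    have hzx : z < x := hz.2
    have h1 := geo0 hρ hyx hz.1
    rw [abs_mul, abs_mul, abs_of_nonneg (F_nonneg hK ρ y z)]
    rcases le_total y z with hyz | hyz
    · have hg := geo hρ hyz h1
      have hF := F_le1' hK hρ hyz hyx.le
      have ht := exp_tail hLρ hm hρ hρ1 hb hyx hg
      have hm1 : (y,z) ∈ D := by rw [hD]; exact ⟨hg, hzx.le⟩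
      have hi : D.indicator (1 : ℝ × ℝ → ℝ) (y,z) = 1 := by simp [hm1]
      rw [hi]
      have hi2 := hind (z,y)
      calc _ ≤ ((1+K0) * (Real.exp (x/ρ) * Real.exp (-((a+1)/ρ)*y))) * (2 * Real.exp (omegaFn m L ρ y)) *
            (2 * (Real.exp 1 * Real.exp (-(1/2)*(x-L*ρ)))) := by
            have := hb y
            gcongr
        _ = (4*(1+K0)*Real.exp 1*Real.exp (-(1/2)*(x-L*ρ))) *
          (Real.exp (x/ρ) * Real.exp (-((a+1)/ρ)*y) * Real.exp (omegaFn m L ρ y) * 1) := by ring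
        _ ≤ _ := by
          apply mul_le_mul_of_nonneg_left _ hk
          exact le_add_of_nonneg_right (by positivity)
    · have hg := geo hρ hyz (by linarith : 1 < Real.exp ((y-x)/ρ) + Real.exp ((z-x)/ρ))
      have hF := F_le2 hK hρ hyz
      have ht := exp_tail hLρ hm hρ hρ1 hb hzx hg
      have hm1 : (z,y) ∈ D := by rw [hD]; exact ⟨hg, hyx.le⟩
      have hi : D.indicator (1 : ℝ × ℝ → ℝ) (z,y) = 1 := by simp [hm1]
      rw [hi]
      have hi2 := hind (y,z)
      have hyx' : Real.exp (y/ρ) ≤ Real.exp (x/ρ) := Real.exp_le_exp.2 (by gcongr)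
      calc _ ≤ ((1+K0) * (Real.exp (x/ρ) * Real.exp (-((a+1)/ρ)*z))) *
            (2 * (Real.exp 1 * Real.exp (-(1/2)*(x-L*ρ)))) * (2 * Real.exp (omegaFn m L ρ z)) := by
            have := hb z
            have hF' := hF.trans (by gcongr : _ ≤ (1+K0) * (Real.exp (x/ρ) * Real.exp (-((a+1)/ρ)*z)))
            gcongr
        _ = (4*(1+K0)*Real.exp 1*Real.exp (-(1/2)*(x-L*ρ))) *
          (Real.exp (x/ρ) * Real.exp (-((a+1)/ρ)*z) * Real.exp (omegaFn m L ρ z) * 1) := by ring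
        _ ≤ _ := by
          apply mul_le_mul_of_nonneg_left _ hk
          exact le_add_of_nonneg_left (by positivity)
  · exact ((setLIntegral_le_lintegral _ _).trans
      (lintegral_mono fun y => setLIntegral_le_lintegral _ _)).trans hI

end RtilAux

namespace RtilAux

lemma R_right {K : ℝ → ℝ → ℝ} {γ a K0 δ m L ρ : ℝ} {h : ℝ → ℝ} (hK : KernelHyp K γ a K0 δ)
    (ha : 0 < a) (ham : a < m) (hρ : 0 < ρ) (hρ1 : ρ < 1) (hL : 0 < L)
    (hb : ∀ x : ℝ, |h x| ≤ 2 * Real.exp (omegaFn m L ρ x)) {x : ℝ} (hx : L*ρ ≤ x) :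
    |Rfun K a L ρ h x| ≤ (8/a + 4*K0*(1/(m-(a-δ))+1/(a-δ))/δ + 16*(1+K0)*Real.exp 1*(1/(m-a)+1/a))
      * (Real.exp (-a*L) + ρ * Real.exp (a*L)) * Real.exp (-(1/2)*(x-L*ρ)) := by
  have hm : 0 < m/ρ := div_pos (by linarith) hρ
  have hK0 : 0 < K0 := hK.2.2.2.2.2.2.1
  have hδ : 0 < δ := hK.2.2.2.2.2.2.2.1.1
  have hδa : δ < a := lt_of_lt_of_le hK.2.2.2.2.2.2.2.1.2 (min_le_right _ _)
  have had : 0 < a - δ := by linarith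
  have hmad : 0 < m - (a - δ) := by linarith
  have hma : 0 < m - a := by linarith
  have t1 := T1 ha hm hρ hL hb hx
  have t2 := T2 hK ham hm hρ hL hb hx
  have t3 := T3 hK ha ham hm hρ hρ1 hL hb x
  rw [Rfun, if_neg (not_lt.2 hx)]
  refine (abs_add_three _ _ _).trans ((add_le_add (add_le_add t1 t2) t3).trans ?_)
  have p1 : 0 ≤ 8/a := by positivity
  have p2 : 0 ≤ 4*K0*(1/(m-(a-δ))+1/(a-δ))/δ := by positivity
  have p3 : 0 ≤ 16*(1+K0)*Real.exp 1*(1/(m-a)+1/a) := by positivity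
  generalize 8/a = c1 at *
  generalize 4*K0*(1/(m-(a-δ))+1/(a-δ))/δ = c2 at *
  generalize 16*(1+K0)*Real.exp 1*(1/(m-a)+1/a) = c3 at *
  have q1 := Real.exp_pos (-a*L)
  have q2 : 0 < ρ * Real.exp (a*L) := by positivity
  have q3 := Real.exp_pos (-(1/2)*(x-L*ρ))
  rw [← add_mul, ← add_mul]
  apply mul_le_mul_of_nonneg_right _ q3.le
  nlinarith [mul_nonneg p1 q2.le, mul_nonneg p2 q1.le, mul_nonneg p3 q1.le]

lemma Rtil_right {K : ℝ → ℝ → ℝ} {a L ρ ρ0 B : ℝ} {h : ℝ → ℝ} (hB : 0 ≤ B)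
    (hρ : 0 < ρ) (hρ0 : ρ < ρ0) (hρ1 : ρ0 < 1)
    (hR : ∀ x, L*ρ ≤ x → |Rfun K a L ρ h x| ≤ B * Real.exp (-(1/2)*(x-L*ρ)))
    {x : ℝ} (hx : L*ρ ≤ x) :
    |Rtil K a L ρ h x| ≤ (1 + 4/(1-ρ0)) * B * Real.exp (-(1/2)*(x-L*ρ)) := by
  have h0 : 0 < 1 - ρ0 := by linarith
  have hd : (1-ρ0)/4 ≤ 1/(1+ρ) - 1/2 := by
    have : 1/(1+ρ) - 1/2 = (1-ρ)/(2*(1+ρ)) := by field_simp; ring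
    rw [this]
    apply div_le_div₀ <;> nlinarith
  have hd0 : 0 < 1/(1+ρ) - 1/2 := by linarith
  have key := abs_int_le_set (S := Ioo (L*ρ) x) measurableSet_Ioo
    (f := fun y => Real.exp ((y-x)/(1+ρ)) * Rfun K a L ρ h y)
    (g := fun y => (B * Real.exp (1/2*(L*ρ) - x/(1+ρ))) * Real.exp ((1/(1+ρ) - 1/2)*y))
    (c := (B * Real.exp (1/2*(L*ρ) - x/(1+ρ))) * (Real.exp ((1/(1+ρ) - 1/2)*x)/(1/(1+ρ) - 1/2)))
    (by positivity) ?_ ?_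
  · rw [Rtil, if_neg (not_lt.2 hx)]
    refine (abs_sub _ _).trans ?_
    rw [abs_mul, abs_of_pos (by positivity : 0 < 1/(1+ρ))]
    have e1 : (B * Real.exp (1/2*(L*ρ) - x/(1+ρ))) * (Real.exp ((1/(1+ρ) - 1/2)*x)/(1/(1+ρ) - 1/2))
        = (B * Real.exp (-(1/2)*(x-L*ρ))) / (1/(1+ρ) - 1/2) := by
      rw [mul_div_assoc', mul_assoc, ← Real.exp_add]; congr 3; ring
    rw [e1] at key
    have e2 : (B * Real.exp (-(1/2)*(x-L*ρ))) / (1/(1+ρ) - 1/2) ≤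
        (B * Real.exp (-(1/2)*(x-L*ρ))) / ((1-ρ0)/4) := by gcongr
    have e3 : 1/(1+ρ) ≤ 1 := by rw [div_le_one (by linarith)]; linarith
    have e4 := mul_le_mul e3 (key.trans e2) (abs_nonneg _) zero_le_one
    have e5 : (B * Real.exp (-(1/2)*(x-L*ρ))) / ((1-ρ0)/4) = 4/(1-ρ0) * B * Real.exp (-(1/2)*(x-L*ρ)) := by
      field_simp
    rw [e5] at e4
    have := hR x hx
    linarith
  · intro y hy
    rw [abs_mul, abs_of_pos (Real.exp_pos _)]
    calc _ ≤ _ := mul_le_mul_of_nonneg_left (hR y hy.1.le) (Real.exp_pos _).le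
      _ = B * (Real.exp ((y-x)/(1+ρ)) * Real.exp (-(1/2)*(y-L*ρ))) := by ring
      _ = _ := by
        rw [← Real.exp_add, mul_assoc, ← Real.exp_add]; congr 2; ring
  · have hk : 0 ≤ B * Real.exp (1/2*(L*ρ) - x/(1+ρ)) := by positivity
    simp only [ENNReal.ofReal_mul hk]
    rw [lintegral_const_mul _ (by fun_prop)]
    gcongr
    rw [← lint_Iic hd0]
    exact lintegral_mono_set fun y hy => hy.2.le

end RtilAux

/-- bounds on the remainder R̃[h] (estimate (4.12) of the paper). -/
theorem Rtil_bounds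
    (γ a K0 δ m L0 ρ0 : ℝ) (hγ : γ < 1) (ha : a = 1 - γ)
    (hK0 : 0 < K0) (hδ : δ ∈ Ioo 0 (min 1 a)) (hP : ParamHyp a m L0 ρ0) :
    ∃ C : ℝ, 0 < C ∧
      ∀ K : ℝ → ℝ → ℝ, KernelHyp K γ a K0 δ →
      ∀ L : ℝ, L0 ≤ L → ∀ ρ ∈ Ioo (0:ℝ) ρ0,
      ∀ h : ℝ → ℝ, memX a m L ρ h →
      (∀ y : ℝ, y < L*ρ → Qfun K a ρ h y ∈ Icc (1/2:ℝ) (3/2)) →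
        (∀ x : ℝ, x ≤ -(L*ρ) →
          |Rtil K a L ρ h x|
            ≤ C * ρ * Real.exp ((m+a+2)*L) * Real.exp ((m/ρ)*(x+L*ρ))) ∧
        (∀ x : ℝ, -(L*ρ) < x → x < L*ρ →
          |Rtil K a L ρ h x| ≤ C * ρ * Real.exp ((a+2)*L)) ∧
        (∀ x : ℝ, L*ρ ≤ x →
          |Rtil K a L ρ h x|
            ≤ C * (Real.exp (-a*L) + ρ * Real.exp (a*L)) * Real.exp (-(1/2)*(x-L*ρ))) := by
  have ha0 : 0 < a := by linarith
  obtain ⟨hm, hL0, hρ0⟩ := hP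
  have ham : a + 1 < m := (le_max_left _ _).trans_lt hm
  have hδa : δ < a := hδ.2.trans_le (min_le_right _ _)
  have had : 0 < a - δ := by linarith
  have hmad : 0 < m - (a - δ) := by linarith [hδ.1]
  have hma : 0 < m - a := by linarith
  have hms : 0 < m - (a+1) := by linarith
  have hδ0 := hδ.1
  have h1ρ0 : 0 < 1 - ρ0 := by linarith [hρ0.2]
  obtain ⟨C1, hC1⟩ : ∃ C1, C1 = 7 * (8*(1+K0)*(1/(m-(a+1))+1/(a+1))) := ⟨_, rfl⟩
  obtain ⟨C2, hC2⟩ : ∃ C2, C2 =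
    8/a + 4*K0*(1/(m-(a-δ))+1/(a-δ))/δ + 16*(1+K0)*Real.exp 1*(1/(m-a)+1/a) := ⟨_, rfl⟩
  have hC1p : 0 < C1 := by rw [hC1]; positivity
  have hC2p : 0 < C2 := by rw [hC2]; positivity
  have hC3p : 0 < (1 + 4/(1-ρ0)) * C2 := by positivity
  refine ⟨C1 + (1 + 4/(1-ρ0)) * C2, by positivity, ?_⟩
  intro K hK L hL ρ hρ h hmem hQ
  have hρp : 0 < ρ := hρ.1
  have hlog : Real.log (4*m) < a*L := by
    have : (1/a) * Real.log (4*m) < L := hL0.trans_le hL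
    rw [one_div, inv_mul_lt_iff₀ ha0] at this
    exact this
  have hLp : 0 < L := by
    have h1 : 0 < Real.log (4*m) := Real.log_pos (by linarith)
    exact pos_of_mul_pos_right (h1.trans hlog) ha0.le
  have hL4 : 4*m ≤ Real.exp (a*L) := by
    rw [← Real.exp_log (by linarith : 0 < 4*m)]
    exact Real.exp_le_exp.2 hlog.le
  have hLρ : 0 < L*ρ := by positivity
  obtain ⟨hcont, _, _, hb⟩ := hmem
  have hmeas : Measurable h := measurable_of_continuousOn_compl_singleton (L*ρ) hcont
  have hleft : ∀ x, x < L*ρ → |Rtil K a L ρ h x| ≤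
      (C1 + (1 + 4/(1-ρ0)) * C2) * ρ * Real.exp ((a+2)*L) * Real.exp (omegaFn m L ρ x) := by
    intro x hx
    refine (RtilAux.Rtil_left hK hmeas ha0 ham hρp hLp hL4 hb hQ hx).trans ?_
    calc _ = C1 * ρ * Real.exp ((a+2)*L) * Real.exp (omegaFn m L ρ x) := by rw [hC1]; ring
      _ ≤ _ := by gcongr; linarith
  refine ⟨fun x hx => ?_, fun x hx hx' => ?_, fun x hx => ?_⟩
  · have := hleft x (by linarith)
    rw [RtilAux.om_left hx] at this
    refine this.trans ?_
    gcongr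
    linarith
  · have := hleft x hx'
    rwa [RtilAux.om_mid hx hx', Real.exp_zero, mul_one] at this
  · have hR : ∀ x, L*ρ ≤ x → |Rfun K a L ρ h x| ≤
        (C2 * (Real.exp (-a*L) + ρ * Real.exp (a*L))) * Real.exp (-(1/2)*(x-L*ρ)) := by
      intro x hx
      rw [hC2]
      exact RtilAux.R_right hK ha0 (by linarith) hρp (hρ.2.trans hρ0.2) hLp hb hx
    refine (RtilAux.Rtil_right (by positivity) hρp hρ.2 hρ0.2 hR hx).trans ?_
    rw [← mul_assoc]
    gcongr
    linarith
end

section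
/- There exists a constant C > 0, depending only on K0, a, δ, m, L0, ρ0, with the following property. Let h1, h2 ∈ X_{L,ρ} and assume 1/2 ≤ Q[h_i](y) ≤ 3/2 for all y < Lρ and i = 1,2. Then: |R̃[h1](x) − R̃[h2](x)| ≤ C·ρ·‖h1−h2‖·e^{(m+4a+4)L}·e^{(m/ρ)(x+Lρ)} for x ≤ −Lρ; |R̃[h1](x) − R̃[h2](x)| ≤ C·ρ·‖h1−h2‖·e^{(5a+4)L} for −Lρ < x < Lρ; and |R̃[h1](x) − R̃[h2](x)| ≤ C·(e^{−aL} + ρ·e^{aL})·‖h1−h2‖·e^{−(1/2)(x−Lρ)} for x ≥ Lρ. -/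
open Set MeasureTheory Filter

/-- weight -/
noncomputable def wF (m L ρ x : ℝ) : ℝ := Real.exp (omegaFn m L ρ x)

/-- min exponent -/
noncomputable def sF (L ρ x : ℝ) : ℝ := min (x/ρ + L) 0

/-- parameter facts -/
structure PC (a K0 δ m L ρ : ℝ) (K : ℝ → ℝ → ℝ) : Prop where
  ha : 0 < a
  hm1 : a + 1 < m
  hm3 : 3*a < m
  hL : 0 < L
  hLm : 4*m ≤ Real.exp (a*L)
  hρ : 0 < ρ
  hρ1 : ρ < 1
  hδ : 0 < δ
  hδa : δ < a
  hK0 : 0 < K0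
  hKc : Continuous (fun t : ℝ => K (Real.exp t) 1)
  hK : ∀ t : ℝ, 0 ≤ K (Real.exp t) 1
  hK1 : ∀ t : ℝ, t ≤ 0 → |Real.exp (a*t) * K (Real.exp t) 1 - 1| ≤ K0 * Real.exp (δ*t)
  hK2 : ∀ t : ℝ, 0 ≤ t → K (Real.exp t) 1 ≤ (1+K0) * Real.exp t

/-- pair facts -/
structure HP (m L ρ N : ℝ) (h1 h2 : ℝ → ℝ) : Prop where
  m1 : Measurable h1
  m2 : Measurable h2
  b1 : ∀ x, |h1 x| ≤ 2 * wF m L ρ x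
  b2 : ∀ x, |h2 x| ≤ 2 * wF m L ρ x
  b : ∀ x, |h1 x - h2 x| ≤ N * wF m L ρ x
  hN : 0 ≤ N

lemma HP.zero {m L ρ N : ℝ} {h1 h2 : ℝ → ℝ} (H : HP m L ρ N h1 h2) :
    HP m L ρ 2 h1 (fun _ => 0) :=
  ⟨H.m1, measurable_const, H.b1, fun x => by
    have : 0 < wF m L ρ x := Real.exp_pos _
    simp; positivity, fun x => by simpa using H.b1 x, by norm_num⟩

lemma HP.symm {m L ρ N : ℝ} {h1 h2 : ℝ → ℝ} (H : HP m L ρ N h1 h2) :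
    HP m L ρ N h2 h1 :=
  ⟨H.m2, H.m1, H.b2, H.b1, fun x => by rw [abs_sub_comm]; exact H.b x, H.hN⟩

lemma wF_pos (m L ρ x : ℝ) : 0 < wF m L ρ x := Real.exp_pos _

lemma wF_meas (m L ρ : ℝ) : Measurable (wF m L ρ) := by
  unfold wF omegaFn
  apply Real.measurable_exp.comp
  refine Measurable.ite measurableSet_Iic (by fun_prop) ?_
  exact Measurable.ite measurableSet_Iio (by fun_prop) (by fun_prop)

lemma wF_le_one {m L ρ : ℝ} (hm : 0 < m) (_hL : 0 < L) (hρ : 0 < ρ) (x : ℝ) : wF m L ρ x ≤ 1 := by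
  unfold wF omegaFn
  rw [Real.exp_le_one_iff]
  split_ifs with h1 h2
  · have : 0 < m/ρ := by positivity
    nlinarith
  · exact le_rfl
  · push Not at h2
    linarith

lemma wF_le2 {m L ρ : ℝ} (hm : 0 < m) (hL : 0 < L) (hρ : 0 < ρ) (x : ℝ) :
    wF m L ρ x ≤ Real.exp (m * (x/ρ + L)) := by
  unfold wF omegaFn
  rw [Real.exp_le_exp]
  have e : m * (x/ρ + L) = m/ρ*(x+L*ρ) := by field_simp
  rw [e]
  have : 0 < m/ρ := by positivity
  have : 0 < L*ρ := by positivity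
  split_ifs with h1 h2
  · exact le_rfl
  · push Not at h1
    apply mul_nonneg <;> linarith
  · push Not at h1 h2
    have : 0 ≤ m/ρ*(x+L*ρ) := by apply mul_nonneg <;> linarith
    linarith

lemma wF_le3 {m L ρ : ℝ} (hm : 0 < m) (hL : 0 < L) (hρ : 0 < ρ) (x : ℝ) :
    wF m L ρ x ≤ Real.exp (-(1/2)*(x - L*ρ)) := by
  unfold wF omegaFn
  rw [Real.exp_le_exp]
  have : 0 < m/ρ := by positivity
  have : 0 < L*ρ := by positivity
  split_ifs with h1 h2
  · have : 0 ≤ m/ρ*(-(x+L*ρ)) := by apply mul_nonneg <;> linarith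
    linarith
  · linarith
  · exact le_rfl

lemma wF_leS {m L ρ : ℝ} (hm : 0 < m) (hL : 0 < L) (hρ : 0 < ρ) (x : ℝ) :
    wF m L ρ x ≤ Real.exp (m * sF L ρ x) := by
  unfold sF
  rcases le_total (x/ρ+L) 0 with h | h
  · rw [min_eq_left h]; exact wF_le2 hm hL hρ x
  · rw [min_eq_right h]; simpa using wF_le_one hm hL hρ x

lemma sF_mono {L ρ : ℝ} (hρ : 0 < ρ) {x y : ℝ} (h : x ≤ y) : sF L ρ x ≤ sF L ρ y := by
  unfold sF; gcongr

lemma sF_np (L ρ x : ℝ) : sF L ρ x ≤ 0 := min_le_right _ _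

lemma sF_le (L ρ x : ℝ) : sF L ρ x ≤ x/ρ + L := min_le_left _ _

lemma le_sF {L ρ x : ℝ} (hL : 0 < L) (hρ : 0 < ρ) (hx : x ≤ L*ρ) : x/ρ ≤ L + sF L ρ x := by
  have : x/ρ ≤ L := by rw [div_le_iff₀ hρ]; exact hx
  unfold sF
  rcases le_total (x/ρ+L) 0 with h | h
  · rw [min_eq_left h]; linarith
  · rw [min_eq_right h]; linarith

/-- integrable with integral at most `B` -/
def IB (f : ℝ → ℝ) (S : Set ℝ) (B : ℝ) : Prop := IntegrableOn f S ∧ ∫ x in S, f x ≤ B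

lemma IB.of_le {f g : ℝ → ℝ} {S : Set ℝ} {B : ℝ} (hS : MeasurableSet S) (hg : IB g S B)
    (hf : Measurable f) (h0 : ∀ x ∈ S, 0 ≤ f x) (h : ∀ x ∈ S, f x ≤ g x) : IB f S B := by
  have i : IntegrableOn f S := by
    refine Integrable.mono' hg.1 hf.aestronglyMeasurable ?_
    filter_upwards [ae_restrict_mem hS] with x hx
    rw [Real.norm_eq_abs, abs_of_nonneg (h0 x hx)]
    exact h x hx
  exact ⟨i, (setIntegral_mono_on i hg.1 hS h).trans hg.2⟩

lemma IB.mul {f : ℝ → ℝ} {S : Set ℝ} {B : ℝ} (c : ℝ) (hc : 0 ≤ c) (h : IB f S B) :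
    IB (fun x => c * f x) S (c*B) :=
  ⟨h.1.const_mul c, by rw [integral_const_mul]; exact mul_le_mul_of_nonneg_left h.2 hc⟩

lemma IB.weaken {f : ℝ → ℝ} {S : Set ℝ} {B B' : ℝ} (h : IB f S B) (hB : B ≤ B') : IB f S B' :=
  ⟨h.1, h.2.trans hB⟩

lemma IB.subset {f : ℝ → ℝ} {S T : Set ℝ} {B : ℝ} (h : IB f S B) (hT : MeasurableSet S) (hST : T ⊆ S)
    (h0 : ∀ x ∈ S, 0 ≤ f x) : IB f T B := by
  refine ⟨h.1.mono_set hST, (setIntegral_mono_set h.1 ?_ ?_).trans h.2⟩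
  · filter_upwards [ae_restrict_mem hT] with x hx using h0 x hx
  · exact LE.le.eventuallyLE hST

lemma IB.union {f : ℝ → ℝ} {S T : Set ℝ} {B B' : ℝ} (h : IB f S B) (h' : IB f T B')
    (hT : MeasurableSet T) (hd : Disjoint S T) : IB f (S ∪ T) (B + B') :=
  ⟨h.1.union h'.1, by rw [setIntegral_union hd hT h.1 h'.1]; exact add_le_add h.2 h'.2⟩

lemma IB.of_le' {f g : ℝ → ℝ} {S : Set ℝ} {B B' : ℝ} (hS : MeasurableSet S) (hg : IB g S B)
    (hf : Measurable f) (h0 : ∀ x ∈ S, 0 ≤ f x) (h : ∀ x ∈ S, f x ≤ g x) (hB : B ≤ B') :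
    IB f S B' := (IB.of_le hS hg hf h0 h).weaken hB

lemma IB_Iic {c : ℝ} (hc : 0 < c) (x : ℝ) :
    IB (fun y => Real.exp (c*y)) (Iic x) (Real.exp (c*x)/c) :=
  ⟨integrableOn_exp_mul_Iic hc x, (integral_exp_mul_Iic hc x).le⟩

lemma IB_Ioi {c : ℝ} (hc : 0 < c) (x : ℝ) :
    IB (fun y => Real.exp (-c*y)) (Ioi x) (Real.exp (-c*x)/c) :=
  ⟨integrableOn_exp_mul_Ioi (by linarith) x, by
    rw [integral_exp_mul_Ioi (by linarith) x, neg_div_neg_eq]⟩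

/-- constant -/
noncomputable def JF (m c : ℝ) : ℝ := 1/(m-c) + 1/c

lemma J_low {m L ρ c : ℝ} (hL : 0 < L) (hρ : 0 < ρ) (hc : 0 < c) (hcm : c < m) (x : ℝ) :
    IB (fun y => Real.exp (-(c/ρ)*y) * wF m L ρ y) (Iic x)
      (ρ * (1/(m-c)) * Real.exp (c*L) * Real.exp ((m-c)*(x/ρ+L))) := by
  have hm : 0 < m := by linarith
  have hmc : 0 < m - c := by linarith
  have hd : 0 < (m-c)/ρ := by positivity
  have h := (IB_Iic hd x).mul (Real.exp (m*L)) (Real.exp_pos _).le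
  refine IB.of_le' measurableSet_Iic h ?_ ?_ ?_ ?_
  · exact (by fun_prop : Measurable fun y => Real.exp (-(c/ρ)*y)).mul (wF_meas m L ρ)
  · intro y _
    exact mul_nonneg (Real.exp_pos _).le (wF_pos _ _ _ _).le
  · intro y _
    calc _ ≤ Real.exp (-(c/ρ)*y) * Real.exp (m * (y/ρ + L)) := by
          gcongr; exact wF_le2 hm hL hρ y
      _ = _ := by
          rw [← Real.exp_add, ← Real.exp_add]; congr 1; field_simp; ring
  refine (le_of_eq ?_)
  rw [mul_assoc (ρ * _), ← Real.exp_add, mul_div_assoc', ← Real.exp_add]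
  have : m * L + (m - c) / ρ * x = c * L + (m - c) * (x / ρ + L) := by field_simp; ring
  rw [this]; field_simp

lemma J_tot {m L ρ c : ℝ} (hL : 0 < L) (hρ : 0 < ρ) (hc : 0 < c) (hcm : c < m) :
    IB (fun y => Real.exp (-(c/ρ)*y) * wF m L ρ y) univ (ρ * JF m c * Real.exp (c*L)) := by
  have hm : 0 < m := by linarith
  have h1 := J_low (m := m) hL hρ hc hcm (-(L*ρ))
  have hd : 0 < c/ρ := by positivity
  have h2 : IB (fun y => Real.exp (-(c/ρ)*y) * wF m L ρ y) (Ioi (-(L*ρ))) (Real.exp (-(c/ρ)*(-(L*ρ)))/(c/ρ)) := by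
    refine IB.of_le measurableSet_Ioi (IB_Ioi hd (-(L*ρ))) ?_ ?_ ?_
    · exact (by fun_prop : Measurable fun y => Real.exp (-(c/ρ)*y)).mul (wF_meas m L ρ)
    · intro y _
      exact mul_nonneg (Real.exp_pos _).le (wF_pos _ _ _ _).le
    · intro y _
      exact mul_le_of_le_one_right (Real.exp_pos _).le (wF_le_one hm hL hρ y)
  have h3 := h1.union h2 measurableSet_Ioi (by
    rw [Set.disjoint_left]; intro y hy hy'; simp at hy hy'; linarith)
  rw [Iic_union_Ioi] at h3
  refine h3.weaken (le_of_eq ?_)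
  have e1 : (m - c) * (-(L * ρ) / ρ + L) = 0 := by field_simp; simp
  have e2 : -(c / ρ) * -(L * ρ) = c * L := by field_simp
  rw [e1, e2, JF, Real.exp_zero]; field_simp

lemma J_Iio {m L ρ c : ℝ} (hL : 0 < L) (hρ : 0 < ρ) (hc : 0 < c) (hcm : c < m) (x : ℝ) :
    IB (fun y => Real.exp (-(c/ρ)*y) * wF m L ρ y) (Iio x)
      (ρ * JF m c * Real.exp (c*L) * Real.exp ((m-c) * sF L ρ x)) := by
  have hmc : 0 < m - c := by linarith
  have h0 : ∀ y, 0 ≤ Real.exp (-(c/ρ)*y) * wF m L ρ y := fun y =>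
    mul_nonneg (Real.exp_pos _).le (wF_pos _ _ _ _).le
  rcases le_total (x/ρ+L) 0 with h | h
  · refine ((J_low (m := m) hL hρ hc hcm x).subset measurableSet_Iic Iio_subset_Iic_self
      fun y _ => h0 y).weaken ?_
    rw [sF, min_eq_left h]
    gcongr
    rw [JF]
    have : 0 < 1/c := by positivity
    linarith
  · refine ((J_tot (m := m) hL hρ hc hcm).subset MeasurableSet.univ (subset_univ _)
      fun y _ => h0 y).weaken ?_
    rw [sF, min_eq_right h]; simp

lemma JF_pos {m c : ℝ} (hc : 0 < c) (hcm : c < m) : 0 < JF m c := by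
  have hmc : 0 < m - c := by linarith
  rw [JF]; positivity

lemma w_Iio {m L ρ : ℝ} (hL : 0 < L) (hρ : 0 < ρ) (hm : 1 < m) {x : ℝ} (hx : x ≤ L*ρ) :
    IB (wF m L ρ) (Iio x) (ρ * JF m 1 * Real.exp (2*L) * Real.exp (m * sF L ρ x)) := by
  have h := (J_Iio (m := m) hL hρ one_pos hm x).mul (Real.exp (x/ρ)) (Real.exp_pos _).le
  refine IB.of_le' measurableSet_Iio h (wF_meas m L ρ) (fun y _ => (wF_pos _ _ _ _).le) ?_ ?_
  intro y hy
  rw [← mul_assoc, ← Real.exp_add]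
  apply le_mul_of_one_le_left (wF_pos _ _ _ _).le
  rw [Real.one_le_exp_iff]
  have : x / ρ + -(1/ρ)*y = (x - y)/ρ := by field_simp; ring
  rw [this]
  have : y < x := hy
  apply div_nonneg <;> linarith
  have hJ := JF_pos one_pos hm
  calc _ = ρ * JF m 1 * Real.exp (x/ρ + 1*L + (m-1) * sF L ρ x) := by
        rw [Real.exp_add, Real.exp_add]; ring
    _ ≤ ρ * JF m 1 * Real.exp (2*L + m * sF L ρ x) := by
        refine mul_le_mul_of_nonneg_left (Real.exp_le_exp.2 ?_) (by positivity)
        have := le_sF hL hρ hx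
        linarith
    _ = _ := by rw [Real.exp_add]; ring

lemma ew_Iio {m L ρ : ℝ} (hL : 0 < L) (hρ : 0 < ρ) (hm : 0 < m) {x : ℝ} (hx : x ≤ L*ρ) :
    IB (fun y => Real.exp (y/ρ) * wF m L ρ y) (Iio x)
      (ρ * Real.exp L * Real.exp ((m+1) * sF L ρ x)) := by
  have hr : 0 < 1/ρ := by positivity
  have h := ((IB_Iic hr x).subset measurableSet_Iic Iio_subset_Iic_self
    fun y _ => (Real.exp_pos _).le).mul (Real.exp (m * sF L ρ x)) (Real.exp_pos _).le
  refine IB.of_le' measurableSet_Iio h ?_ ?_ ?_ ?_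
  · exact (by fun_prop : Measurable fun y => Real.exp (y/ρ)).mul (wF_meas m L ρ)
  · intro y _
    exact mul_nonneg (Real.exp_pos _).le (wF_pos _ _ _ _).le
  · intro y hy
    rw [mul_comm, show 1/ρ*y = y/ρ by ring]
    gcongr
    refine (wF_leS hm hL hρ y).trans ?_
    gcongr
    exact sF_mono hρ (le_of_lt hy)
  calc _ = ρ * Real.exp (x/ρ + m * sF L ρ x) := by
        rw [Real.exp_add]; field_simp
    _ ≤ ρ * Real.exp (L + (m+1) * sF L ρ x) := by
        refine mul_le_mul_of_nonneg_left (Real.exp_le_exp.2 ?_) (by positivity)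
        have := le_sF hL hρ hx
        linarith
    _ = _ := by rw [Real.exp_add]; ring

lemma w_Ioi {m L ρ : ℝ} (hL : 0 < L) (hρ : 0 < ρ) (hm : 0 < m) {c : ℝ} (hc : 0 ≤ c) (x : ℝ) :
    IB (fun y => Real.exp (-c*y) * wF m L ρ y) (Ioi x)
      (2 * (Real.exp (-c*x) * Real.exp (-(1/2)*(x - L*ρ)))) := by
  have h := (IB_Ioi (c := c + 1/2) (by linarith) x).mul (Real.exp (1/2*(L*ρ))) (Real.exp_pos _).le
  refine IB.of_le' measurableSet_Ioi h ?_ ?_ ?_ ?_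
  · exact (by fun_prop : Measurable fun y => Real.exp (-c*y)).mul (wF_meas m L ρ)
  · intro y _
    exact mul_nonneg (Real.exp_pos _).le (wF_pos _ _ _ _).le
  · intro y hy
    calc _ ≤ Real.exp (-c*y) * Real.exp (-(1/2)*(y - L*ρ)) := by
          gcongr; exact wF_le3 hm hL hρ y
      _ = _ := by rw [← Real.exp_add, ← Real.exp_add]; congr 1; ring
  rw [mul_div_assoc', ← Real.exp_add, ← Real.exp_add, div_le_iff₀ (by linarith)]
  have e : 1 / 2 * (L * ρ) + -(c + 1 / 2) * x = -c * x + -(1 / 2) * (x - L * ρ) := by ring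
  rw [e]
  have := Real.exp_pos (-c * x + -(1 / 2) * (x - L * ρ))
  nlinarith

lemma w_Ioi' {m L ρ : ℝ} (hL : 0 < L) (hρ : 0 < ρ) (hm : 0 < m) {c : ℝ} (hc : 0 < c) (x : ℝ) :
    IB (fun y => Real.exp (-(c/ρ)*y) * wF m L ρ y) (Ioi x)
      (ρ/c * (Real.exp (-(c/ρ)*x) * Real.exp (-(1/2)*(x - L*ρ)))) := by
  have hcr : 0 < c/ρ := by positivity
  have h := (IB_Ioi hcr x).mul (Real.exp (-(1/2)*(x - L*ρ))) (Real.exp_pos _).le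
  refine IB.of_le' measurableSet_Ioi h ?_ ?_ ?_ ?_
  · exact (by fun_prop : Measurable fun y => Real.exp (-(c/ρ)*y)).mul (wF_meas m L ρ)
  · intro y _
    exact mul_nonneg (Real.exp_pos _).le (wF_pos _ _ _ _).le
  · intro y hy
    rw [mul_comm]
    gcongr
    refine (wF_le3 hm hL hρ y).trans ?_
    have : x < y := hy
    rw [Real.exp_le_exp]; linarith
  refine (le_of_eq ?_)
  field_simp
lemma PC.m0 {a K0 δ m L ρ : ℝ} {K : ℝ → ℝ → ℝ} (P : PC a K0 δ m L ρ K) : 0 < m := by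
  linarith [P.ha, P.hm1]

lemma PC.m1 {a K0 δ m L ρ : ℝ} {K : ℝ → ℝ → ℝ} (P : PC a K0 δ m L ρ K) : 1 < m := by
  linarith [P.ha, P.hm1]

/-- kernel -/
noncomputable def WF (K : ℝ → ℝ → ℝ) (a ρ y z : ℝ) : ℝ :=
  Real.exp (-(a/ρ)*z) * K (Real.exp ((y-z)/ρ)) 1

lemma WF_nn {a K0 δ m L ρ : ℝ} {K : ℝ → ℝ → ℝ} (P : PC a K0 δ m L ρ K) (y z : ℝ) :
    0 ≤ WF K a ρ y z := mul_nonneg (Real.exp_pos _).le (P.hK _)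

lemma WF_meas {a K0 δ m L ρ : ℝ} {K : ℝ → ℝ → ℝ} (P : PC a K0 δ m L ρ K) :
    Measurable (Function.uncurry (WF K a ρ)) := by
  have h1 : Continuous (fun p : ℝ × ℝ => K (Real.exp ((p.1-p.2)/ρ)) 1) :=
    P.hKc.comp (by fun_prop : Continuous fun p : ℝ × ℝ => (p.1-p.2)/ρ)
  have h2 : Continuous (fun p : ℝ × ℝ => Real.exp (-(a/ρ)*p.2)) := by fun_prop
  exact (h2.mul h1).measurable

lemma WF_d {a K0 δ m L ρ : ℝ} {K : ℝ → ℝ → ℝ} (P : PC a K0 δ m L ρ K) {y z : ℝ} (h : y ≤ z) :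
    |WF K a ρ y z - Real.exp (-(a/ρ)*y)| ≤
      K0 * (Real.exp (-((a-δ)/ρ)*y) * Real.exp (-(δ/ρ)*z)) := by
  have hρ := P.hρ
  have ht : (y-z)/ρ ≤ 0 := div_nonpos_of_nonpos_of_nonneg (by linarith) hρ.le
  have h1 := P.hK1 _ ht
  have e : WF K a ρ y z - Real.exp (-(a/ρ)*y) =
      Real.exp (-(a/ρ)*y) * (Real.exp (a*((y-z)/ρ)) * K (Real.exp ((y-z)/ρ)) 1 - 1) := by
    rw [WF, mul_sub, ← mul_assoc, ← Real.exp_add]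
    congr 3
    · field_simp; ring
    · ring
  rw [e, abs_mul, abs_of_pos (Real.exp_pos _)]
  refine (mul_le_mul_of_nonneg_left h1 (Real.exp_pos _).le).trans (le_of_eq ?_)
  rw [← Real.exp_add, mul_left_comm, ← Real.exp_add]
  congr 2; field_simp; ring

lemma WF_1 {a K0 δ m L ρ : ℝ} {K : ℝ → ℝ → ℝ} (P : PC a K0 δ m L ρ K) {y z : ℝ} (h : y ≤ z) :
    WF K a ρ y z ≤ (1+K0) * Real.exp (-(a/ρ)*y) := by
  have h1 := (abs_le.1 (WF_d P h)).2
  have h2 : Real.exp (-((a-δ)/ρ)*y) * Real.exp (-(δ/ρ)*z) ≤ Real.exp (-(a/ρ)*y) := by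
    rw [← Real.exp_add, Real.exp_le_exp]
    have : 0 ≤ δ/ρ*(z-y) := mul_nonneg (div_nonneg P.hδ.le P.hρ.le) (by linarith)
    have e : -((a-δ)/ρ)*y + -(δ/ρ)*z = -(a/ρ)*y - δ/ρ*(z-y) := by ring
    linarith
  have := mul_le_mul_of_nonneg_left h2 P.hK0.le
  linarith

lemma WF_2 {a K0 δ m L ρ : ℝ} {K : ℝ → ℝ → ℝ} (P : PC a K0 δ m L ρ K) {y z : ℝ} (h : z ≤ y) :
    WF K a ρ y z ≤ (1+K0) * (Real.exp (y/ρ) * Real.exp (-((a+1)/ρ)*z)) := by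
  have ht : 0 ≤ (y-z)/ρ := div_nonneg (by linarith) P.hρ.le
  refine (mul_le_mul_of_nonneg_left (P.hK2 _ ht) (Real.exp_pos _).le).trans (le_of_eq ?_)
  rw [← Real.exp_add, mul_left_comm, ← Real.exp_add]
  congr 2; ring

lemma WF_12 {a K0 δ m L ρ : ℝ} {K : ℝ → ℝ → ℝ} (P : PC a K0 δ m L ρ K) (y z : ℝ) :
    WF K a ρ y z ≤ (1+K0) * (Real.exp (-(a/ρ)*y) + Real.exp (y/ρ) * Real.exp (-((a+1)/ρ)*z)) := by
  have h0 := P.hK0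
  rw [mul_add]
  rcases le_total y z with h | h
  · have := WF_1 P h
    have : 0 ≤ (1+K0) * (Real.exp (y/ρ) * Real.exp (-((a+1)/ρ)*z)) := by positivity
    linarith
  · have := WF_2 P h
    have : 0 ≤ (1+K0) * Real.exp (-(a/ρ)*y) := by positivity
    linarith

lemma HP.prod {m L ρ N : ℝ} {h1 h2 : ℝ → ℝ} (H : HP m L ρ N h1 h2) (y z : ℝ) :
    |h1 y * h1 z - h2 y * h2 z| ≤ 4 * N * (wF m L ρ y * wF m L ρ z) := by
  have e : h1 y * h1 z - h2 y * h2 z = (h1 y - h2 y) * h1 z + h2 y * (h1 z - h2 z) := by ring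
  have hN := H.hN
  have wy := (wF_pos m L ρ y).le
  have wz := (wF_pos m L ρ z).le
  rw [e]
  refine (abs_add_le _ _).trans ?_
  rw [abs_mul, abs_mul]
  have A := mul_le_mul (H.b y) (H.b1 z) (abs_nonneg _) (mul_nonneg hN wy)
  have B := mul_le_mul (H.b2 y) (H.b z) (abs_nonneg _) (mul_nonneg zero_le_two wy)
  calc _ ≤ _ := add_le_add A B
    _ = _ := by ring

lemma HP.prod1 {m L ρ N : ℝ} {h1 h2 : ℝ → ℝ} (H : HP m L ρ N h1 h2) (y z : ℝ) :
    |h1 y * h1 z| ≤ 4 * (wF m L ρ y * wF m L ρ z) := by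
  have wy := (wF_pos m L ρ y).le
  rw [abs_mul]
  have A := mul_le_mul (H.b1 y) (H.b1 z) (abs_nonneg _) (mul_nonneg zero_le_two wy)
  calc _ ≤ _ := A
    _ = _ := by ring

lemma dd {S T : Set ℝ} (hS : MeasurableSet S) (hT : MeasurableSet T) {F1 F2 : ℝ → ℝ → ℝ}
    {D : ℝ × ℝ → ℝ} (hF1 : Measurable (Function.uncurry F1)) (hF2 : Measurable (Function.uncurry F2))
    (hD : Integrable D ((volume.restrict S).prod (volume.restrict T))) {c N B : ℝ}
    (b1 : ∀ y ∈ S, ∀ z ∈ T, |F1 y z| ≤ c * D (y,z))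
    (b2 : ∀ y ∈ S, ∀ z ∈ T, |F2 y z| ≤ c * D (y,z))
    (b : ∀ y ∈ S, ∀ z ∈ T, |F1 y z - F2 y z| ≤ N * D (y,z)) (hN : 0 ≤ N)
    (hB : ∫ p, D p ∂((volume.restrict S).prod (volume.restrict T)) ≤ B) :
    |(∫ y in S, ∫ z in T, F1 y z) - ∫ y in S, ∫ z in T, F2 y z| ≤ N * B := by
  have hae : ∀ᵐ p ∂((volume.restrict S).prod (volume.restrict T)), p.1 ∈ S ∧ p.2 ∈ T := by
    rw [Measure.prod_restrict]
    filter_upwards [ae_restrict_mem (hS.prod hT)] with p hp using hp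
  have i1 : Integrable (Function.uncurry F1) ((volume.restrict S).prod (volume.restrict T)) := by
    refine Integrable.mono' (hD.const_mul c) hF1.aestronglyMeasurable ?_
    filter_upwards [hae] with p hp using b1 _ hp.1 _ hp.2
  have i2 : Integrable (Function.uncurry F2) ((volume.restrict S).prod (volume.restrict T)) := by
    refine Integrable.mono' (hD.const_mul c) hF2.aestronglyMeasurable ?_
    filter_upwards [hae] with p hp using b2 _ hp.1 _ hp.2
  have e1 := integral_prod _ i1
  have e2 := integral_prod _ i2
  simp only [Function.uncurry_apply_pair] at e1 e2
  rw [← e1, ← e2, ← integral_sub i1 i2]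
  rw [← Real.norm_eq_abs]
  refine (norm_integral_le_of_norm_le (hD.const_mul N) ?_).trans ?_
  · filter_upwards [hae] with p hp using b _ hp.1 _ hp.2
  · rw [integral_const_mul]
    exact mul_le_mul_of_nonneg_left hB hN

lemma d1 {S : Set ℝ} (hS : MeasurableSet S) {F1 F2 D : ℝ → ℝ} (hF1 : Measurable F1)
    (hF2 : Measurable F2) {c N B : ℝ} (hD : IB D S B)
    (b1 : ∀ y ∈ S, |F1 y| ≤ c * D y) (b2 : ∀ y ∈ S, |F2 y| ≤ c * D y)
    (b : ∀ y ∈ S, |F1 y - F2 y| ≤ N * D y) (hN : 0 ≤ N) :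
    |(∫ y in S, F1 y) - ∫ y in S, F2 y| ≤ N * B := by
  have i1 : IntegrableOn F1 S := by
    refine Integrable.mono' (hD.1.const_mul c) hF1.aestronglyMeasurable ?_
    filter_upwards [ae_restrict_mem hS] with p hp using b1 _ hp
  have i2 : IntegrableOn F2 S := by
    refine Integrable.mono' (hD.1.const_mul c) hF2.aestronglyMeasurable ?_
    filter_upwards [ae_restrict_mem hS] with p hp using b2 _ hp
  rw [← integral_sub i1 i2]
  rw [← Real.norm_eq_abs]
  refine (norm_integral_le_of_norm_le (hD.1.const_mul N) ?_).trans ?_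
  · filter_upwards [ae_restrict_mem hS] with p hp using b _ hp
  · rw [integral_const_mul]
    exact mul_le_mul_of_nonneg_left hD.2 hN

lemma IBprod {S T : Set ℝ} {f g : ℝ → ℝ} {A B : ℝ}
    (hf : IB f S A) (hg : IB g T B) (hA : 0 ≤ A) (g0 : ∀ x, 0 ≤ g x) :
    Integrable (fun p : ℝ × ℝ => f p.1 * g p.2) ((volume.restrict S).prod (volume.restrict T)) ∧
    ∫ p : ℝ × ℝ, f p.1 * g p.2 ∂((volume.restrict S).prod (volume.restrict T)) ≤ A * B := by
  refine ⟨Integrable.mul_prod hf.1 hg.1, ?_⟩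
  rw [integral_prod_mul]
  exact mul_le_mul hf.2 hg.2 (integral_nonneg g0) hA

lemma meas2 {α : Type} [MeasurableSpace α] (A : α → Set ℝ) {f : α → ℝ → ℝ}
    (hf : Measurable (Function.uncurry f)) (hA : MeasurableSet {p : α × ℝ | p.2 ∈ A p.1}) :
    Measurable fun x => ∫ y in A x, f x y := by
  classical
  have h : (fun x => ∫ y in A x, f x y) =
      fun x => ∫ y, ({p : α × ℝ | p.2 ∈ A p.1}).indicator (Function.uncurry f) (x,y) := by
    ext x
    have : MeasurableSet (A x) := measurable_prodMk_left hA
    rw [← integral_indicator this]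
    rfl
  rw [h]
  exact (StronglyMeasurable.integral_prod_right'
    (hf.indicator hA).stronglyMeasurable).measurable

lemma Q_meas {a K0 δ m L ρ : ℝ} {K : ℝ → ℝ → ℝ} (P : PC a K0 δ m L ρ K) {h : ℝ → ℝ}
    (hh : Measurable h) : Measurable (Qfun K a ρ h) := by
  have h1 : Continuous (fun p : ℝ × ℝ => K (Real.exp ((p.1-p.2)/ρ)) 1) :=
    P.hKc.comp (by fun_prop : Continuous fun p : ℝ × ℝ => (p.1-p.2)/ρ)
  have h2 : Continuous (fun p : ℝ × ℝ => Real.exp (a/ρ*(p.1-p.2))) := by fun_prop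
  have h3 : Measurable (fun p : ℝ × ℝ =>
      Real.exp (a/ρ*(p.1-p.2)) * K (Real.exp ((p.1-p.2)/ρ)) 1 * h p.2) :=
    (h2.mul h1).measurable.mul (hh.comp measurable_snd)
  exact (StronglyMeasurable.integral_prod_right' h3.stronglyMeasurable).measurable

lemma G_meas {a K0 δ m L ρ : ℝ} {K : ℝ → ℝ → ℝ} (P : PC a K0 δ m L ρ K) {h : ℝ → ℝ}
    (hh : Measurable h) : Measurable (fun p : ℝ × ℝ =>
      Real.exp (-(a/ρ)*p.2) * K (Real.exp ((p.1-p.2)/ρ)) 1 * h p.1 * h p.2) :=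
  ((WF_meas P).mul (hh.comp measurable_fst)).mul (hh.comp measurable_snd)

lemma R_meas {a K0 δ m L ρ : ℝ} {K : ℝ → ℝ → ℝ} (P : PC a K0 δ m L ρ K) {h : ℝ → ℝ}
    (hh : Measurable h) : Measurable (Rfun K a L ρ h) := by
  have hG := G_meas P hh
  have hG3 : Measurable (fun p : (ℝ × ℝ) × ℝ =>
      Real.exp (-(a/ρ)*p.2) * K (Real.exp ((p.1.2-p.2)/ρ)) 1 * h p.1.2 * h p.2) :=
    hG.comp (by fun_prop : Measurable fun p : (ℝ × ℝ) × ℝ => (p.1.2, p.2))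
  have hH : Measurable (fun p : ℝ × ℝ =>
      (Real.exp (-(a/ρ)*p.2) * K (Real.exp ((p.1-p.2)/ρ)) 1 - Real.exp (-(a/ρ)*p.1))
        * h p.1 * h p.2) :=
    (((WF_meas P).sub (by fun_prop : Measurable fun p : ℝ × ℝ => Real.exp (-(a/ρ)*p.1))).mul
      (hh.comp measurable_fst)).mul (hh.comp measurable_snd)
  have hH3 : Measurable (fun p : (ℝ × ℝ) × ℝ =>
      (Real.exp (-(a/ρ)*p.2) * K (Real.exp ((p.1.2-p.2)/ρ)) 1 - Real.exp (-(a/ρ)*p.1.2))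
        * h p.1.2 * h p.2) :=
    hH.comp (by fun_prop : Measurable fun p : (ℝ × ℝ) × ℝ => (p.1.2, p.2))
  have mT : Measurable (fun p : (ℝ × ℝ) × ℝ =>
    p.1.1 + ρ * Real.log (1 - Real.exp ((p.1.2-p.1.1)/ρ))) := by fun_prop
  have mI : MeasurableSet {p : ℝ × ℝ | p.2 ∈ Iio p.1} :=
    measurableSet_lt measurable_snd measurable_fst
  have mI' : MeasurableSet {p : ℝ × ℝ | p.2 ∈ Ioi p.1} :=
    measurableSet_lt measurable_fst measurable_snd
  have A' := meas2 (α := ℝ × ℝ)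
    (fun q => Iio (q.1 + ρ * Real.log (1 - Real.exp ((q.2-q.1)/ρ))))
    (f := fun q z => Real.exp (-(a/ρ)*z) * K (Real.exp ((q.2-z)/ρ)) 1 * h q.2 * h z)
    hG3 (measurableSet_lt measurable_snd mT)
  have A := meas2 (α := ℝ) (fun x => Iio x) (f := fun x y => ∫ z in Iio (x + ρ * Real.log (1 - Real.exp ((y-x)/ρ))),
    Real.exp (-(a/ρ)*z) * K (Real.exp ((y-z)/ρ)) 1 * h y * h z) A' mI
  have B1 := meas2 (α := ℝ) (fun x => Ioi x) (f := fun _ y => Real.exp (-(a/ρ)*y) * h y)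
    ((by fun_prop : Measurable fun p : ℝ × ℝ => Real.exp (-(a/ρ)*p.2)).mul
      (hh.comp measurable_snd)) mI'
  have B2 := meas2 (α := ℝ) (fun x => Ioi x) (f := fun _ y => h y) (hh.comp measurable_snd) mI'
  have B3' := meas2 (α := ℝ × ℝ)
    (fun q => Ioi q.1)
    (f := fun q z => (Real.exp (-(a/ρ)*z) * K (Real.exp ((q.2-z)/ρ)) 1 - Real.exp (-(a/ρ)*q.2)) * h q.2 * h z)
    hH3 (measurableSet_lt (by fun_prop : Measurable fun p : (ℝ × ℝ) × ℝ => p.1.1) measurable_snd)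
  have B3 := meas2 (α := ℝ) (fun x => Iio x) (f := fun x y => ∫ z in Ioi x,
    (Real.exp (-(a/ρ)*z) * K (Real.exp ((y-z)/ρ)) 1 - Real.exp (-(a/ρ)*y)) * h y * h z) B3' mI
  have B4' := meas2 (α := ℝ × ℝ)
    (fun q => Ioo (q.1 + ρ * Real.log (1 - Real.exp ((q.2-q.1)/ρ))) q.1)
    (f := fun q z => Real.exp (-(a/ρ)*z) * K (Real.exp ((q.2-z)/ρ)) 1 * h q.2 * h z)
    hG3 ((measurableSet_lt mT measurable_snd).inter
      (measurableSet_lt measurable_snd (by fun_prop : Measurable fun p : (ℝ × ℝ) × ℝ => p.1.1)))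
  have B4 := meas2 (α := ℝ) (fun x => Iio x) (f := fun x y => ∫ z in Ioo (x + ρ * Real.log (1 - Real.exp ((y-x)/ρ))) x,
    Real.exp (-(a/ρ)*z) * K (Real.exp ((y-z)/ρ)) 1 * h y * h z) B4' mI
  unfold Rfun
  refine Measurable.ite measurableSet_Iio (A.const_mul _) ?_
  exact (((B1.const_mul _).mul B2).add (B3.const_mul _)).add (B4.const_mul _)
/-- integrable on a product with integral at most `B` -/
def IB2 (D : ℝ × ℝ → ℝ) (S T : Set ℝ) (B : ℝ) : Prop :=
  Integrable D ((volume.restrict S).prod (volume.restrict T)) ∧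
    ∫ p, D p ∂((volume.restrict S).prod (volume.restrict T)) ≤ B

lemma IB2.add {f g : ℝ × ℝ → ℝ} {S T : Set ℝ} {B B' : ℝ} (h : IB2 f S T B) (h' : IB2 g S T B') :
    IB2 (fun x => f x + g x) S T (B + B') :=
  ⟨h.1.add h'.1, by rw [integral_add h.1 h'.1]; exact add_le_add h.2 h'.2⟩

lemma IB2.mul {f : ℝ × ℝ → ℝ} {S T : Set ℝ} {B : ℝ} (c : ℝ) (hc : 0 ≤ c) (h : IB2 f S T B) :
    IB2 (fun x => c * f x) S T (c*B) :=
  ⟨h.1.const_mul c, by rw [integral_const_mul]; exact mul_le_mul_of_nonneg_left h.2 hc⟩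

lemma IBprod' {S T : Set ℝ} {f g : ℝ → ℝ} {A B : ℝ}
    (hf : IB f S A) (hg : IB g T B) (hA : 0 ≤ A) (g0 : ∀ x, 0 ≤ g x) :
    IB2 (fun p : ℝ × ℝ => f p.1 * g p.2) S T (A * B) := IBprod hf hg hA g0

lemma dd' {S T : Set ℝ} (hS : MeasurableSet S) (hT : MeasurableSet T) {F1 F2 : ℝ → ℝ → ℝ}
    {D : ℝ × ℝ → ℝ} (hF1 : Measurable (Function.uncurry F1)) (hF2 : Measurable (Function.uncurry F2))
    {c N B : ℝ} (hD : IB2 D S T B)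
    (b1 : ∀ y ∈ S, ∀ z ∈ T, |F1 y z| ≤ c * D (y,z))
    (b2 : ∀ y ∈ S, ∀ z ∈ T, |F2 y z| ≤ c * D (y,z))
    (b : ∀ y ∈ S, ∀ z ∈ T, |F1 y z - F2 y z| ≤ N * D (y,z)) (hN : 0 ≤ N) :
    |(∫ y in S, ∫ z in T, F1 y z) - ∫ y in S, ∫ z in T, F2 y z| ≤ N * B :=
  dd hS hT hF1 hF2 hD.1 b1 b2 b hN hD.2

lemma IB.add {f g : ℝ → ℝ} {S : Set ℝ} {B B' : ℝ} (h : IB f S B) (h' : IB g S B') :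
    IB (fun x => f x + g x) S (B + B') :=
  ⟨h.1.add h'.1, by rw [integral_add h.1 h'.1]; exact add_le_add h.2 h'.2⟩

lemma w_univ {m L ρ : ℝ} (hL : 0 < L) (hρ : 0 < ρ) (hρ1 : ρ < 1) (hm : 1 < m) :
    IB (wF m L ρ) univ ((JF m 1 + 2) * Real.exp (2*L)) := by
  have h0 : ∀ y, 0 ≤ wF m L ρ y := fun y => (wF_pos _ _ _ _).le
  have h1 := w_Iio (m := m) hL hρ hm (le_refl (L*ρ))
  have h2 := w_Ioi (m := m) hL hρ (by linarith) (le_refl 0) (L*ρ)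
  have h2' : IB (wF m L ρ) (Ici (L*ρ)) 2 := by
    simp at h2
    exact ⟨(integrableOn_Ici_iff_integrableOn_Ioi (by simp)).2 h2.1, by rw [integral_Ici_eq_integral_Ioi]; exact h2.2⟩
  have h3 := h1.union h2' measurableSet_Ici (by
    rw [Set.disjoint_left]; intro y hy hy'; simp at hy hy'; linarith)
  rw [Iio_union_Ici] at h3
  refine h3.weaken ?_
  have hJ := JF_pos one_pos hm
  have e1 : Real.exp (m * sF L ρ (L*ρ)) ≤ 1 := by
    rw [Real.exp_le_one_iff]
    have := sF_np L ρ (L*ρ)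
    nlinarith
  have e2 : 1 ≤ Real.exp (2*L) := by rw [Real.one_le_exp_iff]; linarith
  have e3 : ρ * JF m 1 * Real.exp (2*L) * Real.exp (m * sF L ρ (L*ρ)) ≤
      1 * JF m 1 * Real.exp (2*L) * 1 := by gcongr
  linarith

lemma Q_diff {a K0 δ m L ρ N : ℝ} {K : ℝ → ℝ → ℝ} (P : PC a K0 δ m L ρ K) {h1 h2 : ℝ → ℝ}
    (H : HP m L ρ N h1 h2) {y : ℝ} (hy : y ≤ L*ρ) :
    |Qfun K a ρ h1 y - Qfun K a ρ h2 y| ≤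
      N * ((1+K0) * (JF m 1 + 2 + JF m (a+1)) * Real.exp ((2*a+2)*L)) := by
  have hL := P.hL
  have hρ := P.hρ
  have ha := P.ha
  have hK0 := P.hK0
  have hN := H.hN
  have hJ := JF_pos one_pos P.m1
  have hJ' := JF_pos (by linarith : 0 < a+1) P.hm1
  have hw := w_univ (m := m) hL hρ P.hρ1 P.m1
  have hJt := (J_tot (m := m) hL hρ (by linarith : 0 < a+1) P.hm1).mul (Real.exp ((a+1)/ρ*y))
    (Real.exp_pos _).le
  have hD := ((hw.add hJt).mul (1+K0) (by linarith))
  have key : ∀ z, 0 ≤ Real.exp (a/ρ*(y-z)) * K (Real.exp ((y-z)/ρ)) 1 ∧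
      Real.exp (a/ρ*(y-z)) * K (Real.exp ((y-z)/ρ)) 1 * wF m L ρ z ≤
      (1+K0) * (wF m L ρ z + Real.exp ((a+1)/ρ*y) * (Real.exp (-((a+1)/ρ)*z) * wF m L ρ z)) := by
    intro z
    refine ⟨mul_nonneg (Real.exp_pos _).le (P.hK _), ?_⟩
    have h := mul_le_mul_of_nonneg_left (WF_12 P y z) (Real.exp_pos (a/ρ*y)).le
    have e : Real.exp (a/ρ*y) * WF K a ρ y z =
        Real.exp (a/ρ*(y-z)) * K (Real.exp ((y-z)/ρ)) 1 := by
      rw [WF, ← mul_assoc, ← Real.exp_add]; congr 2; ring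
    have e2 : Real.exp (a/ρ*y) * ((1+K0) * (Real.exp (-(a/ρ)*y) +
        Real.exp (y/ρ) * Real.exp (-((a+1)/ρ)*z))) =
        (1+K0) * (1 + Real.exp ((a+1)/ρ*y) * Real.exp (-((a+1)/ρ)*z)) := by
      have e3 : Real.exp (a/ρ*y) * Real.exp (-(a/ρ)*y) = 1 := by
        rw [← Real.exp_add]; simp
      have e4 : Real.exp (a/ρ*y) * Real.exp (y/ρ) = Real.exp ((a+1)/ρ*y) := by
        rw [← Real.exp_add]; congr 1; ring
      linear_combination (1+K0) * e3 + (1+K0) * Real.exp (-((a+1)/ρ)*z) * e4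
    rw [e, e2] at h
    have := mul_le_mul_of_nonneg_right h (wF_pos m L ρ z).le
    refine this.trans (le_of_eq ?_)
    ring
  have mk : ∀ h : ℝ → ℝ, Measurable h → Measurable fun z =>
      Real.exp (a/ρ*(y-z)) * K (Real.exp ((y-z)/ρ)) 1 * h z := by
    intro h hh
    have h1 : Continuous (fun p : ℝ => K (Real.exp ((y-p)/ρ)) 1) :=
      P.hKc.comp (by fun_prop : Continuous fun p : ℝ => (y-p)/ρ)
    exact ((by fun_prop : Continuous fun z => Real.exp (a/ρ*(y-z))).mul h1).measurable.mul hh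
  have bk : ∀ (h : ℝ → ℝ) (c z : ℝ), 0 ≤ c → |h z| ≤ c * wF m L ρ z →
      |Real.exp (a/ρ*(y-z)) * K (Real.exp ((y-z)/ρ)) 1 * h z| ≤ c *
      ((1+K0) * (wF m L ρ z + Real.exp ((a+1)/ρ*y) * (Real.exp (-((a+1)/ρ)*z) * wF m L ρ z))) := by
    intro h c z hc hh
    rw [abs_mul, abs_of_nonneg (key z).1]
    refine (mul_le_mul_of_nonneg_left hh (key z).1).trans ?_
    rw [mul_left_comm]
    exact mul_le_mul_of_nonneg_left (key z).2 hc
  have := d1 MeasurableSet.univ (mk h1 H.m1) (mk h2 H.m2) hD (c := 2) (N := N)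
    (fun z _ => bk h1 2 z (by norm_num) (H.b1 z)) (fun z _ => bk h2 2 z (by norm_num) (H.b2 z))
    (fun z _ => by rw [← mul_sub]; exact bk (fun z => h1 z - h2 z) N z hN (H.b z)) hN
  simp only [Measure.restrict_univ] at this
  refine this.trans ?_
  gcongr ?_ * ?_
  rw [mul_assoc (1+K0)]
  refine mul_le_mul_of_nonneg_left ?_ (by linarith)
  have f1 : Real.exp (2*L) ≤ Real.exp ((2*a+2)*L) := by
    rw [Real.exp_le_exp]; nlinarith
  have f2 : Real.exp ((a+1)/ρ*y) * Real.exp ((a+1)*L) ≤ Real.exp ((2*a+2)*L) := by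
    rw [← Real.exp_add, Real.exp_le_exp]
    have : y/ρ ≤ L := by rw [div_le_iff₀ hρ]; exact hy
    have e : (a+1)/ρ*y = (a+1)*(y/ρ) := by ring
    rw [e]; nlinarith
  have g1 := mul_le_mul_of_nonneg_left f1 (by linarith : 0 ≤ JF m 1 + 2)
  have g2 := mul_le_mul_of_nonneg_left f2 (by positivity : 0 ≤ ρ * JF m (a+1))
  have g3 : ρ * JF m (a+1) * Real.exp ((2*a+2)*L) ≤ 1 * JF m (a+1) * Real.exp ((2*a+2)*L) := by
    gcongr; exact P.hρ1.le
  linarith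

lemma T_le {ρ x y : ℝ} (hρ : 0 < ρ) (h : y < x) :
    x + ρ * Real.log (1 - Real.exp ((y-x)/ρ)) ≤ x := by
  have h1 : (y-x)/ρ < 0 := div_neg_of_neg_of_pos (by linarith) hρ
  have h2 : Real.exp ((y-x)/ρ) < 1 := by rwa [Real.exp_lt_one_iff]
  have := Real.log_nonpos (by linarith : 0 ≤ 1 - Real.exp ((y-x)/ρ))
    (by linarith [Real.exp_pos ((y-x)/ρ)])
  nlinarith

lemma R_low {a K0 δ m L ρ N : ℝ} {K : ℝ → ℝ → ℝ} (P : PC a K0 δ m L ρ K) {h1 h2 : ℝ → ℝ}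
    (H : HP m L ρ N h1 h2) {x : ℝ} (hx : x < L*ρ) :
    |Rfun K a L ρ h1 x - Rfun K a L ρ h2 x| ≤
      N * (4 * (1+K0) * (JF m a * JF m 1 + JF m (a+1)) * ρ * Real.exp ((a+2)*L)
        * Real.exp ((2*m-a) * sF L ρ x)) := by
  classical
  have hL := P.hL
  have hρ := P.hρ
  have ha := P.ha
  have hK0 := P.hK0
  have hN := H.hN
  have hm := P.m0
  have hJ1 := JF_pos one_pos P.m1
  have hJa := JF_pos ha (by linarith [P.hm1] : a < m)
  have hJ' := JF_pos (by linarith : 0 < a+1) P.hm1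
  set T : ℝ → ℝ := fun y => x + ρ * Real.log (1 - Real.exp ((y-x)/ρ)) with hT
  have conv : ∀ h : ℝ → ℝ, Rfun K a L ρ h x = -(1/ρ) * ∫ y in Iio x, ∫ z in Iio x,
      (if z < T y then WF K a ρ y z * (h y * h z) else 0) := by
    intro h
    rw [Rfun, if_pos hx]
    congr 1
    apply setIntegral_congr_fun measurableSet_Iio
    intro y hy
    have hTy : T y ≤ x := T_le hρ hy
    have : (fun z => if z < T y then WF K a ρ y z * (h y * h z) else 0) =
        (Iio (T y)).indicator (fun z => WF K a ρ y z * (h y * h z)) := by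
      ext z; simp [indicator_apply]
    simp only [this]
    rw [setIntegral_indicator measurableSet_Iio, Iio_inter_Iio, min_eq_right hTy]
    simp only [WF, mul_assoc]
    rfl
  have p1 := IBprod' (J_Iio (m := m) hL hρ ha (by linarith [P.hm1]) x) (w_Iio (m := m) hL hρ P.m1 hx.le)
    (by positivity) (fun z => (wF_pos _ _ _ _).le)
  have p2 := IBprod' (ew_Iio (m := m) hL hρ hm hx.le) (J_Iio (m := m) hL hρ (by linarith : 0 < a+1) P.hm1 x)
    (by positivity) (fun z => mul_nonneg (Real.exp_pos _).le (wF_pos _ _ _ _).le)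
  have hD := (p1.add p2).mul (1+K0) (by linarith)
  have mk : ∀ h : ℝ → ℝ, Measurable h → Measurable (Function.uncurry fun y z =>
      if z < T y then WF K a ρ y z * (h y * h z) else 0) := by
    intro h hh
    refine Measurable.ite (measurableSet_lt measurable_snd (by fun_prop)) ?_ measurable_const
    exact (WF_meas P).mul ((hh.comp measurable_fst).mul (hh.comp measurable_snd))
  have key : ∀ (c v y z : ℝ), 0 ≤ c → |v| ≤ c * (wF m L ρ y * wF m L ρ z) →
      |if z < T y then WF K a ρ y z * v else 0| ≤ c * ((1+K0) *
        ((Real.exp (-(a/ρ)*y) * wF m L ρ y) * wF m L ρ z +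
          (Real.exp (y/ρ) * wF m L ρ y) * (Real.exp (-((a+1)/ρ)*z) * wF m L ρ z))) := by
    intro c v y z hc hv
    have wy := wF_pos m L ρ y
    have wz := wF_pos m L ρ z
    split_ifs
    · rw [abs_mul, abs_of_nonneg (WF_nn P y z)]
      calc _ ≤ ((1+K0) * (Real.exp (-(a/ρ)*y) + Real.exp (y/ρ) * Real.exp (-((a+1)/ρ)*z))) *
            (c * (wF m L ρ y * wF m L ρ z)) := by
              gcongr
              exact WF_12 P y z
        _ = _ := by ring
    · rw [abs_zero]; positivity
  have := dd' measurableSet_Iio measurableSet_Iio (mk h1 H.m1) (mk h2 H.m2) hD (c := 4) (N := 4*N)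
    (fun y _ z _ => key 4 _ y z (by norm_num) (H.prod1 y z))
    (fun y _ z _ => key 4 _ y z (by norm_num) (H.symm.prod1 y z))
    (fun y _ z _ => by
      have := key (4*N) _ y z (by positivity) (H.prod y z)
      convert this using 2
      split_ifs <;> simp [mul_sub])
    (by positivity)
  rw [conv h1, conv h2, ← mul_sub, abs_mul, abs_neg, abs_of_pos (by positivity : 0 < 1/ρ)]
  refine (mul_le_mul_of_nonneg_left this (by positivity : 0 ≤ 1/ρ)).trans (le_of_eq ?_)
  have E1 : Real.exp (a*L) * Real.exp ((m-a)*sF L ρ x) * (Real.exp (2*L) * Real.exp (m*sF L ρ x)) =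
      Real.exp ((a+2)*L) * Real.exp ((2*m-a) * sF L ρ x) := by
    simp only [← Real.exp_add]; congr 1; ring
  have E2 : Real.exp L * Real.exp ((m+1)*sF L ρ x) *
      (Real.exp ((a+1)*L) * Real.exp ((m-(a+1))*sF L ρ x)) =
      Real.exp ((a+2)*L) * Real.exp ((2*m-a) * sF L ρ x) := by
    simp only [← Real.exp_add]; congr 1; ring
  calc _ = N * (4 * (1+K0) * (JF m a * JF m 1 * (Real.exp (a*L) * Real.exp ((m-a)*sF L ρ x) *
        (Real.exp (2*L) * Real.exp (m*sF L ρ x))) + JF m (a+1) * (Real.exp L *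
        Real.exp ((m+1)*sF L ρ x) * (Real.exp ((a+1)*L) * Real.exp ((m-(a+1))*sF L ρ x)))) * ρ) := by
        field_simp
    _ = _ := by rw [E1, E2]; ring
lemma reg_aux {ρ x u v : ℝ} (hρ : 0 < ρ) (hu : u < x) (hvu : v ≤ u)
    (h : 1 - Real.exp ((u-x)/ρ) < Real.exp ((v-x)/ρ)) :
    x - ρ < u ∧ x - 2*ρ*Real.exp ((v-x)/ρ) < u := by
  set q := Real.exp ((v-x)/ρ) with hq
  set p := Real.exp ((u-x)/ρ) with hp
  have hqp : q ≤ p := by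
    rw [hq, hp, Real.exp_le_exp]; gcongr
  obtain ⟨t, ht⟩ : ∃ t, t = (x-u)/ρ := ⟨_, rfl⟩
  have ht0 : 0 < t := by rw [ht]; exact div_pos (by linarith) hρ
  have hxu : x - u = ρ * t := by rw [ht]; field_simp
  have hpt : Real.exp t * p = 1 := by
    rw [hp, ht, ← Real.exp_add]
    have : (x-u)/ρ + (u-x)/ρ = 0 := by ring
    rw [this, Real.exp_zero]
  have hp0 : 0 < p := Real.exp_pos _
  have h1 : (t+1) * p ≤ 1 :=
    (mul_le_mul_of_nonneg_right (Real.add_one_le_exp t) hp0.le).trans hpt.le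
  have hp2 : 1/2 < p := by linarith
  constructor
  · have : t < 1 := by nlinarith
    nlinarith
  · have : t < 2*q := by nlinarith
    nlinarith

lemma T_lt {ρ x y z : ℝ} (hρ : 0 < ρ) (hy : y < x)
    (h : x + ρ * Real.log (1 - Real.exp ((y-x)/ρ)) < z) :
    1 - Real.exp ((y-x)/ρ) < Real.exp ((z-x)/ρ) := by
  have h1 : (y-x)/ρ < 0 := div_neg_of_neg_of_pos (by linarith) hρ
  have h2 : Real.exp ((y-x)/ρ) < 1 := by rwa [Real.exp_lt_one_iff]
  rw [← Real.log_lt_iff_lt_exp (by linarith), lt_div_iff₀ hρ]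
  linarith

lemma wF_near {m L ρ x u : ℝ} (hm : 0 < m) (hL : 0 < L) (hρ : 0 < ρ) (hρ1 : ρ < 1)
    (h : x - ρ < u) : wF m L ρ u ≤ 2 * Real.exp (-(1/2)*(x - L*ρ)) := by
  refine (wF_le3 hm hL hρ u).trans ?_
  have e1 : Real.exp (1/2) ≤ 2 := by
    have h1 := Real.add_one_le_exp (-(1/2:ℝ))
    have h2 : Real.exp (1/2) * Real.exp (-(1/2)) = 1 := by rw [← Real.exp_add]; simp
    nlinarith [Real.exp_pos (1/2)]
  calc _ ≤ Real.exp (1/2 + -(1/2)*(x - L*ρ)) := by rw [Real.exp_le_exp]; linarith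
    _ = Real.exp (1/2) * Real.exp (-(1/2)*(x - L*ρ)) := Real.exp_add _ _
    _ ≤ _ := by gcongr

lemma IB2_slice {x : ℝ} {c v : ℝ → ℝ} {B : ℝ} (hc : Measurable c) (hv : Measurable v)
    (c0 : ∀ z, 0 ≤ c z) (v0 : ∀ z, 0 ≤ v z) {T : Set ℝ} (hB : IB (fun z => c z * v z) T B) :
    IB2 (fun p => if x - c p.2 < p.1 then v p.2 else 0) (Iio x) T B := by
  have inner : ∀ z, ∫ y in Iio x, (if x - c z < y then v z else 0) = c z * v z := by
    intro z
    have : (fun y => if x - c z < y then v z else 0) = (Ioi (x - c z)).indicator (fun _ => v z) := by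
      ext y; simp [indicator_apply]
    rw [this, setIntegral_indicator measurableSet_Ioi, setIntegral_const, Iio_inter_Ioi]
    simp [Measure.real, c0 z]
  have hmeas : Measurable (fun p : ℝ × ℝ => if x - c p.2 < p.1 then v p.2 else 0) :=
    Measurable.ite (measurableSet_lt (by fun_prop) measurable_fst) (by fun_prop) measurable_const
  have hint : Integrable (fun p : ℝ × ℝ => if x - c p.2 < p.1 then v p.2 else 0)
      ((volume.restrict (Iio x)).prod (volume.restrict T)) := by
    rw [integrable_prod_iff' hmeas.aestronglyMeasurable]
    constructor
    · refine Eventually.of_forall fun z => ?_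
      have : (fun y => if x - c z < y then v z else 0) =
          (Ioi (x - c z)).indicator (fun _ => v z) := by
        ext y; simp [indicator_apply]
      simp only [this]
      rw [integrable_indicator_iff measurableSet_Ioi, IntegrableOn,
        Measure.restrict_restrict measurableSet_Ioi, Ioi_inter_Iio]
      exact integrableOn_const (by simp)
    · have : (fun z => ∫ y in Iio x, ‖(if x - c z < y then v z else 0)‖) = fun z => c z * v z := by
        ext z
        rw [← inner z]
        congr 1; ext y
        rw [Real.norm_eq_abs, abs_of_nonneg]
        split_ifs
        · exact v0 z
        · exact le_rfl
      simp only [this]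
      exact hB.1
  refine ⟨hint, ?_⟩
  rw [integral_prod_symm _ hint]
  simp only [inner]
  exact hB.2

lemma R_t1 {a K0 δ m L ρ N : ℝ} {K : ℝ → ℝ → ℝ} (P : PC a K0 δ m L ρ K) {h1 h2 : ℝ → ℝ}
    (H : HP m L ρ N h1 h2) {x : ℝ} (hx : L*ρ ≤ x) :
    |(∫ y in Ioi x, Real.exp (-(a/ρ)*y) * h1 y) * (∫ z in Ioi x, h1 z) -
      (∫ y in Ioi x, Real.exp (-(a/ρ)*y) * h2 y) * (∫ z in Ioi x, h2 z)| ≤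
      N * (8/a * ρ * Real.exp (-a*L) * Real.exp (-(1/2)*(x-L*ρ))) := by
  have hL := P.hL
  have hρ := P.hρ
  have ha := P.ha
  have hN := H.hN
  set E := Real.exp (-(1/2)*(x-L*ρ)) with hE
  have hE0 : 0 < E := Real.exp_pos _
  have hE1 : E ≤ 1 := by rw [hE, Real.exp_le_one_iff]; linarith
  have I1 := w_Ioi' (m := m) hL hρ P.m0 ha x
  have I2 := w_Ioi (m := m) hL hρ P.m0 (le_refl 0) x
  simp only [neg_zero, zero_mul, Real.exp_zero, one_mul] at I2
  rw [← hE] at I1 I2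
  have A : ∀ {N' : ℝ} {g1 g2 : ℝ → ℝ}, HP m L ρ N' g1 g2 →
      |(∫ y in Ioi x, Real.exp (-(a/ρ)*y) * g1 y) - ∫ y in Ioi x, Real.exp (-(a/ρ)*y) * g2 y| ≤
        N' * (ρ/a * (Real.exp (-(a/ρ)*x) * E)) := by
    intro N' g1 g2 G
    have mk : ∀ h : ℝ → ℝ, Measurable h → Measurable fun y => Real.exp (-(a/ρ)*y) * h y :=
      fun h hh => (by fun_prop : Measurable fun y => Real.exp (-(a/ρ)*y)).mul hh
    have bk : ∀ (c v y : ℝ), |v| ≤ c * wF m L ρ y → |Real.exp (-(a/ρ)*y) * v| ≤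
        c * (Real.exp (-(a/ρ)*y) * wF m L ρ y) := by
      intro c v y h
      rw [abs_mul, abs_of_pos (Real.exp_pos _), mul_left_comm]
      gcongr
    exact d1 measurableSet_Ioi (mk _ G.m1) (mk _ G.m2) I1 (c := 2)
      (fun y _ => bk _ _ _ (G.b1 y)) (fun y _ => bk _ _ _ (G.b2 y))
      (fun y _ => by rw [← mul_sub]; exact bk _ _ _ (G.b y)) G.hN
  have B : ∀ {N' : ℝ} {g1 g2 : ℝ → ℝ}, HP m L ρ N' g1 g2 →
      |(∫ y in Ioi x, g1 y) - ∫ y in Ioi x, g2 y| ≤ N' * (2 * E) := by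
    intro N' g1 g2 G
    exact d1 measurableSet_Ioi G.m1 G.m2 I2 (c := 2)
      (fun y _ => G.b1 y) (fun y _ => G.b2 y) (fun y _ => G.b y) G.hN
  have a1 := A H
  have a2 := A H.symm.zero
  have b1 := B H.zero
  have b2 := B H
  simp only [mul_zero, integral_zero, sub_zero] at a2 b1
  set A1 := ∫ y in Ioi x, Real.exp (-(a/ρ)*y) * h1 y
  set A2 := ∫ y in Ioi x, Real.exp (-(a/ρ)*y) * h2 y
  set B1 := ∫ y in Ioi x, h1 y
  set B2 := ∫ y in Ioi x, h2 y
  have e : A1 * B1 - A2 * B2 = (A1 - A2) * B1 + A2 * (B1 - B2) := by ring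
  rw [e]
  have X : Real.exp (-(a/ρ)*x) ≤ Real.exp (-a*L) := by
    rw [Real.exp_le_exp]
    have : L ≤ x/ρ := by rw [le_div_iff₀ hρ]; exact hx
    have e : -(a/ρ)*x = -a*(x/ρ) := by ring
    rw [e]; nlinarith
  calc _ ≤ |A1 - A2| * |B1| + |A2| * |B1 - B2| := by
        refine (abs_add_le _ _).trans ?_
        rw [abs_mul, abs_mul]
    _ ≤ N * (ρ/a * (Real.exp (-(a/ρ)*x) * E)) * (2 * (2*E)) +
        2 * (ρ/a * (Real.exp (-(a/ρ)*x) * E)) * (N * (2*E)) := by gcongr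
    _ = N * (8/a * ρ * Real.exp (-(a/ρ)*x) * (E * E)) := by ring
    _ ≤ N * (8/a * ρ * Real.exp (-a*L) * (E * 1)) := by gcongr
    _ = _ := by ring

lemma R_t2 {a K0 δ m L ρ N : ℝ} {K : ℝ → ℝ → ℝ} (P : PC a K0 δ m L ρ K) {h1 h2 : ℝ → ℝ}
    (H : HP m L ρ N h1 h2) {x : ℝ} (hx : L*ρ ≤ x) :
    |(∫ y in Iio x, ∫ z in Ioi x,
        (Real.exp (-(a/ρ)*z) * K (Real.exp ((y-z)/ρ)) 1 - Real.exp (-(a/ρ)*y)) * h1 y * h1 z) -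
      (∫ y in Iio x, ∫ z in Ioi x,
        (Real.exp (-(a/ρ)*z) * K (Real.exp ((y-z)/ρ)) 1 - Real.exp (-(a/ρ)*y)) * h2 y * h2 z)| ≤
      N * (4 * K0 * JF m (a-δ) / δ * ρ * (ρ * Real.exp (a*L)) * Real.exp (-(1/2)*(x-L*ρ))) := by
  have hL := P.hL
  have hρ := P.hρ
  have ha := P.ha
  have hδ := P.hδ
  have hδa := P.hδa
  have hK0 := P.hK0
  have hN := H.hN
  set E := Real.exp (-(1/2)*(x-L*ρ)) with hE
  have hE0 : 0 < E := Real.exp_pos _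
  have hJ := JF_pos (by linarith : 0 < a - δ) (by linarith [P.hm1] : a - δ < m)
  have I1 := (J_tot (m := m) hL hρ (by linarith : 0 < a - δ) (by linarith [P.hm1])).subset
    MeasurableSet.univ (subset_univ (Iio x))
    fun y _ => mul_nonneg (Real.exp_pos _).le (wF_pos _ _ _ _).le
  have I2 := w_Ioi' (m := m) hL hρ P.m0 hδ x
  have hD := (IBprod' I1 I2 (by positivity)
    (fun z => mul_nonneg (Real.exp_pos _).le (wF_pos _ _ _ _).le)).mul K0 hK0.le
  have mk : ∀ h : ℝ → ℝ, Measurable h → Measurable (Function.uncurry fun y z =>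
      (Real.exp (-(a/ρ)*z) * K (Real.exp ((y-z)/ρ)) 1 - Real.exp (-(a/ρ)*y)) * h y * h z) :=
    fun h hh => (((WF_meas P).sub
      (by fun_prop : Measurable fun p : ℝ × ℝ => Real.exp (-(a/ρ)*p.1))).mul
      (hh.comp measurable_fst)).mul (hh.comp measurable_snd)
  have key : ∀ (c v y z : ℝ), 0 ≤ c → y ∈ Iio x → z ∈ Ioi x →
      |v| ≤ c * (wF m L ρ y * wF m L ρ z) →
      |(Real.exp (-(a/ρ)*z) * K (Real.exp ((y-z)/ρ)) 1 - Real.exp (-(a/ρ)*y)) * v| ≤ c * (K0 *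
        ((Real.exp (-((a-δ)/ρ)*y) * wF m L ρ y) * (Real.exp (-(δ/ρ)*z) * wF m L ρ z))) := by
    intro c v y z hc hy hz hv
    simp only [mem_Iio, mem_Ioi] at hy hz
    rw [abs_mul]
    have wy := wF_pos m L ρ y
    have wz := wF_pos m L ρ z
    have := WF_d P (by linarith : y ≤ z)
    unfold WF at this
    calc _ ≤ K0 * (Real.exp (-((a-δ)/ρ)*y) * Real.exp (-(δ/ρ)*z)) *
          (c * (wF m L ρ y * wF m L ρ z)) := by gcongr
      _ = _ := by ring
  have := dd' measurableSet_Iio measurableSet_Ioi (mk h1 H.m1) (mk h2 H.m2) hD (c := 4) (N := 4*N)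
    (fun y hy z hz => by
      rw [mul_assoc]; exact key 4 _ y z (by norm_num) hy hz (H.prod1 y z))
    (fun y hy z hz => by
      rw [mul_assoc]; exact key 4 _ y z (by norm_num) hy hz (H.symm.prod1 y z))
    (fun y hy z hz => by
      rw [mul_assoc, mul_assoc, ← mul_sub]
      exact key (4*N) _ y z (by positivity) hy hz (H.prod y z))
    (by positivity)
  refine this.trans ?_
  have X : Real.exp ((a-δ)*L) * Real.exp (-(δ/ρ)*x) ≤ Real.exp (a*L) := by
    rw [← Real.exp_add, Real.exp_le_exp]
    have : L ≤ x/ρ := by rw [le_div_iff₀ hρ]; exact hx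
    have e : -(δ/ρ)*x = -δ*(x/ρ) := by ring
    rw [e]; nlinarith
  calc _ = N * (4 * K0 * JF m (a-δ) / δ * ρ *
        (ρ * (Real.exp ((a-δ)*L) * Real.exp (-(δ/ρ)*x))) * E) := by rw [← hE]; ring
    _ ≤ _ := by gcongr

lemma R_t3 {a K0 δ m L ρ N : ℝ} {K : ℝ → ℝ → ℝ} (P : PC a K0 δ m L ρ K) {h1 h2 : ℝ → ℝ}
    (H : HP m L ρ N h1 h2) {x : ℝ} :
    |(∫ y in Iio x, ∫ z in Ioo (x + ρ * Real.log (1 - Real.exp ((y-x)/ρ))) x,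
        Real.exp (-(a/ρ)*z) * K (Real.exp ((y-z)/ρ)) 1 * h1 y * h1 z) -
      (∫ y in Iio x, ∫ z in Ioo (x + ρ * Real.log (1 - Real.exp ((y-x)/ρ))) x,
        Real.exp (-(a/ρ)*z) * K (Real.exp ((y-z)/ρ)) 1 * h2 y * h2 z)| ≤
      N * (24 * (1+K0) * JF m a * ρ * (ρ * Real.exp (a*L)) * Real.exp (-(1/2)*(x-L*ρ))) := by
  classical
  have hL := P.hL
  have hρ := P.hρ
  have ha := P.ha
  have hK0 := P.hK0
  have hN := H.hN
  set E := Real.exp (-(1/2)*(x-L*ρ)) with hE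
  have hE0 : 0 < E := Real.exp_pos _
  have hJ := JF_pos ha (by linarith [P.hm1] : a < m)
  set T : ℝ → ℝ := fun y => x + ρ * Real.log (1 - Real.exp ((y-x)/ρ)) with hT
  have conv : ∀ h : ℝ → ℝ, (∫ y in Iio x, ∫ z in Ioo (T y) x,
        Real.exp (-(a/ρ)*z) * K (Real.exp ((y-z)/ρ)) 1 * h y * h z) =
      ∫ y in Iio x, ∫ z in Iio x, (if T y < z then WF K a ρ y z * (h y * h z) else 0) := by
    intro h
    apply setIntegral_congr_fun measurableSet_Iio
    intro y hy
    have : (fun z => if T y < z then WF K a ρ y z * (h y * h z) else 0) =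
        (Ioi (T y)).indicator (fun z => WF K a ρ y z * (h y * h z)) := by
      ext z; simp [indicator_apply]
    simp only [this]
    rw [setIntegral_indicator measurableSet_Ioi, Iio_inter_Ioi]
    simp only [WF, mul_assoc]
  have I1 := (J_tot (m := m) hL hρ ha (by linarith [P.hm1])).subset
    MeasurableSet.univ (subset_univ (Iio x))
    fun y _ => mul_nonneg (Real.exp_pos _).le (wF_pos _ _ _ _).le
  have Ig : IB (fun z => if x - ρ < z then 2*E else 0) (Iio x) (2*E*ρ) := by
    have : (fun z => if x - ρ < z then 2*E else 0) = (Ioi (x - ρ)).indicator (fun _ => 2*E) := by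
      ext y; simp [indicator_apply]
    rw [this]
    constructor
    · rw [IntegrableOn, integrable_indicator_iff measurableSet_Ioi, IntegrableOn,
        Measure.restrict_restrict measurableSet_Ioi, Ioi_inter_Iio]
      exact integrableOn_const (by simp)
    · rw [setIntegral_indicator measurableSet_Ioi, setIntegral_const, Iio_inter_Ioi]
      simp [Measure.real, hρ.le]; linarith
  have p1 := IBprod' I1 Ig (by positivity) (fun z => by split_ifs <;> positivity)
  have mw : Measurable (wF m L ρ) := wF_meas m L ρ
  have p2 := IB2_slice (x := x) (c := fun z => 2*ρ*Real.exp ((z-x)/ρ))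
    (v := fun z => 2*E*Real.exp (x/ρ) * (Real.exp (-((a+1)/ρ)*z) * wF m L ρ z))
    (T := Iio x) (B := 4*ρ*E * (ρ * JF m a * Real.exp (a*L))) (by fun_prop)
    (by fun_prop) (fun z => by positivity)
    (fun z => by have := wF_pos m L ρ z; positivity) (by
      have := I1.mul (4*ρ*E) (by positivity)
      convert this using 2 with z
      have e : Real.exp ((z-x)/ρ) * Real.exp (x/ρ) * Real.exp (-((a+1)/ρ)*z) =
          Real.exp (-(a/ρ)*z) := by
        rw [← Real.exp_add, ← Real.exp_add]; congr 1; ring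
      rw [← e]; ring)
  have hD := (p1.add p2).mul (1+K0) (by linarith)
  have mk : ∀ h : ℝ → ℝ, Measurable h → Measurable (Function.uncurry fun y z =>
      if T y < z then WF K a ρ y z * (h y * h z) else 0) := by
    intro h hh
    refine Measurable.ite (measurableSet_lt (by fun_prop) measurable_snd) ?_ measurable_const
    exact (WF_meas P).mul ((hh.comp measurable_fst).mul (hh.comp measurable_snd))
  have key : ∀ (c v y z : ℝ), 0 ≤ c → y ∈ Iio x → z ∈ Iio x →
      |v| ≤ c * (wF m L ρ y * wF m L ρ z) →
      |if T y < z then WF K a ρ y z * v else 0| ≤ c * ((1+K0) *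
        ((Real.exp (-(a/ρ)*y) * wF m L ρ y) * (if x - ρ < z then 2*E else 0) +
          (if x - 2*ρ*Real.exp ((z-x)/ρ) < y then
            2*E*Real.exp (x/ρ) * (Real.exp (-((a+1)/ρ)*z) * wF m L ρ z) else 0))) := by
    intro c v y z hc hy hz hv
    simp only [mem_Iio] at hy hz
    have wy := wF_pos m L ρ y
    have wz := wF_pos m L ρ z
    have n1 : 0 ≤ (Real.exp (-(a/ρ)*y) * wF m L ρ y) * (if x - ρ < z then 2*E else 0) := by
      split_ifs <;> positivity
    have n2 : 0 ≤ (if x - 2*ρ*Real.exp ((z-x)/ρ) < y then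
            2*E*Real.exp (x/ρ) * (Real.exp (-((a+1)/ρ)*z) * wF m L ρ z) else 0) := by
      split_ifs <;> positivity
    by_cases hTz : T y < z
    · rw [if_pos hTz, abs_mul, abs_of_nonneg (WF_nn P y z)]
      have hr := T_lt hρ hy hTz
      rcases le_total y z with hyz | hyz
      · have hz' := (reg_aux hρ hz hyz (by linarith)).1
        have hw := wF_near P.m0 hL hρ P.hρ1 hz'
        rw [← hE] at hw
        calc _ ≤ ((1+K0) * Real.exp (-(a/ρ)*y)) * (c * (wF m L ρ y * (2*E))) := by
              refine mul_le_mul (WF_1 P hyz) (hv.trans ?_) (abs_nonneg _) (by positivity)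
              gcongr
          _ = c * ((1+K0) * ((Real.exp (-(a/ρ)*y) * wF m L ρ y) *
                (if x - ρ < z then 2*E else 0))) := by rw [if_pos hz']; ring
          _ ≤ _ := by gcongr; linarith
      · have hy' := reg_aux hρ hy hyz (by linarith)
        have hw := wF_near P.m0 hL hρ P.hρ1 hy'.1
        rw [← hE] at hw
        calc _ ≤ ((1+K0) * (Real.exp (x/ρ) * Real.exp (-((a+1)/ρ)*z))) *
              (c * (2*E * wF m L ρ z)) := by
              refine mul_le_mul ((WF_2 P hyz).trans ?_) (hv.trans ?_) (abs_nonneg _) (by positivity)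
              · gcongr
              · gcongr
          _ = c * ((1+K0) * (if x - 2*ρ*Real.exp ((z-x)/ρ) < y then
            2*E*Real.exp (x/ρ) * (Real.exp (-((a+1)/ρ)*z) * wF m L ρ z) else 0)) := by
              rw [if_pos hy'.2]; ring
          _ ≤ _ := by gcongr; linarith
    · rw [if_neg hTz, abs_zero]
      exact mul_nonneg hc (mul_nonneg (by linarith) (add_nonneg n1 n2))
  have := dd' measurableSet_Iio measurableSet_Iio (mk h1 H.m1) (mk h2 H.m2) hD (c := 4) (N := 4*N)
    (fun y hy z hz => key 4 _ y z (by norm_num) hy hz (H.prod1 y z))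
    (fun y hy z hz => key 4 _ y z (by norm_num) hy hz (H.symm.prod1 y z))
    (fun y hy z hz => by
      have := key (4*N) _ y z (by positivity) hy hz (H.prod y z)
      convert this using 2
      split_ifs <;> simp [mul_sub])
    (by positivity)
  rw [conv h1, conv h2]
  refine this.trans (le_of_eq ?_)
  ring

lemma R_high {a K0 δ m L ρ N : ℝ} {K : ℝ → ℝ → ℝ} (P : PC a K0 δ m L ρ K) {h1 h2 : ℝ → ℝ}
    (H : HP m L ρ N h1 h2) {x : ℝ} (hx : L*ρ ≤ x) :
    |Rfun K a L ρ h1 x - Rfun K a L ρ h2 x| ≤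
      N * ((8/a + 4 * K0 * JF m (a-δ) / δ + 24 * (1+K0) * JF m a) *
        (Real.exp (-a*L) + ρ * Real.exp (a*L)) * Real.exp (-(1/2)*(x-L*ρ))) := by
  have t1 := R_t1 P H hx
  have t2 := R_t2 P H hx
  have t3 := R_t3 P H (x := x)
  have hρ := P.hρ
  have ha := P.ha
  have hδ := P.hδ
  have hδa := P.hδa
  have hK0 := P.hK0
  have hN := H.hN
  have hJ := JF_pos (by linarith : 0 < a - δ) (by linarith [P.hm1] : a - δ < m)
  have hJa := JF_pos ha (by linarith [P.hm1] : a < m)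
  rw [Rfun, Rfun, if_neg (not_lt.2 hx), if_neg (not_lt.2 hx)]
  have comb : ∀ A B A' B' c d c' d' : ℝ,
      (-(1/ρ) * A * B + (1/ρ) * c + (1/ρ) * d) - (-(1/ρ) * A' * B' + (1/ρ) * c' + (1/ρ) * d') =
      (1/ρ) * (-(A * B - A' * B') + (c - c') + (d - d')) := by intros; ring
  rw [comb, abs_mul, abs_of_pos (by positivity : 0 < 1/ρ)]
  refine (mul_le_mul_of_nonneg_left ((abs_add_three _ _ _).trans
    (add_le_add (add_le_add ((abs_neg _).le.trans t1) t2) t3)) (by positivity)).trans ?_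
  set E := Real.exp (-(1/2)*(x-L*ρ)) with hE
  have hE0 : 0 < E := Real.exp_pos _
  have x1 := Real.exp_pos (-a*L)
  have x2 : 0 < ρ * Real.exp (a*L) := by positivity
  set X := Real.exp (-a*L)
  set Y := ρ * Real.exp (a*L)
  have c1 : 0 < 8/a := by positivity
  have c2 : 0 < 4 * K0 * JF m (a-δ) / δ := by positivity
  have c3 : 0 < 24 * (1+K0) * JF m a := by positivity
  set C1 := 8/a
  set C2 := 4 * K0 * JF m (a-δ) / δ
  set C3 := 24 * (1+K0) * JF m a
  have e : 1/ρ * (N * (C1 * ρ * X * E) + N * (C2 * ρ * Y * E) + N * (C3 * ρ * Y * E)) =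
      N * ((C1 * X + C2 * Y + C3 * Y) * E) := by field_simp
  rw [e]
  gcongr
  nlinarith [mul_pos c1 x2, mul_pos c2 x1, mul_pos c3 x1]
lemma psi_sub {K : ℝ → ℝ → ℝ} {a L ρ : ℝ} (hρ : 0 < ρ) (ha : 0 < a) {h : ℝ → ℝ}
    (hm : Measurable (Qfun K a ρ h))
    (hq : ∀ y : ℝ, y < L*ρ → Qfun K a ρ h y ∈ Icc (1/2:ℝ) (3/2)) {x y : ℝ}
    (hxy : x < y) (hy : y < L*ρ) :
    IntegrableOn (fun z => Real.exp (-(a/ρ)*z) * Qfun K a ρ h z) (Ioc x y) ∧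
    psiFn K a L ρ h x - psiFn K a L ρ h y =
      (1/ρ) * ∫ z in Ioc x y, Real.exp (-(a/ρ)*z) * Qfun K a ρ h z := by
  have hI : IntegrableOn (fun z => Real.exp (-(a/ρ)*z) * Qfun K a ρ h z) (Ioo x (L*ρ)) := by
    have h1 : IntegrableOn (fun z => (3/2) * Real.exp (-(a/ρ)*z)) (Ioo x (L*ρ)) :=
      ((IB_Ioi (div_pos ha hρ) x).1.mono_set Ioo_subset_Ioi_self).const_mul _
    refine Integrable.mono' h1 (by
      apply Measurable.aestronglyMeasurable
      exact (by fun_prop : Measurable fun z => Real.exp (-(a/ρ)*z)).mul hm) ?_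
    filter_upwards [ae_restrict_mem measurableSet_Ioo] with z hz
    have := hq z hz.2
    rw [Real.norm_eq_abs, abs_mul, abs_of_pos (Real.exp_pos _), abs_of_nonneg (by linarith [this.1]),
      mul_comm]
    exact mul_le_mul_of_nonneg_right this.2 (Real.exp_pos _).le
  have hs : Ioo x (L*ρ) = Ioc x y ∪ Ioo y (L*ρ) := (Ioc_union_Ioo_eq_Ioo hxy.le hy).symm
  have i1 := hI.mono_set (hs ▸ subset_union_left : Ioc x y ⊆ Ioo x (L*ρ))
  have i2 := hI.mono_set (hs ▸ subset_union_right : Ioo y (L*ρ) ⊆ Ioo x (L*ρ))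
  refine ⟨i1, ?_⟩
  unfold psiFn
  rw [hs, setIntegral_union (by
    rw [Set.disjoint_left]; intro z hz hz'; exact absurd hz.2 (not_le.2 hz'.1))
    measurableSet_Ioo i1 i2]
  ring

lemma psi_low {K : ℝ → ℝ → ℝ} {a K0 δ m L ρ : ℝ} (P : PC a K0 δ m L ρ K) {h : ℝ → ℝ}
    (hm : Measurable (Qfun K a ρ h))
    (hq : ∀ y : ℝ, y < L*ρ → Qfun K a ρ h y ∈ Icc (1/2:ℝ) (3/2)) {x y : ℝ}
    (hxy : x < y) (hy : y < L*ρ) :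
    2*m*(sF L ρ y - sF L ρ x) ≤ psiFn K a L ρ h x - psiFn K a L ρ h y := by
  have hρ := P.hρ
  have hL := P.hL
  have hm0 := P.m0
  obtain ⟨i, e⟩ := psi_sub hρ P.ha hm hq hxy hy
  rw [e]
  have nn : ∀ z ∈ Ioc x y, 0 ≤ Real.exp (-(a/ρ)*z) * Qfun K a ρ h z := fun z hz =>
    mul_nonneg (Real.exp_pos _).le (by linarith [(hq z (hz.2.trans_lt hy)).1])
  rcases le_total (-(L*ρ)) x with hx | hx
  · have s0 : ∀ w, -(L*ρ) ≤ w → sF L ρ w = 0 := fun w hw => by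
      unfold sF
      apply min_eq_right
      have : -L ≤ w/ρ := by rw [le_div_iff₀ hρ]; linarith
      linarith
    rw [s0 x hx, s0 y (by linarith)]
    have := setIntegral_nonneg (μ := volume) measurableSet_Ioc nn
    have : 0 < 1/ρ := by positivity
    simp only [sub_self, mul_zero]
    positivity
  · set w := min y (-(L*ρ)) with hw
    have hxw : x ≤ w := le_min hxy.le hx
    have hwy : w ≤ y := min_le_left _ _
    have hsub : Ioc x w ⊆ Ioc x y := Ioc_subset_Ioc_right hwy
    have h1 : ∫ z in Ioc x w, Real.exp (-(a/ρ)*z) * Qfun K a ρ h z ≤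
        ∫ z in Ioc x y, Real.exp (-(a/ρ)*z) * Qfun K a ρ h z := by
      refine setIntegral_mono_set i ?_ (LE.le.eventuallyLE hsub)
      filter_upwards [ae_restrict_mem measurableSet_Ioc] with z hz using nn z hz
    have h2 : ∫ z in Ioc x w, (2*m) ≤ ∫ z in Ioc x w, Real.exp (-(a/ρ)*z) * Qfun K a ρ h z := by
      refine setIntegral_mono_on (integrableOn_const (by simp)) (i.mono_set hsub) measurableSet_Ioc ?_
      intro z hz
      have hz1 : z ≤ -(L*ρ) := hz.2.trans (min_le_right _ _)
      have q := (hq z ((hsub hz).2.trans_lt hy)).1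
      have : 4*m ≤ Real.exp (-(a/ρ)*z) := by
        refine P.hLm.trans (Real.exp_le_exp.2 ?_)
        have : L ≤ -z/ρ := by rw [le_div_iff₀ hρ]; linarith
        have e : -(a/ρ)*z = a * (-z/ρ) := by ring
        rw [e]
        exact mul_le_mul_of_nonneg_left this P.ha.le
      nlinarith
    have h3 : ∫ z in Ioc x w, (2*m) = (w-x)*(2*m) := by
      rw [setIntegral_const, Measure.real, Real.volume_Ioc, ENNReal.toReal_ofReal (by linarith),
        smul_eq_mul]
    have sx : sF L ρ x = x/ρ + L := by
      unfold sF
      apply min_eq_left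
      have : x/ρ ≤ -L := by rw [div_le_iff₀ hρ]; linarith
      linarith
    have sy : sF L ρ y = w/ρ + L := by
      unfold sF
      rcases le_total y (-(L*ρ)) with hh | hh
      · rw [hw, min_eq_left hh]
        apply min_eq_left
        have : y/ρ ≤ -L := by rw [div_le_iff₀ hρ]; linarith
        linarith
      · rw [hw, min_eq_right hh, min_eq_right]
        · field_simp; ring
        · have : -L ≤ y/ρ := by rw [le_div_iff₀ hρ]; linarith
          linarith
    rw [sx, sy]
    have : 2*m*(w/ρ+L - (x/ρ+L)) = 1/ρ * ((w-x)*(2*m)) := by field_simp; ring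
    rw [this, ← h3]
    gcongr
    exact h2.trans h1

lemma exp_sx {a L ρ x : ℝ} (ha : 0 < a) :
    Real.exp (-(a/ρ)*x) ≤ Real.exp (a*L) * Real.exp (-a * sF L ρ x) := by
  rw [← Real.exp_add, Real.exp_le_exp]
  have := mul_le_mul_of_nonneg_left (sF_le L ρ x) ha.le
  have e : -(a/ρ)*x = - (a * (x/ρ)) := by ring
  rw [e]
  linarith

/-- constant -/
noncomputable def CQ (m a K0 : ℝ) : ℝ := (1+K0)*(JF m 1 + 2 + JF m (a+1))
/-- constant -/
noncomputable def CR (m a K0 : ℝ) : ℝ := 4*(1+K0)*(JF m a * JF m 1 + JF m (a+1))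
/-- constant -/
noncomputable def CH (m a K0 δ : ℝ) : ℝ := 8/a + 4*K0*JF m (a-δ)/δ + 24*(1+K0)*JF m a

lemma psi_diff {K : ℝ → ℝ → ℝ} {a K0 δ m L ρ N : ℝ} (P : PC a K0 δ m L ρ K) {h1 h2 : ℝ → ℝ}
    (H : HP m L ρ N h1 h2) (hCQ : 0 ≤ CQ m a K0)
    (hq1 : ∀ y : ℝ, y < L*ρ → Qfun K a ρ h1 y ∈ Icc (1/2:ℝ) (3/2))
    (hq2 : ∀ y : ℝ, y < L*ρ → Qfun K a ρ h2 y ∈ Icc (1/2:ℝ) (3/2)) {x y : ℝ}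
    (hxy : x < y) (hy : y < L*ρ) :
    |(psiFn K a L ρ h1 x - psiFn K a L ρ h1 y) - (psiFn K a L ρ h2 x - psiFn K a L ρ h2 y)| ≤
      N * CQ m a K0 * Real.exp ((2*a+2)*L) * (1/a) * (Real.exp (a*L) * Real.exp (-a * sF L ρ x)) := by
  have hρ := P.hρ
  have ha := P.ha
  have hN := H.hN
  have mQ1 := Q_meas P H.m1
  have mQ2 := Q_meas P H.m2
  rw [(psi_sub hρ P.ha mQ1 hq1 hxy hy).2, (psi_sub hρ P.ha mQ2 hq2 hxy hy).2, ← mul_sub, abs_mul,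
    abs_of_pos (by positivity : 0 < 1/ρ)]
  have me : Measurable fun z => Real.exp (-(a/ρ)*z) := by fun_prop
  have hD : IB (fun z => Real.exp (-(a/ρ)*z)) (Ioc x y) (Real.exp (-(a/ρ)*x)/(a/ρ)) :=
    (IB_Ioi (div_pos ha hρ) x).subset measurableSet_Ioi Ioc_subset_Ioi_self
      (fun z _ => (Real.exp_pos _).le)
  have bb : ∀ h : ℝ → ℝ, (∀ y : ℝ, y < L*ρ → Qfun K a ρ h y ∈ Icc (1/2:ℝ) (3/2)) →
      ∀ z ∈ Ioc x y, |Real.exp (-(a/ρ)*z) * Qfun K a ρ h z| ≤ (3/2) * Real.exp (-(a/ρ)*z) := by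
    intro h hq z hz
    have := hq z (hz.2.trans_lt hy)
    rw [abs_mul, abs_of_pos (Real.exp_pos _), abs_of_nonneg (by linarith [this.1]), mul_comm]
    exact mul_le_mul_of_nonneg_right this.2 (Real.exp_pos _).le
  have := d1 measurableSet_Ioc (me.mul mQ1) (me.mul mQ2) hD (bb h1 hq1) (bb h2 hq2)
    (N := N * (CQ m a K0 * Real.exp ((2*a+2)*L))) (fun z hz => by
      simp only [Pi.mul_apply]
      rw [← mul_sub, abs_mul, abs_of_pos (Real.exp_pos _), mul_comm]
      exact mul_le_mul_of_nonneg_right (Q_diff P H (hz.2.trans hy.le)) (Real.exp_pos _).le)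
    (by positivity)
  simp only [Pi.mul_apply] at this
  refine (mul_le_mul_of_nonneg_left this (by positivity)).trans ?_
  have e : 1/ρ * (N * (CQ m a K0 * Real.exp ((2*a+2)*L)) * (Real.exp (-(a/ρ)*x)/(a/ρ))) =
    N * CQ m a K0 * Real.exp ((2*a+2)*L) * (1/a) * Real.exp (-(a/ρ)*x) := by field_simp
  rw [e]
  exact mul_le_mul_of_nonneg_left (exp_sx ha) (by positivity)

lemma exp_diff {A B M : ℝ} (hA : M ≤ A) (hB : M ≤ B) :
    |Real.exp (-A) - Real.exp (-B)| ≤ Real.exp (-M) * |A - B| := by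
  wlog h : A ≤ B generalizing A B
  · rw [abs_sub_comm, abs_sub_comm A B]; exact this hB hA (le_of_not_ge h)
  have h1 : Real.exp (-B) ≤ Real.exp (-A) := Real.exp_le_exp.2 (by linarith)
  rw [abs_of_nonneg (by linarith), abs_of_nonpos (by linarith)]
  have h2 : Real.exp (-B) = Real.exp (-A) * Real.exp (A-B) := by rw [← Real.exp_add]; ring_nf
  have h3 := Real.add_one_le_exp (A-B)
  have h4 : Real.exp (-A) ≤ Real.exp (-M) := Real.exp_le_exp.2 (by linarith)
  have h5 : Real.exp (-A) * (B-A) ≤ Real.exp (-M) * (B-A) :=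
    mul_le_mul_of_nonneg_right h4 (by linarith)
  have h6 : Real.exp (-A) * (A-B+1) ≤ Real.exp (-A) * Real.exp (A-B) :=
    mul_le_mul_of_nonneg_left h3 (Real.exp_pos _).le
  rw [h2]
  linarith

lemma prod3 {E1 E2 Q1 Q2 R1 R2 ε α β r η : ℝ} (hE : |E1 - E2| ≤ ε*α) (hE0 : 0 ≤ E2) (hE2 : E2 ≤ ε)
    (hQ1 : |Q1| ≤ 3/2) (hQ2 : |Q2| ≤ 3/2) (hQ : |Q1-Q2| ≤ β) (hR1 : |R1| ≤ r) (hR : |R1-R2| ≤ η) :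
    |E1*Q1*R1 - E2*Q2*R2| ≤ ε*α*(3/2)*r + ε*β*r + ε*(3/2)*η := by
  have e : E1*Q1*R1 - E2*Q2*R2 = (E1-E2)*Q1*R1 + E2*(Q1-Q2)*R1 + E2*Q2*(R1-R2) := by ring
  rw [e]
  have hα : 0 ≤ ε*α := (abs_nonneg _).trans hE
  have hβ := (abs_nonneg _).trans hQ
  have hε : 0 ≤ ε := hE0.trans hE2
  refine (abs_add_three _ _ _).trans ?_
  simp only [abs_mul, abs_of_nonneg hE0]
  gcongr

lemma R_zero {K : ℝ → ℝ → ℝ} {a L ρ : ℝ} (x : ℝ) : Rfun K a L ρ (fun _ => 0) x = 0 := by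
  simp [Rfun]

lemma CQ_pos {K : ℝ → ℝ → ℝ} {a K0 δ m L ρ : ℝ} (P : PC a K0 δ m L ρ K) : 0 < CQ m a K0 := by
  have := JF_pos one_pos P.m1
  have := JF_pos (by linarith [P.ha] : 0 < a+1) P.hm1
  have := P.hK0
  unfold CQ
  positivity

lemma CR_pos {K : ℝ → ℝ → ℝ} {a K0 δ m L ρ : ℝ} (P : PC a K0 δ m L ρ K) : 0 < CR m a K0 := by
  have := JF_pos one_pos P.m1
  have := JF_pos P.ha (by linarith [P.hm1] : a < m)
  have := JF_pos (by linarith [P.ha] : 0 < a+1) P.hm1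
  have := P.hK0
  unfold CR
  positivity

lemma CH_pos {K : ℝ → ℝ → ℝ} {a K0 δ m L ρ : ℝ} (P : PC a K0 δ m L ρ K) : 0 < CH m a K0 δ := by
  have := JF_pos P.ha (by linarith [P.hm1] : a < m)
  have := JF_pos (by linarith [P.hδa] : 0 < a-δ) (by linarith [P.hm1, P.hδ] : a-δ < m)
  have := P.hK0
  have := P.ha
  have := P.hδ
  unfold CH
  positivity

lemma psi_meas {K : ℝ → ℝ → ℝ} {a K0 δ m L ρ : ℝ} (P : PC a K0 δ m L ρ K) {h : ℝ → ℝ}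
    (hh : Measurable h) : Measurable (psiFn K a L ρ h) := by
  unfold psiFn
  refine Measurable.const_mul ?_ _
  refine meas2 (fun x => Ioo x (L*ρ)) (f := fun _ y => Real.exp (-(a/ρ)*y) * Qfun K a ρ h y) ?_ ?_
  · exact ((by fun_prop : Measurable fun z => Real.exp (-(a/ρ)*z)).mul (Q_meas P hh)).comp
      measurable_snd
  · exact (measurableSet_lt measurable_fst measurable_snd).inter
      (measurableSet_lt measurable_snd measurable_const)

lemma Rt_low {K : ℝ → ℝ → ℝ} {a K0 δ m L ρ N : ℝ} (P : PC a K0 δ m L ρ K) {h1 h2 : ℝ → ℝ}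
    (H : HP m L ρ N h1 h2)
    (hq1 : ∀ y : ℝ, y < L*ρ → Qfun K a ρ h1 y ∈ Icc (1/2:ℝ) (3/2))
    (hq2 : ∀ y : ℝ, y < L*ρ → Qfun K a ρ h2 y ∈ Icc (1/2:ℝ) (3/2)) {x : ℝ} (hx : x < L*ρ) :
    |Rtil K a L ρ h1 x - Rtil K a L ρ h2 x| ≤
      N * (CR m a K0 * (1 + (3*CQ m a K0/a + 2*CQ m a K0 + 3/2)/a) * ρ * Real.exp ((5*a+4)*L) *
        Real.exp (m * sF L ρ x)) := by
  have hρ := P.hρ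
  have ha := P.ha
  have hL := P.hL
  have hN := H.hN
  have hm3 := P.hm3
  have hm0 := P.m0
  have mQ1 := Q_meas P H.m1
  have mQ2 := Q_meas P H.m2
  have cq := CQ_pos P
  have cr := CR_pos P
  obtain ⟨q, hq⟩ : ∃ q, q = CQ m a K0 := ⟨_, rfl⟩
  obtain ⟨r, hr⟩ : ∃ r, r = CR m a K0 := ⟨_, rfl⟩
  obtain ⟨s, hs⟩ : ∃ s, s = sF L ρ x := ⟨_, rfl⟩
  have s0 : s ≤ 0 := hs ▸ sF_np L ρ x
  obtain ⟨e1, he1⟩ : ∃ e, e = Real.exp ((a+2)*L) := ⟨_, rfl⟩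
  obtain ⟨e2, he2⟩ : ∃ e, e = Real.exp ((2*a+2)*L) := ⟨_, rfl⟩
  obtain ⟨X, hX⟩ : ∃ X, X = Real.exp (a*L) * Real.exp (-a*s) := ⟨_, rfl⟩
  have e1p : 1 ≤ e1 := by rw [he1]; exact Real.one_le_exp (by positivity)
  have e2p : 1 ≤ e2 := by rw [he2]; exact Real.one_le_exp (by positivity)
  have Xp : 1 ≤ X := by
    rw [hX, ← Real.exp_add]
    apply Real.one_le_exp
    have := mul_nonneg ha.le (neg_nonneg.2 s0)
    nlinarith [mul_pos ha hL]
  have RL : ∀ {N' : ℝ} {g1 g2 : ℝ → ℝ}, HP m L ρ N' g1 g2 → ∀ y < L*ρ,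
      |Rfun K a L ρ g1 y - Rfun K a L ρ g2 y| ≤
        N' * (r * ρ * e1) * Real.exp ((2*m-a)*sF L ρ y) := by
    intro N' g1 g2 H' y hy
    have := R_low P H' hy
    rw [hr, he1, CR]
    refine this.trans (le_of_eq ?_)
    ring
  have RZ : ∀ {N' : ℝ} {g1 g2 : ℝ → ℝ}, HP m L ρ N' g1 g2 → ∀ y < L*ρ,
      |Rfun K a L ρ g1 y| ≤ 2 * (r * ρ * e1) * Real.exp ((2*m-a)*sF L ρ y) := by
    intro N' g1 g2 H' y hy
    have := RL H'.zero y hy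
    rwa [R_zero, sub_zero] at this
  have aQ : ∀ h : ℝ → ℝ, (∀ y : ℝ, y < L*ρ → Qfun K a ρ h y ∈ Icc (1/2:ℝ) (3/2)) →
      ∀ y < L*ρ, |Qfun K a ρ h y| ≤ 3/2 := by
    intro h hh y hy
    have := hh y hy
    rw [abs_of_nonneg (by linarith [this.1])]; exact this.2
  have eg : ∀ y, x < y → Real.exp (-(2*m*(sF L ρ y - s))) * Real.exp ((2*m-a)*sF L ρ y) ≤
      Real.exp ((2*m-a)*s) := by
    intro y hy
    rw [← Real.exp_add, Real.exp_le_exp]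
    have : s ≤ sF L ρ y := hs ▸ sF_mono hρ hy.le
    nlinarith
  have eE : ∀ h : ℝ → ℝ, Measurable (Qfun K a ρ h) →
      (∀ y : ℝ, y < L*ρ → Qfun K a ρ h y ∈ Icc (1/2:ℝ) (3/2)) →
      ∀ y ∈ Ioo x (L*ρ), Real.exp (-(psiFn K a L ρ h x - psiFn K a L ρ h y)) ≤
        Real.exp (-(2*m*(sF L ρ y - s))) := by
    intro h mh hh y hy
    rw [Real.exp_le_exp, hs]
    have := psi_low P mh hh hy.1 hy.2
    linarith
  have hD : IB (fun z => Real.exp (-(a/ρ)*z)) (Ioo x (L*ρ)) (ρ/a*X) := by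
    refine IB.weaken ((IB_Ioi (div_pos ha hρ) x).subset measurableSet_Ioi Ioo_subset_Ioi_self
      (fun z _ => (Real.exp_pos _).le)) ?_
    have e : Real.exp (-(a/ρ)*x)/(a/ρ) = ρ/a * Real.exp (-(a/ρ)*x) := by field_simp
    rw [e, hX, hs]
    exact mul_le_mul_of_nonneg_left (exp_sx ha) (by positivity)
  have mF : ∀ h : ℝ → ℝ, Measurable h → Measurable (fun y =>
      Real.exp (-(psiFn K a L ρ h x - psiFn K a L ρ h y)) * Real.exp (-(a/ρ)*y) *
        Qfun K a ρ h y * Rfun K a L ρ h y) := by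
    intro h hh
    have := psi_meas (L := L) P hh
    have := Q_meas P hh
    have := R_meas P hh
    fun_prop
  have bF : ∀ {N' : ℝ} {h g : ℝ → ℝ}, HP m L ρ N' h g →
      (∀ y : ℝ, y < L*ρ → Qfun K a ρ h y ∈ Icc (1/2:ℝ) (3/2)) → ∀ y ∈ Ioo x (L*ρ),
      |Real.exp (-(psiFn K a L ρ h x - psiFn K a L ρ h y)) * Real.exp (-(a/ρ)*y) *
        Qfun K a ρ h y * Rfun K a L ρ h y| ≤
      (3/2 * (2 * (r*ρ*e1)) * Real.exp ((2*m-a)*s)) * Real.exp (-(a/ρ)*y) := by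
    intro N' h g H' hh y hy
    have A := eE h (Q_meas P H'.m1) hh y hy
    have B := aQ h hh y hy.2
    have C := RZ H' y hy.2
    have D := eg y hy.1
    simp only [abs_mul, Real.abs_exp]
    calc _ ≤ Real.exp (-(2*m*(sF L ρ y - s))) * Real.exp (-(a/ρ)*y) * (3/2) *
          (2 * (r * ρ * e1) * Real.exp ((2*m-a)*sF L ρ y)) := by gcongr
      _ = (3/2 * (2 * (r*ρ*e1)) * (Real.exp (-(2*m*(sF L ρ y - s))) *
          Real.exp ((2*m-a)*sF L ρ y))) * Real.exp (-(a/ρ)*y) := by ring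
      _ ≤ _ := by rw [← hr] at cr; gcongr
  rw [← hq] at cq
  rw [← hr] at cr
  have key := d1 measurableSet_Ioo (mF h1 H.m1) (mF h2 H.m2) hD (bF H hq1) (bF H.symm hq2)
    (N := N * (r*ρ*e1*((3*q/a+2*q+3/2)*e2*X) * Real.exp ((2*m-a)*s))) (by
      intro y hy
      have A1 := psi_low P mQ1 hq1 hy.1 hy.2
      have A2 := psi_low P mQ2 hq2 hy.1 hy.2
      have dE := exp_diff A1 A2
      have dP := psi_diff P H (hq ▸ cq.le) hq1 hq2 hy.1 hy.2
      rw [← hs] at dE dP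
      rw [← hq, ← he2, ← hX] at dP
      have dE' := dE.trans (mul_le_mul_of_nonneg_left dP (Real.exp_pos _).le)
      have dQ := Q_diff P H hy.2.le
      rw [← CQ, ← hq, ← he2] at dQ
      have T := prod3 dE' (Real.exp_pos _).le (eE h2 mQ2 hq2 y hy) (aQ h1 hq1 y hy.2)
        (aQ h2 hq2 y hy.2) dQ (RZ H y hy.2) (RL H y hy.2)
      have e : ∀ h : ℝ → ℝ, Real.exp (-(psiFn K a L ρ h x - psiFn K a L ρ h y)) *
          Real.exp (-(a/ρ)*y) * Qfun K a ρ h y * Rfun K a L ρ h y =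
          (Real.exp (-(psiFn K a L ρ h x - psiFn K a L ρ h y)) * Qfun K a ρ h y * Rfun K a L ρ h y)
          * Real.exp (-(a/ρ)*y) := fun h => by ring
      rw [e h1, e h2, ← sub_mul, abs_mul, Real.abs_exp]
      refine mul_le_mul_of_nonneg_right (T.trans ?_) (Real.exp_pos _).le
      have D := eg y hy.1
      set ε := Real.exp (-(2*m*(sF L ρ y - s)))
      set g := Real.exp ((2*m-a)*sF L ρ y)
      have p : 3*q/a*e2*X + 2*q*e2 + 3/2 ≤ (3*q/a+2*q+3/2)*e2*X := by
        have t1 : 1 ≤ e2 * X := one_le_mul_of_one_le_of_one_le e2p Xp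
        have t2 : e2 ≤ e2 * X := le_mul_of_one_le_right (by linarith) Xp
        have := mul_le_mul_of_nonneg_left t2 (by positivity : 0 ≤ 2*q)
        nlinarith
      calc _ = N * (r*ρ*e1*(3*q/a*e2*X + 2*q*e2 + 3/2) * (ε*g)) := by ring
        _ ≤ _ := by gcongr) (by positivity)
  have k0 := RL H x hx
  rw [← hs] at k0
  unfold Rtil
  rw [if_pos hx, if_pos hx]
  rw [show ∀ A B C D c : ℝ, (A - c*B) - (C - c*D) = (A - C) - c*(B-D) from fun _ _ _ _ _ => by ring]
  refine (abs_sub _ _).trans ?_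
  rw [abs_mul, abs_of_pos (by positivity : 0 < 1/ρ)]
  refine (add_le_add k0 (mul_le_mul_of_nonneg_left key (by positivity))).trans ?_
  rw [← hq, ← hr, ← hs]
  have E1 : e1 * Real.exp ((2*m-a)*s) ≤ Real.exp ((5*a+4)*L) * Real.exp (m*s) := by
    rw [he1, ← Real.exp_add, ← Real.exp_add, Real.exp_le_exp]
    have f1 : 0 ≤ (m-a)*(-s) := mul_nonneg (by linarith) (by linarith)
    nlinarith [mul_pos ha hL]
  have E2 : e1 * e2 * X * X * Real.exp ((2*m-a)*s) ≤ Real.exp ((5*a+4)*L) * Real.exp (m*s) := by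
    rw [he1, he2, hX]
    simp only [← Real.exp_add]
    rw [Real.exp_le_exp]
    nlinarith
  have e : N * (r * ρ * e1) * Real.exp ((2*m-a)*s) + 1/ρ * (N * (r*ρ*e1*((3*q/a+2*q+3/2)*e2*X) *
      Real.exp ((2*m-a)*s)) * (ρ/a*X)) = N * (r * ρ) * ((e1 * Real.exp ((2*m-a)*s)) +
      (3*q/a+2*q+3/2)/a * (e1 * e2 * X * X * Real.exp ((2*m-a)*s))) := by field_simp
  rw [e]
  calc _ ≤ N * (r * ρ) * ((Real.exp ((5*a+4)*L) * Real.exp (m*s)) +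
      (3*q/a+2*q+3/2)/a * (Real.exp ((5*a+4)*L) * Real.exp (m*s))) := by gcongr
    _ = _ := by ring

lemma Rt_high {K : ℝ → ℝ → ℝ} {a K0 δ m L ρ ρ0 N : ℝ} (P : PC a K0 δ m L ρ K) {h1 h2 : ℝ → ℝ}
    (H : HP m L ρ N h1 h2) (h0 : ρ < ρ0) (h01 : ρ0 < 1) {x : ℝ} (hx : L*ρ ≤ x) :
    |Rtil K a L ρ h1 x - Rtil K a L ρ h2 x| ≤
      N * (CH m a K0 δ * (1 + 2/(1-ρ0)) * (Real.exp (-a*L) + ρ*Real.exp (a*L)) *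
        Real.exp (-(1/2)*(x-L*ρ))) := by
  have hρ := P.hρ
  have hρ1 := P.hρ1
  have hN := H.hN
  have ch := CH_pos P
  obtain ⟨c, hc⟩ : ∃ c, c = CH m a K0 δ * (Real.exp (-a*L) + ρ*Real.exp (a*L)) := ⟨_, rfl⟩
  have c0 : 0 < c := by rw [hc]; positivity
  have RL : ∀ {N' : ℝ} {g1 g2 : ℝ → ℝ}, HP m L ρ N' g1 g2 → ∀ y, L*ρ ≤ y →
      |Rfun K a L ρ g1 y - Rfun K a L ρ g2 y| ≤
        N' * c * Real.exp (-(1/2)*(y-L*ρ)) := by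
    intro N' g1 g2 H' y hy
    have := R_high P H' hy
    rw [hc, CH]
    refine this.trans (le_of_eq ?_)
    ring
  have RZ : ∀ {N' : ℝ} {g1 g2 : ℝ → ℝ}, HP m L ρ N' g1 g2 → ∀ y, L*ρ ≤ y →
      |Rfun K a L ρ g1 y| ≤ 2 * c * Real.exp (-(1/2)*(y-L*ρ)) := by
    intro N' g1 g2 H' y hy
    have := RL H'.zero y hy
    rwa [R_zero, sub_zero] at this
  obtain ⟨k, hk⟩ : ∃ k, k = 1/(1+ρ) - 1/2 := ⟨_, rfl⟩
  have hk' : k = (1-ρ)/(2*(1+ρ)) := by rw [hk]; field_simp; ring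
  have k0 : 0 < k := by rw [hk']; apply div_pos <;> linarith
  have hD : IB (fun y => Real.exp ((y-x)/(1+ρ)) * Real.exp (-(1/2)*(y-L*ρ))) (Ioo (L*ρ) x)
      (Real.exp (-(1/2)*(x-L*ρ))/k) := by
    have := ((IB_Iic k0 x).mul (Real.exp (-x/(1+ρ) + L*ρ/2)) (Real.exp_pos _).le).subset
      measurableSet_Iic (Ioo_subset_Iio_self.trans Iio_subset_Iic_self : Ioo (L*ρ) x ⊆ Iic x)
      (fun y _ => by positivity)
    convert this using 1
    · ext y
      rw [← Real.exp_add, ← Real.exp_add, hk]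
      congr 1; ring
    · rw [← mul_div_assoc, ← Real.exp_add, hk]
      congr 2; ring
  have me : Measurable fun y => Real.exp ((y-x)/(1+ρ)) := by fun_prop
  have key := d1 measurableSet_Ioo (me.mul (R_meas P H.m1)) (me.mul (R_meas P H.m2)) hD
    (c := 2*c) (N := N*c)
    (fun y hy => by
      simp only [Pi.mul_apply, abs_mul, Real.abs_exp]
      refine (mul_le_mul_of_nonneg_left (RZ H y hy.1.le) (Real.exp_pos _).le).trans (le_of_eq ?_)
      ring)
    (fun y hy => by
      simp only [Pi.mul_apply, abs_mul, Real.abs_exp]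
      refine (mul_le_mul_of_nonneg_left (RZ H.symm y hy.1.le) (Real.exp_pos _).le).trans (le_of_eq ?_)
      ring)
    (fun y hy => by
      simp only [Pi.mul_apply]
      rw [← mul_sub]
      simp only [abs_mul, Real.abs_exp]
      refine (mul_le_mul_of_nonneg_left (RL H y hy.1.le) (Real.exp_pos _).le).trans (le_of_eq ?_)
      ring) (by positivity)
  simp only [Pi.mul_apply] at key
  unfold Rtil
  rw [if_neg (not_lt.2 hx), if_neg (not_lt.2 hx)]
  rw [show ∀ A B C D c : ℝ, (A - c*B) - (C - c*D) = (A - C) - c*(B-D) from fun _ _ _ _ _ => by ring]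
  refine (abs_sub _ _).trans ?_
  rw [abs_mul, abs_of_pos (by positivity : 0 < 1/(1+ρ))]
  refine (add_le_add (RL H x hx) (mul_le_mul_of_nonneg_left key (by positivity))).trans ?_
  have : N * (CH m a K0 δ * (1 + 2/(1-ρ0)) * (Real.exp (-a*L) + ρ*Real.exp (a*L)) *
        Real.exp (-(1/2)*(x-L*ρ))) = N * c * Real.exp (-(1/2)*(x-L*ρ)) * (1 + 2/(1-ρ0)) := by
    rw [hc]; ring
  rw [this]
  have e : 1/(1+ρ) * (N * c * (Real.exp (-(1/2)*(x-L*ρ))/k)) =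
      N * c * Real.exp (-(1/2)*(x-L*ρ)) * (2/(1-ρ)) := by
    have : 1 - ρ ≠ 0 := by linarith
    rw [hk']; field_simp
  rw [e, ← mul_one_add]
  have : 2/(1-ρ) ≤ 2/(1-ρ0) := by
    apply div_le_div_of_nonneg_left <;> linarith
  gcongr

lemma mkPC {γ a K0 δ m L0 ρ0 L ρ : ℝ} {K : ℝ → ℝ → ℝ} (hP : ParamHyp a m L0 ρ0)
    (hK : KernelHyp K γ a K0 δ) (hL : L0 ≤ L) (hρ : ρ ∈ Ioo (0:ℝ) ρ0) : PC a K0 δ m L ρ K := by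
  obtain ⟨hγ, ha, hc, hnn, hsym, hhom, hK0, hδ, hKd⟩ := hK
  obtain ⟨hm, hL0, hρ0⟩ := hP
  have ha0 : 0 < a := by linarith
  have hm1 := (le_max_left _ _).trans_lt hm
  have hm3 := (le_max_right _ _).trans_lt hm
  have hlog : 0 < Real.log (4*m) := Real.log_pos (by linarith)
  have hLp : 0 < L := by
    have : 0 < 1/a * Real.log (4*m) := by positivity
    linarith
  have hb : ∀ t : ℝ, t ≤ 0 → |Real.exp (a*t) * K (Real.exp t) 1 - 1| ≤ K0 * Real.exp (δ*t) := by
    intro t ht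
    have h1 : Real.exp t ≤ 1 := Real.exp_le_one_iff.2 ht
    have := hKd (Real.exp t) ⟨Real.exp_pos _, by linarith⟩
    rwa [← Real.exp_mul, ← Real.exp_mul, mul_comm t, mul_comm t] at this
  refine ⟨ha0, hm1, hm3, hLp, ?_, hρ.1, hρ.2.trans hρ0.2, hδ.1, hδ.2.trans_le (min_le_right _ _), hK0,
    ?_, fun t => hnn _ _ (Real.exp_pos _) one_pos, hb, ?_⟩
  · rw [← Real.log_le_iff_le_exp (by linarith)]
    have : 1/a * Real.log (4*m) ≤ L := by linarith
    have := mul_le_mul_of_nonneg_left this ha0.le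
    rwa [← mul_assoc, mul_one_div_cancel ha0.ne', one_mul] at this
  · exact hc.comp_continuous (f := fun t : ℝ => (Real.exp t, (1:ℝ))) (by fun_prop)
      (fun t => by simp [Real.exp_pos])
  · intro t ht
    have h1 := hhom 1 (Real.exp (-t)) (Real.exp t) one_pos (Real.exp_pos _) (Real.exp_pos _)
    rw [mul_one, ← Real.exp_add, add_neg_cancel, Real.exp_zero,
      hsym 1 _ one_pos (Real.exp_pos _), ← Real.exp_mul] at h1
    have h2 := (abs_le.1 (hb (-t) (by linarith))).2
    have h3 : Real.exp (δ * -t) ≤ 1 := Real.exp_le_one_iff.2 (by nlinarith [hδ.1])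
    have h4 : Real.exp (a * -t) * K (Real.exp (-t)) 1 ≤ 1 + K0 := by nlinarith
    rw [h1]
    have e : Real.exp (t*γ) = Real.exp t * Real.exp (a * -t) := by
      rw [← Real.exp_add, ha]; ring_nf
    rw [e, mul_assoc, mul_comm]
    exact mul_le_mul_of_nonneg_right h4 (Real.exp_pos _).le

lemma mkHP {a m L ρ : ℝ} {h1 h2 : ℝ → ℝ} (H1 : memX a m L ρ h1) (H2 : memX a m L ρ h2) :
    HP m L ρ (normX m L ρ (fun t => h1 t - h2 t)) h1 h2 := by
  have bd : BddAbove (range fun x => |h1 x - h2 x| * Real.exp (-(omegaFn m L ρ x))) := by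
    refine ⟨4, ?_⟩
    rintro _ ⟨x, rfl⟩
    have := abs_sub (h1 x) (h2 x)
    have b1 := H1.2.2.2 x
    have b2 := H2.2.2.2 x
    simp only
    rw [Real.exp_neg, ← div_eq_mul_inv, div_le_iff₀ (Real.exp_pos _)]
    linarith
  refine ⟨measurable_of_continuousOn_compl_singleton (L*ρ) H1.1,
    measurable_of_continuousOn_compl_singleton (L*ρ) H2.1, H1.2.2.2, H2.2.2.2, ?_, ?_⟩
  · intro x
    have := le_ciSup bd x
    rw [Real.exp_neg, ← div_eq_mul_inv, div_le_iff₀ (Real.exp_pos _)] at this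
    exact this
  · exact Real.iSup_nonneg fun x => by positivity

/-- Lipschitz bounds on the remainder R̃[h] (estimate (4.13) of the paper). -/
theorem Rtil_lipschitz_bounds
    (γ a K0 δ m L0 ρ0 : ℝ) (hγ : γ < 1) (ha : a = 1 - γ)
    (hK0 : 0 < K0) (hδ : δ ∈ Ioo 0 (min 1 a)) (hP : ParamHyp a m L0 ρ0) :
    ∃ C : ℝ, 0 < C ∧
      ∀ K : ℝ → ℝ → ℝ, KernelHyp K γ a K0 δ →
      ∀ L : ℝ, L0 ≤ L → ∀ ρ ∈ Ioo (0:ℝ) ρ0,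
      ∀ h1 h2 : ℝ → ℝ, memX a m L ρ h1 → memX a m L ρ h2 →
      (∀ y : ℝ, y < L*ρ → Qfun K a ρ h1 y ∈ Icc (1/2:ℝ) (3/2)) →
      (∀ y : ℝ, y < L*ρ → Qfun K a ρ h2 y ∈ Icc (1/2:ℝ) (3/2)) →
        (∀ x : ℝ, x ≤ -(L*ρ) →
          |Rtil K a L ρ h1 x - Rtil K a L ρ h2 x|
            ≤ C * ρ * normX m L ρ (fun t => h1 t - h2 t)
              * Real.exp ((m+4*a+4)*L) * Real.exp ((m/ρ)*(x+L*ρ))) ∧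
        (∀ x : ℝ, -(L*ρ) < x → x < L*ρ →
          |Rtil K a L ρ h1 x - Rtil K a L ρ h2 x|
            ≤ C * ρ * normX m L ρ (fun t => h1 t - h2 t) * Real.exp ((5*a+4)*L)) ∧
        (∀ x : ℝ, L*ρ ≤ x →
          |Rtil K a L ρ h1 x - Rtil K a L ρ h2 x|
            ≤ C * (Real.exp (-a*L) + ρ * Real.exp (a*L))
              * normX m L ρ (fun t => h1 t - h2 t) * Real.exp (-(1/2)*(x-L*ρ))) := by
  obtain ⟨A, hA⟩ : ∃ A, A = CR m a K0 * (1 + (3*CQ m a K0/a + 2*CQ m a K0 + 3/2)/a) := ⟨_, rfl⟩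
  obtain ⟨B, hB⟩ : ∃ B, B = CH m a K0 δ * (1 + 2/(1-ρ0)) := ⟨_, rfl⟩
  refine ⟨|A| + |B| + 1, by positivity, ?_⟩
  intro K hK L hL ρ hρ h1 h2 H1 H2 hq1 hq2
  have P := mkPC hP hK hL hρ
  have H := mkHP H1 H2
  have hN := H.hN
  have hρ0 := P.hρ
  have hA1 : A ≤ |A| + |B| + 1 := by linarith [le_abs_self A, abs_nonneg B]
  have hB1 : B ≤ |A| + |B| + 1 := by linarith [le_abs_self B, abs_nonneg A]
  generalize |A| + |B| + 1 = C at hA1 hB1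
  have low : ∀ x, x < L*ρ → |Rtil K a L ρ h1 x - Rtil K a L ρ h2 x| ≤
      C * ρ * normX m L ρ (fun t => h1 t - h2 t) * Real.exp ((5*a+4)*L) *
        Real.exp (m * sF L ρ x) := by
    intro x hx
    have := Rt_low P H hq1 hq2 hx
    rw [← hA] at this
    refine this.trans ?_
    calc _ = A * ρ * normX m L ρ (fun t => h1 t - h2 t) * Real.exp ((5*a+4)*L) *
        Real.exp (m * sF L ρ x) := by ring
      _ ≤ _ := by gcongr
  have hLρ : 0 < L*ρ := mul_pos P.hL P.hρ
  have ch : 0 < B := by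
    rw [hB]
    have := CH_pos P
    have : 0 < 1 - ρ0 := by linarith [hP.2.2.2]
    positivity
  have C0 : 0 ≤ C := by linarith
  refine ⟨fun x hx => ?_, fun x hx hx' => ?_, fun x hx => ?_⟩
  · refine (low x (by linarith)).trans ?_
    have e : m * sF L ρ x ≤ (m/ρ)*(x+L*ρ) := by
      have := mul_le_mul_of_nonneg_left (sF_le L ρ x) P.m0.le
      have e : m * (x/ρ + L) = m/ρ*(x+L*ρ) := by field_simp
      linarith
    have e' : (5*a+4)*L ≤ (m+4*a+4)*L := by
      have : a < m := by linarith [P.hm1]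
      have := mul_lt_mul_of_pos_right this P.hL
      linarith
    gcongr
  · refine (low x hx').trans ?_
    refine mul_le_of_le_one_right (by positivity) (Real.exp_le_one_iff.2 ?_)
    have := sF_np L ρ x
    nlinarith [P.m0]
  · have := Rt_high P H hρ.2 hP.2.2.2 hx
    rw [← hB] at this
    refine this.trans ?_
    calc _ = B * (Real.exp (-a*L) + ρ * Real.exp (a*L))
              * normX m L ρ (fun t => h1 t - h2 t) * Real.exp (-(1/2)*(x-L*ρ)) := by ring
      _ ≤ _ := by gcongr
end
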